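/- Let A be a negative square-free integer with A ≡ 1 or 25 (mod 36). Then limsup_{X→∞} ( Σ_{D ∈ N⁺(X,1,12|A|)} rank E_D(ℚ) ) / ( #N⁺(X,1,12|A|) ) ≤ 4/3. -/

import Mathlib

open Filter

/-- The Mordell curve `y² = x³ + a` as a Weierstrass curve over `ℚ`. -/
noncomputable def MordellCurve (a : ℤ) : WeierstrassCurve ℚ :=
  { a₁ := 0, a₂ := 0, a₃ := 0, a₄ := 0, a₆ := (a : ℚ) }

/-- The Mordell–Weil rank of `y² = x³ + a` over `ℚ`. -/
noncomputable def mordellRank (a : ℤ) : ℕ :=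
  Module.finrank ℤ (MordellCurve a).toAffine.Point

/-- An integer is a fundamental discriminant if it is the discriminant of a quadratic
number field: `Δ ≠ 1` and either `Δ` is square-free with `Δ ≡ 1 (mod 4)`, or `Δ = 4·m'`
with `m'` square-free and `m' ≡ 2` or `3 (mod 4)`. -/
def IsFundamentalDiscriminant (Δ : ℤ) : Prop :=
  Δ ≠ 1 ∧ ((Squarefree Δ ∧ Δ % 4 = 1) ∨
    ∃ m' : ℤ, Δ = 4 * m' ∧ Squarefree m' ∧ (m' % 4 = 2 ∨ m' % 4 = 3))

/-- `Nplus X m N` is the set of fundamental discriminants `Δ` with `0 < Δ < X` and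
`Δ ≡ m (mod N)`. -/
def Nplus (X : ℝ) (m N : ℤ) : Set ℤ :=
  {Δ : ℤ | 0 < Δ ∧ (Δ : ℝ) < X ∧ IsFundamentalDiscriminant Δ ∧ Δ ≡ m [ZMOD N]}

/-- The curve `y² = x³ + k` over a field. -/
def MC {F : Type*} [Field F] (k : F) : WeierstrassCurve F :=
  { a₁ := 0, a₂ := 0, a₃ := 0, a₄ := 0, a₆ := k }

section curve
variable {F : Type*} [Field F] [DecidableEq F] {k : F}

open WeierstrassCurve WeierstrassCurve.Affine

lemma MC_negY (x y : F) : (MC k).toAffine.negY x y = -y := by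
  simp [WeierstrassCurve.Affine.negY, MC]

lemma MC_equation (x y : F) : (MC k).toAffine.Equation x y ↔ y ^ 2 = x ^ 3 + k := by
  rw [WeierstrassCurve.Affine.equation_iff]; simp [MC]

lemma MC_eq_of_ns {x y : F} (h : (MC k).toAffine.Nonsingular x y) : y ^ 2 = x ^ 3 + k :=
  (MC_equation x y).1 h.1

lemma MC_nonsingular [CharZero F] (hk : k ≠ 0) {x y : F} (h : y ^ 2 = x ^ 3 + k) :
    (MC k).toAffine.Nonsingular x y := by
  rw [WeierstrassCurve.Affine.nonsingular_iff]
  refine ⟨(MC_equation x y).2 h, ?_⟩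
  simp only [MC]
  by_contra hc
  push Not at hc
  obtain ⟨h1, h2⟩ := hc
  have hy : y = 0 := by
    have : 2 * y = 0 := by linear_combination h2
    simpa using this
  have hx : x = 0 := by
    have : 3 * x ^ 2 = 0 := by linear_combination -h1
    simpa using this
  subst hx hy
  apply hk
  linear_combination -h

lemma MC_isElliptic [CharZero F] (hk : k ≠ 0) : (MC k).IsElliptic := by
  constructor
  have : (MC k).Δ = -432 * k ^ 2 := by
    simp [WeierstrassCurve.Δ, WeierstrassCurve.b₂, WeierstrassCurve.b₄, WeierstrassCurve.b₆,
      WeierstrassCurve.b₈, MC]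
    ring
  rw [this]
  have : (-432 * k ^ 2 : F) ≠ 0 := by simp [hk]
  exact this.isUnit

lemma MC_addX (x₁ x₂ l : F) : (MC k).toAffine.addX x₁ x₂ l = l ^ 2 - x₁ - x₂ := by
  simp [WeierstrassCurve.Affine.addX, MC]

lemma MC_addY (x₁ x₂ y₁ l : F) :
    (MC k).toAffine.addY x₁ x₂ y₁ l = -(l * (l ^ 2 - x₁ - x₂ - x₁) + y₁) := by
  simp [WeierstrassCurve.Affine.addY, WeierstrassCurve.Affine.negAddY,
    WeierstrassCurve.Affine.negY, MC_addX, MC]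

lemma MC_slope_ne {x₁ x₂ y₁ y₂ : F} (h : x₁ ≠ x₂) :
    (MC k).toAffine.slope x₁ x₂ y₁ y₂ = (y₁ - y₂) / (x₁ - x₂) :=
  WeierstrassCurve.Affine.slope_of_X_ne h

lemma MC_slope_eq {x y : F} (h : y ≠ -y) :
    (MC k).toAffine.slope x x y y = 3 * x ^ 2 / (2 * y) := by
  rw [WeierstrassCurve.Affine.slope_of_Y_ne rfl (by rwa [MC_negY])]
  simp [MC_negY]
  simp [MC]
  ring

lemma sym2x_addSub [CharZero F] (hk : k ≠ 0) (P Q : (MC k).toAffine.Point) :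
    ∃ c : F, c ≠ 0 ∧ (fun i ↦ (addSubMap (MC k) i).eval (Point.sym2x P Q)) =
      c • Point.sym2x (P + Q) (P - Q) := by
  have key : ∀ v : Fin 3 → F, (fun i ↦ (addSubMap (MC k) i).eval v) =
      ![v 0 ^ 2 - 4 * k * v 1 * v 2, 2 * v 1 * v 0 + 4 * k * v 2 ^ 2, v 1 ^ 2 - 4 * v 0 * v 2] := by
    intro v
    ext i
    fin_cases i <;> simp [addSubMap, WeierstrassCurve.b₂, WeierstrassCurve.b₄,
      WeierstrassCurve.b₆, WeierstrassCurve.b₈, MC]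
  rw [key]
  have self : ∀ P : (MC k).toAffine.Point, ∃ c : F, c ≠ 0 ∧
      (let v := Point.sym2x P P
      ![v 0 ^ 2 - 4 * k * v 1 * v 2, 2 * v 1 * v 0 + 4 * k * v 2 ^ 2, v 1 ^ 2 - 4 * v 0 * v 2] =
      c • Point.sym2x (P + P) 0) := by
    rintro (_ | ⟨x, y, h⟩)
    · refine ⟨1, one_ne_zero, ?_⟩
      simp [← Point.zero_def]
    · have he := MC_eq_of_ns h
      by_cases hy : y = -y
      · have hy0 : y = 0 := by
          have : 2 * y = 0 := by linear_combination hy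
          simpa using this
        rw [Point.add_self_of_Y_eq (by rwa [MC_negY])]
        refine ⟨9 * x ^ 4, ?_, ?_⟩
        · have : x ≠ 0 := by
            rintro rfl
            apply hk; rw [hy0] at he; linear_combination -he
          simp [this]
        · subst hy0
          simp only [Point.sym2x_some_some, Point.sym2x_zero_zero]
          ext i
          fin_cases i
          · simp; linear_combination (8 * x) * he
          · simp; linear_combination (-4) * he
          · simp; ring
      · rw [Point.add_self_of_Y_ne (by rwa [MC_negY])]
        have hy0 : y ≠ 0 := by
          rintro rfl; simp at hy
        refine ⟨4 * y ^ 2, by simp [hy0], ?_⟩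
        simp only [Point.sym2x_some_some, Point.sym2x_some_zero, MC_slope_eq hy, MC_addX]
        ext i
        fin_cases i
        · simp
          field_simp
          linear_combination (32 * x) * he
        · simp; linear_combination (-4) * he
        · simp; ring
  rcases P with _ | ⟨x₁, y₁, h₁⟩
  · rcases Q with _ | ⟨x₂, y₂, h₂⟩
    · refine ⟨1, one_ne_zero, ?_⟩
      simp [← Point.zero_def]
    · refine ⟨1, one_ne_zero, ?_⟩
      simp only [← Point.zero_def, zero_add, zero_sub, Point.sym2x_neg_right]
      ext i
      fin_cases i <;> simp <;> ring
  · rcases Q with _ | ⟨x₂, y₂, h₂⟩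
    · refine ⟨1, one_ne_zero, ?_⟩
      simp only [← Point.zero_def, add_zero, sub_zero]
      ext i
      fin_cases i <;> simp <;> ring
    · by_cases hx : x₁ = x₂
      · rcases (Point.X_eq_iff (h₁ := h₁) (h₂ := h₂)).1 hx with h | h
        · rw [h, sub_self]
          exact self _
        · rw [h, neg_add_cancel, Point.sym2x_neg_left, ← neg_add', Point.sym2x_comm 0,
            Point.sym2x_neg_left]
          exact self _
      · have e1 := MC_eq_of_ns h₁
        have e2 := MC_eq_of_ns h₂
        refine ⟨(x₁ - x₂) ^ 2, by simpa [sub_eq_zero] using hx, ?_⟩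
        have hx' : x₁ - x₂ ≠ 0 := sub_ne_zero.2 hx
        rw [sub_eq_add_neg (Point.some x₁ y₁ h₁), Point.neg_some, Point.add_of_X_ne hx, Point.add_of_X_ne hx]
        simp only [Point.sym2x_some_some, MC_slope_ne hx, MC_addX, MC_negY]
        have hk' : k = y₁ ^ 2 - x₁ ^ 3 := by linear_combination -e1
        have hy2 : y₂ ^ 2 = x₂ ^ 3 + (y₁ ^ 2 - x₁ ^ 3) := by rw [← hk']; exact e2
        ext i
        fin_cases i
        · simp
          field_simp
          rw [hk']
          have h4 : y₂ ^ 4 = (x₂ ^ 3 + (y₁ ^ 2 - x₁ ^ 3)) ^ 2 := by rw [← hy2]; ring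
          ring_nf
          rw [h4, hy2]
          ring
        · simp
          field_simp
          rw [hk']
          ring_nf
          rw [hy2]
          ring
        · simp
          ring

end curve

open WeierstrassCurve WeierstrassCurve.Affine in
lemma MC_parallelogram {k : ℚ} (hk : k ≠ 0) :
    ∃ C : ℝ, ∀ P Q : (MC k).toAffine.Point,
      |Height.logHeight (P + Q).xRep + Height.logHeight (P - Q).xRep
        - 2 * (Height.logHeight P.xRep + Height.logHeight Q.xRep)| ≤ C := by
  have := MC_isElliptic hk
  obtain ⟨C₁, h₁⟩ := abs_logHeight_addSubMap_sub_two_mul_logHeight_le (MC k)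
  obtain ⟨C₂, h₂⟩ := Height.abs_logHeight_sym2_sub_le ℚ
  have h₂' : ∀ P Q : (MC k).toAffine.Point, |Height.logHeight (Point.sym2x P Q) -
      (Height.logHeight P.xRep + Height.logHeight Q.xRep)| ≤ C₂ := by
    intro P Q
    have e : ∀ P : (MC k).toAffine.Point, ![P.xRep 0, P.xRep 1] = P.xRep := by
      intro P; ext i; fin_cases i <;> rfl
    have := h₂ (a := P.xRep 0) (b := P.xRep 1) (c := Q.xRep 0) (d := Q.xRep 1)
      (by rw [e]; exact P.xRep_ne_zero) (by rw [e]; exact Q.xRep_ne_zero)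
    rw [e, e] at this
    exact this
  refine ⟨C₁ + 3 * C₂, fun P Q ↦ ?_⟩
  obtain ⟨c, hc, h⟩ := sym2x_addSub hk P Q
  have a1 := h₁ (Point.sym2x P Q)
  rw [h, Height.logHeight_smul_eq_logHeight _ hc] at a1
  have a2 := h₂' P Q
  have a3 := h₂' (P + Q) (P - Q)
  rw [abs_le] at *
  constructor <;> linarith [a1.1, a1.2, a2.1, a2.2, a3.1, a3.2]

lemma MC_northcott {k : ℚ} :
    Northcott (fun P : (MC k).toAffine.Point ↦ Height.logHeight P.xRep) := by
  constructor
  intro B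
  have hf : {x : ℚ | Height.logHeight₁ x ≤ B}.Finite := Northcott.finite_le B
  have hf2 : (insert ![1, 0] ((fun x : ℚ ↦ ![x, 1]) '' {x : ℚ | Height.logHeight₁ x ≤ B})).Finite :=
    (hf.image _).insert _
  refine Set.Finite.of_finite_fibers (WeierstrassCurve.Affine.Point.xRep) (hf2.subset ?_) ?_
  · rintro _ ⟨P, hP, rfl⟩
    rcases P with _ | ⟨x, y, h⟩
    · left; rfl
    · right
      refine ⟨x, ?_, rfl⟩
      simp only [Set.mem_ofPred_eq, WeierstrassCurve.Affine.Point.xRep_some] at hP ⊢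
      rwa [Height.logHeight₁_eq_logHeight]
  · rintro _ ⟨P, hP, rfl⟩
    refine (Set.toFinite {P, -P}).subset ?_
    rintro Q ⟨_, hQ⟩
    exact WeierstrassCurve.Affine.Point.eq_or_eq_neg_of_xRep_eq_xRep hQ

lemma MC_fg {k : ℚ} (hk : k ≠ 0)
    (h : (nsmulAddMonoidHom (α := (MC k).toAffine.Point) 3).range.FiniteIndex) :
    AddGroup.FG (MC k).toAffine.Point := by
  obtain ⟨C, hC⟩ := MC_parallelogram hk
  have := MC_northcott (k := k)
  set hh := (fun P : (MC k).toAffine.Point ↦ Height.logHeight P.xRep) with hh_def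
  have hC' : ∀ P Q, |hh (P + Q) + hh (P - Q) - 2 * (hh P + hh Q)| ≤ C := hC
  have h0 : ∀ P, 0 ≤ hh P := fun P ↦ Height.logHeight_nonneg _
  refine AddCommGroup.fg_of_descent (h := hh) (n := 3) (a := 2) (b := 9)
    (c := fun g ↦ 2 * hh (-g) + C) (c₀ := 3 * C + 2 * hh 0) (by norm_num) (by norm_num) h ?_ ?_
  · intro g x
    have := hC' (g + x) (-g)
    rw [abs_le] at this
    have e1 : g + x + -g = x := by abel
    rw [e1] at this
    linarith [h0 (g + x - -g), this.1, this.2]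
  · intro x
    have a1 := hC' x x
    have a2 := hC' (2 • x) x
    rw [abs_le] at a1 a2
    have e1 : x + x = 2 • x := by abel
    have e2 : (2 • x) + x = 3 • x := by abel
    have e3 : (2 • x) - x = x := by abel
    rw [e1, sub_self] at a1
    rw [e2, e3] at a2
    linarith [a1.1, a1.2, a2.1, a2.2, h0 x, h0 0]

/-- rank bound from the index of `3 G` for a finitely generated group. -/
lemma pow_finrank_le_index {G : Type*} [AddCommGroup G] [AddGroup.FG G]
    (h0 : (nsmulAddMonoidHom (α := G) 3).range.index ≠ 0) :
    3 ^ Module.finrank ℤ G ≤ (nsmulAddMonoidHom (α := G) 3).range.index := by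
  have : Module.Finite ℤ G := Module.Finite.iff_addGroup_fg.2 inferInstance
  set n := Module.finrank ℤ G with hn
  have hn' : Module.finrank ℤ (G ⧸ Submodule.torsion ℤ G) = n := by
    rw [Module.finrank, rank_quotient_eq_of_le_torsion le_rfl]; rfl
  let b := Module.finBasisOfFinrankEq ℤ (G ⧸ Submodule.torsion ℤ G) hn'
  let f1 : G →+ (G ⧸ Submodule.torsion ℤ G) := (Submodule.mkQ (Submodule.torsion ℤ G)).toAddMonoidHom
  let f2 : (G ⧸ Submodule.torsion ℤ G) →+ (Fin n → ℤ) := b.equivFun.toLinearMap.toAddMonoidHom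
  let f3 : (Fin n → ℤ) →+ (Fin n → ZMod 3) :=
    { toFun := fun v i ↦ (v i : ZMod 3)
      map_zero' := by ext; simp
      map_add' := by intros; ext; simp }
  let f : G →+ (Fin n → ZMod 3) := f3.comp (f2.comp f1)
  have hs : Function.Surjective f := by
    have s1 : Function.Surjective f1 := Submodule.mkQ_surjective _
    have s2 : Function.Surjective f2 := b.equivFun.surjective
    have s3 : Function.Surjective f3 := by
      intro w
      refine ⟨fun i ↦ ((w i).val : ℤ), ?_⟩
      ext i
      simp [f3]
    exact s3.comp (s2.comp s1)
  have hi : f.ker.index = 3 ^ n := by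
    rw [AddSubgroup.index_ker, AddMonoidHom.range_eq_top.2 hs]
    simp
  have hle : (nsmulAddMonoidHom (α := G) 3).range ≤ f.ker := by
    rintro _ ⟨x, rfl⟩
    rw [AddMonoidHom.mem_ker]
    simp only [nsmulAddMonoidHom_apply, map_nsmul]
    ext i
    have : (3 : ZMod 3) = 0 := rfl
    simp [this]
  rw [← hi]
  exact Nat.le_of_dvd (Nat.pos_of_ne_zero h0) (AddSubgroup.index_dvd_of_le hle)

lemma MC_rank_le {k : ℚ} (hk : k ≠ 0) {r : ℕ}
    (h0 : (nsmulAddMonoidHom (α := (MC k).toAffine.Point) 3).range.index ≠ 0)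
    (h : (nsmulAddMonoidHom (α := (MC k).toAffine.Point) 3).range.index ≤ 3 ^ r) :
    Module.finrank ℤ (MC k).toAffine.Point ≤ r := by
  have := MC_fg hk ⟨h0⟩
  have := (pow_finrank_le_index (G := (MC k).toAffine.Point) h0).trans h
  exact (Nat.pow_le_pow_iff_right (by norm_num)).1 this

section hom
open WeierstrassCurve WeierstrassCurve.Affine
variable {F L : Type*} [Field F] [DecidableEq F] [Field L] [DecidableEq L]

lemma MC_ns_map [CharZero F] [CharZero L] {k : F} (φ : F →+* L) (u : L) {k' : L} (hk0 : k' ≠ 0)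
    (hk : k' = φ k * u ^ 6) {x y : F} (h : (MC k).toAffine.Nonsingular x y) :
    (MC k').toAffine.Nonsingular (φ x * u ^ 2) (φ y * u ^ 3) := by
  apply MC_nonsingular hk0
  have := congrArg φ (MC_eq_of_ns h)
  simp only [map_pow, map_add] at this
  rw [hk]; linear_combination u ^ 6 * this

/-- the scaling map on points -/
def scaleFun [CharZero F] [CharZero L] {k : F} (φ : F →+* L) (u : L) {k' : L} (hk0 : k' ≠ 0)
    (hk : k' = φ k * u ^ 6) : (MC k).toAffine.Point → (MC k').toAffine.Point
  | Point.zero => 0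
  | Point.some x y h => Point.some (φ x * u ^ 2) (φ y * u ^ 3) (MC_ns_map φ u hk0 hk h)

lemma some_congr {W : WeierstrassCurve.Affine F} {x x' y y' : F} (h : W.Nonsingular x y)
    (h' : W.Nonsingular x' y') (hx : x = x') (hy : y = y') :
    Point.some x y h = Point.some x' y' h' := by
  subst hx hy; rfl

lemma MC_add_neg {k : F} {x y x' y' : F} (h : (MC k).toAffine.Nonsingular x y)
    (h' : (MC k).toAffine.Nonsingular x' y') (hx : x = x') (hy : y = - y') :
    Point.some x y h + Point.some x' y' h' = 0 := by
  apply Point.add_of_Y_eq hx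
  rw [MC_negY, hy]

/-- addition with explicit formula -/
lemma MC_add_ne [CharZero F] {k : F} (hk : k ≠ 0) {x y x' y' : F}
    (h : (MC k).toAffine.Nonsingular x y)
    (h' : (MC k).toAffine.Nonsingular x' y') (hx : x ≠ x') (l X Y : F) (hl : l = (y - y') / (x - x'))
    (hX : X = l ^ 2 - x - x') (hY : Y = -(l * (X - x) + y)) :
    ∃ H, Point.some x y h + Point.some x' y' h' = Point.some X Y H := by
  have e := Point.add_of_X_ne (h₁ := h) (h₂ := h') hx
  have e1 : (MC k).toAffine.addX x x' ((MC k).toAffine.slope x x' y y') = X := by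
    rw [MC_slope_ne hx, MC_addX, hX, hl]
  have e2 : (MC k).toAffine.addY x x' y ((MC k).toAffine.slope x x' y y') = Y := by
    rw [MC_slope_ne hx, MC_addY, hY, hX, hl]
  refine ⟨?_, ?_⟩
  · rw [← e1, ← e2]
    exact nonsingular_add h h' (fun hh ↦ hx hh.1)
  · rw [e]; exact some_congr _ _ e1 e2

lemma MC_add_self [CharZero F] {k : F} (hk : k ≠ 0) {x y x' y' : F}
    (h : (MC k).toAffine.Nonsingular x y)
    (h' : (MC k).toAffine.Nonsingular x' y') (hx : x = x') (hy : y = y') (hy0 : y ≠ 0)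
    (l X Y : F) (hl : l = 3 * x ^ 2 / (2 * y))
    (hX : X = l ^ 2 - x - x) (hY : Y = -(l * (X - x) + y)) :
    ∃ H, Point.some x y h + Point.some x' y' h' = Point.some X Y H := by
  subst hx hy
  have hy : y ≠ -y := by
    intro hh
    have : 2 * y = 0 := by linear_combination hh
    simp [hy0] at this
  have hy' : y ≠ (MC k).toAffine.negY x y := by rwa [MC_negY]
  have e := Point.add_self_of_Y_ne (h₁ := h) hy'
  have e1 : (MC k).toAffine.addX x x ((MC k).toAffine.slope x x y y) = X := by
    rw [MC_slope_eq hy, MC_addX, hX, hl]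
  have e2 : (MC k).toAffine.addY x x y ((MC k).toAffine.slope x x y y) = Y := by
    rw [MC_slope_eq hy, MC_addY, hY, hX, hl]
  refine ⟨?_, ?_⟩
  · rw [← e1, ← e2]
    exact nonsingular_add h h (fun hh ↦ hy' hh.2)
  · rw [e]; exact some_congr _ _ e1 e2

lemma scaleFun_add [CharZero F] [CharZero L] {k : F} (φ : F →+* L) (u : L) {k' : L} (hk0 : k' ≠ 0)
    (hk : k' = φ k * u ^ 6) (P Q : (MC k).toAffine.Point) :
    scaleFun φ u hk0 hk (P + Q) = scaleFun φ u hk0 hk P + scaleFun φ u hk0 hk Q := by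
  have hu : u ≠ 0 := by rintro rfl; simp at hk; exact hk0 hk
  have hk1 : k ≠ 0 := by rintro rfl; simp at hk; exact hk0 hk
  rcases P with _ | ⟨x₁, y₁, h₁⟩
  · change scaleFun φ u hk0 hk (0 + Q) = 0 + scaleFun φ u hk0 hk Q
    rw [zero_add, zero_add]
  rcases Q with _ | ⟨x₂, y₂, h₂⟩
  · change scaleFun φ u hk0 hk (_ + 0) = scaleFun φ u hk0 hk _ + 0
    rw [add_zero, add_zero]
  by_cases hx : x₁ = x₂
  · rcases (Point.X_eq_iff (h₁ := h₁) (h₂ := h₂)).1 hx with h | h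
    · by_cases hy : y₁ = 0
      · injection h with hx' hy'
        rw [MC_add_neg h₁ h₂ hx' (by rw [← hy', hy]; simp)]
        simp only [scaleFun]
        rw [MC_add_neg _ _ (by rw [hx']) (by rw [← hy', hy]; simp)]
      · injection h with hx' hy'
        obtain ⟨H, e⟩ := MC_add_self hk1 h₁ h₂ hx' hy' hy _ _ _ rfl rfl rfl
        rw [e]
        simp only [scaleFun]
        obtain ⟨H2, e2⟩ := MC_add_self hk0 (MC_ns_map φ u hk0 hk h₁) (MC_ns_map φ u hk0 hk h₂)
          (by rw [hx']) (by rw [hy']) (by simp [hy, hu]) _ _ _ rfl rfl rfl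
        rw [e2]
        have hy2 : φ y₁ ≠ 0 := by simpa using hy
        apply some_congr
        · simp only [map_sub, map_pow, map_div₀, map_mul, map_ofNat]
          field_simp
        · simp only [map_sub, map_pow, map_div₀, map_mul, map_ofNat, map_neg, map_add]
          field_simp
    · rw [Point.neg_some] at h
      injection h with hx' hy'
      rw [MC_negY] at hy'
      rw [MC_add_neg h₁ h₂ hx' hy']
      simp only [scaleFun]
      rw [MC_add_neg _ _ (by rw [hx']) (by rw [hy']; simp)]
  · have hx2 : φ x₁ ≠ φ x₂ := fun h ↦ hx (φ.injective h)
    have hx3 : φ x₁ * u ^ 2 ≠ φ x₂ * u ^ 2 := fun h ↦ hx2 (mul_right_cancel₀ (pow_ne_zero 2 hu) h)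
    obtain ⟨H, e⟩ := MC_add_ne hk1 h₁ h₂ hx _ _ _ rfl rfl rfl
    rw [e]
    simp only [scaleFun]
    obtain ⟨H2, e2⟩ := MC_add_ne hk0 (MC_ns_map φ u hk0 hk h₁) (MC_ns_map φ u hk0 hk h₂)
      hx3 _ _ _ rfl rfl rfl
    rw [e2]
    have h4 : φ x₁ - φ x₂ ≠ 0 := sub_ne_zero.2 hx2
    have e3 : (φ y₁ * u ^ 3 - φ y₂ * u ^ 3) / (φ x₁ * u ^ 2 - φ x₂ * u ^ 2) =
      u * ((φ y₁ - φ y₂) / (φ x₁ - φ x₂)) := by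
      rw [← sub_mul, ← sub_mul]; field_simp
    apply some_congr
    · rw [e3]
      simp only [map_sub, map_pow, map_div₀, map_mul, map_ofNat]
      ring
    · rw [e3]
      simp only [map_sub, map_pow, map_div₀, map_mul, map_ofNat, map_neg, map_add]
      ring

def scale [CharZero F] [CharZero L] {k : F} (φ : F →+* L) (u : L) {k' : L} (hk0 : k' ≠ 0)
    (hk : k' = φ k * u ^ 6) : (MC k).toAffine.Point →+ (MC k').toAffine.Point where
  toFun := scaleFun φ u hk0 hk
  map_zero' := rfl
  map_add' := scaleFun_add φ u hk0 hk

lemma scale_some [CharZero F] [CharZero L] {k : F} (φ : F →+* L) (u : L) {k' : L} (hk0 : k' ≠ 0)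
    (hk : k' = φ k * u ^ 6) {x y : F} (h : (MC k).toAffine.Nonsingular x y) :
    scale φ u hk0 hk (Point.some x y h) =
      Point.some (φ x * u ^ 2) (φ y * u ^ 3) (MC_ns_map φ u hk0 hk h) := rfl

lemma scale_inj [CharZero F] [CharZero L] {k : F} (φ : F →+* L) (u : L) {k' : L} (hk0 : k' ≠ 0)
    (hk : k' = φ k * u ^ 6) : Function.Injective (scale φ u hk0 hk) := by
  have hu : u ≠ 0 := by rintro rfl; simp at hk; exact hk0 hk
  rw [injective_iff_map_eq_zero]
  rintro (_ | ⟨x, y, h⟩) hP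
  · rfl
  · rw [scale_some] at hP
    exact absurd hP (by simp)

end hom

section descent
open WeierstrassCurve WeierstrassCurve.Affine

/-- `√-3` -/
noncomputable def s3 : ℂ := (Real.sqrt 3 : ℂ) * Complex.I

lemma s3_sq : s3 ^ 2 = -3 := by
  have : ((Real.sqrt 3 : ℝ) : ℂ) ^ 2 = 3 := by
    rw [← Complex.ofReal_pow, Real.sq_sqrt (by norm_num)]; simp
  rw [s3, mul_pow, this, Complex.I_sq]; ring

lemma s3_ne : s3 ≠ 0 := by
  intro h; have := s3_sq; rw [h] at this; norm_num at this

noncomputable def om : ℂ := (-1 + s3) / 2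

lemma om_sq : om ^ 2 = -1 - om := by
  rw [om]; linear_combination (1/4 : ℂ) * s3_sq

lemma om_cube : om ^ 3 = 1 := by
  linear_combination (om - 1) * om_sq

lemma om_ne : om ≠ 0 := by
  intro h; have := om_cube; rw [h] at this; norm_num at this

variable {k : ℚ}

lemma cast_ne (hk : k ≠ 0) : (k : ℂ) ≠ 0 := by exact_mod_cast hk

/-- multiplication by `ω`: `(ω x, y)`. -/
noncomputable def mulOm (hk : k ≠ 0) : (MC (k : ℂ)).toAffine.Point →+ (MC (k : ℂ)).toAffine.Point :=
  scale (RingHom.id ℂ) (om ^ 2) (cast_ne hk) (by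
    have : (om ^ 2) ^ 6 = 1 := by rw [← pow_mul, show 2 * 6 = 3 * 4 by norm_num, pow_mul, om_cube]; simp
    rw [this]; simp)

lemma mulOm_some (hk : k ≠ 0) {x y : ℂ} (h : (MC (k : ℂ)).toAffine.Nonsingular x y) :
    ∃ H, mulOm hk (Point.some x y h) = Point.some (om * x) y H := by
  have e1 : (om ^ 2) ^ 2 = om := by linear_combination om * om_cube
  have e2 : (om ^ 2) ^ 3 = 1 := by linear_combination (om ^ 3 + 1) * om_cube
  have : (MC (k : ℂ)).toAffine.Nonsingular (om * x) y := by
    apply MC_nonsingular (cast_ne hk)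
    linear_combination MC_eq_of_ns h - x ^ 3 * om_cube
  refine ⟨this, ?_⟩
  rw [mulOm, scale_some]
  apply some_congr
  · simp [e1, mul_comm]
  · simp [e2]

/-- the endomorphism `√-3 = ω - ω²` -/
noncomputable def TT (hk : k ≠ 0) : (MC (k : ℂ)).toAffine.Point →+ (MC (k : ℂ)).toAffine.Point :=
  mulOm hk - (mulOm hk).comp (mulOm hk)

lemma TT_some_zero (hk : k ≠ 0) {x y : ℂ} (h : (MC (k : ℂ)).toAffine.Nonsingular x y)
    (hx : x = 0) : TT hk (Point.some x y h) = 0 := by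
  obtain ⟨H, e⟩ := mulOm_some hk h
  have e' : mulOm hk (Point.some x y h) = Point.some x y h := by
    rw [e]; exact some_congr _ _ (by rw [hx]; simp) rfl
  simp [TT, e']

lemma TT_some (hk : k ≠ 0) {x y : ℂ} (h : (MC (k : ℂ)).toAffine.Nonsingular x y)
    (hx : x ≠ 0) : ∃ H, TT hk (Point.some x y h) =
      Point.some (x - 4 * y ^ 2 / (3 * x ^ 2)) (s3 * y * (9 * x ^ 3 - 8 * y ^ 2) / (9 * x ^ 3)) H := by
  obtain ⟨H, e⟩ := mulOm_some hk h
  obtain ⟨H2, e2⟩ := mulOm_some hk H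
  have e3 : TT hk (Point.some x y h) = Point.some (om * x) y H + -(Point.some (om * (om * x)) y H2) := by
    simp [TT, e, e2, sub_eq_add_neg]
  rw [e3, Point.neg_some]
  have hs := s3_ne
  have d : om * x - om * (om * x) = s3 * x := by
    have : om - om ^ 2 = s3 := by rw [om_sq, om]; ring
    linear_combination x * this
  apply MC_add_ne (cast_ne hk) H _ _ (2 * y / (s3 * x))
  · rw [MC_negY, d]; ring
  · have e5 : (2 * y / (s3 * x)) ^ 2 = - (4 * y ^ 2 / (3 * x ^ 2)) := by
      rw [div_pow, mul_pow s3, s3_sq]; field_simp; ring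
    rw [e5]; linear_combination x * om_sq
  · have e6 : (1 : ℂ) / s3 = - s3 / 3 := by
      field_simp; linear_combination s3_sq
    have e7 : 2 * y / (s3 * x) = 2 * y / x * (-s3 / 3) := by rw [← e6]; field_simp
    rw [e7, om]
    field_simp
    linear_combination (27 * y * x^3) * s3_sq
  · intro hh
    have : s3 * x = 0 := by rw [← d]; exact sub_eq_zero.2 hh
    simp [hs, hx] at this

lemma om_sum (hk : k ≠ 0) (P : (MC (k : ℂ)).toAffine.Point) :
    P + mulOm hk P + mulOm hk (mulOm hk P) = 0 := by
  rcases P with _ | ⟨x, y, h⟩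
  · change (0 : (MC (k : ℂ)).toAffine.Point) + mulOm hk 0 + mulOm hk (mulOm hk 0) = 0
    simp
  obtain ⟨H, e⟩ := mulOm_some hk h
  obtain ⟨H2, e2⟩ := mulOm_some hk H
  rw [e, e2]
  by_cases hx : x = 0
  · subst hx
    have hy : y ≠ 0 := by
      rintro rfl; have := MC_eq_of_ns h; simp at this; exact hk (by exact_mod_cast this.symm)
    obtain ⟨H3, e3⟩ := MC_add_self (cast_ne hk) h H (by simp) rfl hy 0 0 (-y) (by simp) (by simp) (by simp)
    rw [e3, MC_add_neg _ _ (by simp) (by simp)]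
  · have hne : x ≠ om * x := by
      intro hh
      have h1 : om = 1 := by
        have : om * x = 1 * x := by rw [one_mul]; exact hh.symm
        exact mul_right_cancel₀ hx this
      have := om_sq; rw [h1] at this; norm_num at this
    obtain ⟨H3, e3⟩ := MC_add_ne (cast_ne hk) h H hne 0 (om * (om * x)) (-y) (by simp)
      (by linear_combination x * om_sq) (by simp)
    rw [e3, MC_add_neg _ _ rfl rfl]

lemma TT_TT (hk : k ≠ 0) (P : (MC (k : ℂ)).toAffine.Point) : TT hk (TT hk P) = -((3 : ℕ) • P) := by
  have h0 := om_sum hk P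
  have h1 := om_sum hk (mulOm hk P)
  simp only [TT, AddMonoidHom.sub_apply, AddMonoidHom.comp_apply, map_sub]
  set a := mulOm hk P
  set b := mulOm hk a
  have hb : b = -P - a := by
    rw [← sub_eq_zero, ← h0]; abel
  have hc : mulOm hk b = P := by
    have : mulOm hk b = -a - b := by rw [← sub_eq_zero, ← h1]; abel
    rw [this, hb]; abel
  rw [hc]
  change b - P - (P - a) = _
  rw [hb]; abel

lemma hkneg (hk : k ≠ 0) : (-27 * k) ≠ 0 := by simpa using hk

/-- embedding of `E(ℚ)` -/
noncomputable def embA (hk : k ≠ 0) : (MC k).toAffine.Point →+ (MC (k : ℂ)).toAffine.Point :=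
  scale (algebraMap ℚ ℂ) 1 (cast_ne hk) (by simp)

/-- embedding of `E'(ℚ)` -/
noncomputable def embB (hk : k ≠ 0) : (MC (-27 * k)).toAffine.Point →+ (MC (k : ℂ)).toAffine.Point :=
  scale (algebraMap ℚ ℂ) (1 / s3) (cast_ne hk) (by
    have : s3 ^ 6 = -27 := by rw [show 6 = 2 * 3 by norm_num, pow_mul, s3_sq]; norm_num
    rw [div_pow, this]; simp; ring)

lemma embA_some (hk : k ≠ 0) {x y : ℚ} (h : (MC k).toAffine.Nonsingular x y) :
    ∃ H, embA hk (Point.some x y h) = Point.some (x : ℂ) (y : ℂ) H := by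
  refine ⟨?_, ?_⟩
  · apply MC_nonsingular (cast_ne hk)
    exact_mod_cast MC_eq_of_ns h
  · rw [embA, scale_some]; exact some_congr _ _ (by simp) (by simp)

lemma embB_some (hk : k ≠ 0) {x y : ℚ} (h : (MC (-27 * k)).toAffine.Nonsingular x y) :
    ∃ H, embB hk (Point.some x y h) = Point.some (-(x : ℂ) / 3) (s3 * (y : ℂ) / 9) H := by
  refine ⟨?_, ?_⟩
  · apply MC_nonsingular (cast_ne hk)
    have : (y : ℂ) ^ 2 = x ^ 3 + (-27 * k) := by exact_mod_cast MC_eq_of_ns h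
    linear_combination (-3/81) * this + (y : ℂ) ^ 2 / 81 * s3_sq
  · rw [embB, scale_some]
    have hs := s3_ne
    refine some_congr _ _ ?_ ?_
    · simp; rw [s3_sq]; ring
    · simp; field_simp; rw [show s3 ^ 4 = (s3 ^ 2) ^ 2 by ring, s3_sq]; ring

lemma exists_f (hk : k ≠ 0) (P : (MC k).toAffine.Point) : ∃ P', TT hk (embA hk P) = embB hk P' := by
  rcases P with _ | ⟨x, y, h⟩
  · exact ⟨0, by rw [map_zero]; change TT hk (embA hk 0) = 0; simp⟩
  obtain ⟨H, e⟩ := embA_some hk h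
  rw [e]
  by_cases hx : x = 0
  · exact ⟨0, by rw [map_zero, TT_some_zero]; simpa using hx⟩
  · have hx' : (x : ℂ) ≠ 0 := by exact_mod_cast hx
    obtain ⟨H1, e1⟩ := TT_some hk H hx'
    rw [e1]
    have he := MC_eq_of_ns h
    have hk' : k = y ^ 2 - x ^ 3 := by linear_combination -he
    have hn : (MC (-27 * k)).toAffine.Nonsingular (-3 * (x - 4 * y ^ 2 / (3 * x ^ 2)))
        (y * (9 * x ^ 3 - 8 * y ^ 2) / x ^ 3) := by
      apply MC_nonsingular (hkneg hk)
      rw [hk']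
      field_simp
      ring
    refine ⟨Point.some _ _ hn, ?_⟩
    obtain ⟨H2, e2⟩ := embB_some hk hn
    rw [e2]
    apply some_congr
    · push_cast; field_simp
    · push_cast; field_simp

lemma exists_g (hk : k ≠ 0) (P : (MC (-27 * k)).toAffine.Point) :
    ∃ P', TT hk (embB hk P) = embA hk P' := by
  rcases P with _ | ⟨x, y, h⟩
  · exact ⟨0, by rw [map_zero]; change TT hk (embB hk 0) = 0; simp⟩
  obtain ⟨H, e⟩ := embB_some hk h
  rw [e]
  by_cases hx : x = 0
  · exact ⟨0, by rw [map_zero, TT_some_zero]; simp [hx]⟩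
  · have hx' : (x : ℂ) ≠ 0 := by exact_mod_cast hx
    obtain ⟨H1, e1⟩ := TT_some hk H (by simpa using hx')
    rw [e1]
    have he := MC_eq_of_ns h
    have hk' : k = (x ^ 3 - y ^ 2) / 27 := by linarith
    have hn : (MC k).toAffine.Nonsingular (-x / 3 + 4 * y ^ 2 / (9 * x ^ 2))
        (-(y / 3) * (9 * x ^ 3 - 8 * y ^ 2) / (9 * x ^ 3)) := by
      apply MC_nonsingular hk
      rw [hk']
      field_simp
      ring
    refine ⟨Point.some _ _ hn, ?_⟩
    obtain ⟨H2, e2⟩ := embA_some hk hn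
    rw [e2]
    apply some_congr
    · push_cast
      rw [div_pow, mul_pow, s3_sq]
      field_simp
      ring
    · push_cast
      rw [show s3 * (s3 * (y : ℂ) / 9) = s3 ^ 2 * y / 9 by ring,
        show (s3 * (y : ℂ) / 9) ^ 2 = s3 ^ 2 * y ^ 2 / 81 by ring, s3_sq]
      field_simp
      ring

end descent

section delta
open WeierstrassCurve WeierstrassCurve.Affine

/-- membership in `ℚ + ℚ κ`. -/
def inK (κ z : ℂ) : Prop := ∃ u v : ℚ, z = u + v * κ

/-- nonzero cubes of `ℚ(κ)`. -/
def cubK (κ z : ℂ) : Prop := ∃ w, inK κ w ∧ w ≠ 0 ∧ z = w ^ 3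

/-- `κ` is an irrational square root of the rational `k`. -/
structure IsRt (k : ℚ) (κ : ℂ) : Prop where
  sq : κ ^ 2 = k
  irr : ¬ IsSquare k

variable {k : ℚ} {κ : ℂ}

lemma IsRt.indep (h : IsRt k κ) {u v : ℚ} (e : (u : ℂ) + v * κ = 0) : u = 0 ∧ v = 0 := by
  by_cases hv : v = 0
  · subst hv; simp at e; exact ⟨e, rfl⟩
  · exfalso
    apply h.irr
    have hv' : (v : ℂ) ≠ 0 := by exact_mod_cast hv
    have : κ = -(u : ℂ) / v := by field_simp; linear_combination e
    have h2 := h.sq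
    rw [this] at h2
    refine ⟨-u / v, ?_⟩
    have h3 : ((-u / v * (-u / v) : ℚ) : ℂ) = (k : ℂ) := by rw [← h2]; push_cast; ring
    exact_mod_cast h3.symm

lemma IsRt.inj (h : IsRt k κ) {u v u' v' : ℚ} (e : (u : ℂ) + v * κ = u' + v' * κ) :
    u = u' ∧ v = v' := by
  have := h.indep (u := u - u') (v := v - v') (by push_cast; linear_combination e)
  exact ⟨sub_eq_zero.1 this.1, sub_eq_zero.1 this.2⟩

lemma IsRt.k_ne (h : IsRt k κ) : k ≠ 0 := by
  intro hk; exact h.irr ⟨0, by simp [hk]⟩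

lemma inK_rat (u : ℚ) : inK κ u := ⟨u, 0, by simp⟩
lemma inK_self : inK κ κ := ⟨0, 1, by simp⟩
lemma inK.add {z w : ℂ} : inK κ z → inK κ w → inK κ (z + w) := by
  rintro ⟨u, v, rfl⟩ ⟨u', v', rfl⟩
  exact ⟨u + u', v + v', by push_cast; ring⟩
lemma inK.neg {z : ℂ} : inK κ z → inK κ (-z) := by
  rintro ⟨u, v, rfl⟩
  exact ⟨-u, -v, by push_cast; ring⟩
lemma inK.sub {z w : ℂ} (hz : inK κ z) (hw : inK κ w) : inK κ (z - w) := by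
  rw [sub_eq_add_neg]; exact hz.add hw.neg
lemma IsRt.mul (h : IsRt k κ) {z w : ℂ} : inK κ z → inK κ w → inK κ (z * w) := by
  rintro ⟨u, v, rfl⟩ ⟨u', v', rfl⟩
  exact ⟨u * u' + k * v * v', u * v' + v * u', by push_cast; linear_combination (v * v' : ℂ) * h.sq⟩
lemma IsRt.inv (h : IsRt k κ) {z : ℂ} : inK κ z → inK κ z⁻¹ := by
  rintro ⟨u, v, rfl⟩
  by_cases hz : (u : ℂ) + v * κ = 0
  · rw [hz]; exact ⟨0, 0, by simp⟩
  have hz' : (u : ℂ) + (-v : ℚ) * κ ≠ 0 := by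
    intro e
    obtain ⟨h1, h2⟩ := h.indep e
    have : v = 0 := by linarith
    apply hz; simp [h1, this]
  have e : (u ^ 2 - k * v ^ 2 : ℂ) = (u + v * κ) * (u + (-v : ℚ) * κ) := by
    push_cast; linear_combination (v ^ 2 : ℂ) * h.sq
  have hn : (u ^ 2 - k * v ^ 2 : ℂ) ≠ 0 := by rw [e]; exact mul_ne_zero hz hz'
  refine ⟨u / (u ^ 2 - k * v ^ 2), -v / (u ^ 2 - k * v ^ 2), ?_⟩
  push_cast
  apply inv_eq_of_mul_eq_one_right
  push_cast at e
  have e' : ((u : ℂ) + v * κ) * (u / (u ^ 2 - k * v ^ 2) + -v / (u ^ 2 - k * v ^ 2) * κ) =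
      ((u + v * κ) * (u + -v * κ)) / (u ^ 2 - k * v ^ 2) := by ring
  rw [e', ← e, div_self hn]

lemma IsRt.cub_mul (h : IsRt k κ) {z w : ℂ} : cubK κ z → cubK κ w → cubK κ (z * w) := by
  rintro ⟨a, ha, ha0, rfl⟩ ⟨b, hb, hb0, rfl⟩
  exact ⟨a * b, h.mul ha hb, mul_ne_zero ha0 hb0, by ring⟩
lemma IsRt.cub_inv (h : IsRt k κ) {z : ℂ} : cubK κ z → cubK κ z⁻¹ := by
  rintro ⟨a, ha, ha0, rfl⟩
  exact ⟨a⁻¹, h.inv ha, inv_ne_zero ha0, by simp⟩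
lemma IsRt.cub_div (h : IsRt k κ) {z w : ℂ} (hz : cubK κ z) (hw : cubK κ w) : cubK κ (z / w) := by
  rw [div_eq_mul_inv]; exact h.cub_mul hz (h.cub_inv hw)
lemma cub_one : cubK κ 1 := ⟨1, ⟨1, 0, by simp⟩, one_ne_zero, by simp⟩

/-- the descent map, as a map to `ℂ`. -/
noncomputable def dl (κ : ℂ) : (MC k).toAffine.Point → ℂ
  | Point.zero => 1
  | Point.some _ y _ => y - κ

lemma dl_zero : dl (k := k) κ 0 = 1 := rfl

lemma IsRt.sub_ne (h : IsRt k κ) (y : ℚ) : (y : ℂ) - κ ≠ 0 := by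
  intro e
  have := (h.indep (u := y) (v := -1) (by push_cast; linear_combination e)).2
  norm_num at this

lemma IsRt.dl_ne (h : IsRt k κ) (P : (MC k).toAffine.Point) : dl κ P ≠ 0 := by
  rcases P with _ | ⟨x, y, hP⟩
  · exact one_ne_zero
  · exact h.sub_ne y

lemma IsRt.x_ne (h : IsRt k κ) {x y : ℚ} (e : y ^ 2 = x ^ 3 + k) : x ≠ 0 := by
  rintro rfl
  apply h.irr
  exact ⟨y, by linear_combination -e⟩

lemma IsRt.third (h : IsRt k κ) {y₁ y₂ y₃ x₃ c : ℚ} (e3 : y₃ ^ 2 = x₃ ^ 3 + k)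
    (e : ((y₁ : ℂ) - κ) * (y₂ - κ) * (-y₃ - κ) = (c - κ) ^ 3) :
    cubK κ (((y₁ : ℂ) - κ) * (y₂ - κ) / (y₃ - κ)) := by
  have hx := h.x_ne e3
  have hx' : (x₃ : ℂ) ≠ 0 := by exact_mod_cast hx
  have e3' : (y₃ : ℂ) ^ 2 = x₃ ^ 3 + k := by exact_mod_cast e3
  have hd := h.sub_ne y₃
  refine ⟨(c - κ) * (((-x₃)⁻¹ : ℚ) : ℂ), h.mul ((inK_rat c).sub inK_self) (inK_rat _),
    mul_ne_zero (h.sub_ne c) (by push_cast; simpa using hx'), ?_⟩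
  push_cast
  rw [mul_pow, ← e, inv_pow]
  field_simp
  linear_combination (-((y₁ : ℂ) - κ) * (y₂ - κ)) * (e3' - h.sq)

lemma line_id {x y z L κ k : ℂ} (f1 : y ^ 2 = x ^ 3 + k) (hsq : κ ^ 2 = k)
    (hf : x ^ 2 + x * z + z ^ 2 = L * (2 * y - L * (x - z))) :
    (y - κ) * (y - L * (x - z) - κ) * (- -(L * (L ^ 2 - x - z - x) + y) - κ) =
      (y - L * x - κ) ^ 3 := by
  have E2 : x * z + (x + z) * (L ^ 2 - x - z) = -2 * L * (y - L * x) := by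
    linear_combination -hf
  have E3 : x * z * (L ^ 2 - x - z) = (y - L * x) ^ 2 - k := by
    linear_combination (-x) * hf - f1
  linear_combination L ^ 3 * E3 + L ^ 2 * (y - L * x - κ) * E2 + L ^ 3 * hsq

lemma IsRt.dl_add (h : IsRt k κ) (P Q : (MC k).toAffine.Point) :
    cubK κ (dl κ P * dl κ Q / dl κ (P + Q)) := by
  rcases P with _ | ⟨x₁, y₁, h₁⟩
  · change cubK κ (1 * dl κ Q / dl κ (0 + Q))
    rw [zero_add, one_mul, div_self (h.dl_ne _)]; exact cub_one
  rcases Q with _ | ⟨x₂, y₂, h₂⟩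
  · change cubK κ (dl κ _ * 1 / dl κ (_ + 0))
    rw [add_zero, mul_one, div_self (h.dl_ne _)]; exact cub_one
  have e1 := MC_eq_of_ns h₁
  have e2 := MC_eq_of_ns h₂
  have f1 : (y₁ : ℂ) ^ 2 = x₁ ^ 3 + k := by exact_mod_cast e1
  have f2 : (y₂ : ℂ) ^ 2 = x₂ ^ 3 + k := by exact_mod_cast e2
  have hsq := h.sq
  by_cases hx : x₁ = x₂
  · by_cases hy : y₁ = - y₂
    · rw [MC_add_neg h₁ h₂ hx hy, dl_zero, div_one]
      have := h.x_ne e1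
      refine ⟨((-x₁ : ℚ) : ℂ), inK_rat _, by simpa using this, ?_⟩
      simp only [dl]
      have hy2 : (y₂ : ℂ) = - y₁ := by rw [hy]; push_cast; ring
      rw [hy2]; push_cast; linear_combination hsq - f1
    · have hy2 : y₁ = y₂ := by
        have : (y₁ - y₂) * (y₁ + y₂) = 0 := by rw [hx] at e1; linear_combination e1 - e2
        rcases mul_eq_zero.1 this with h | h
        · linarith
        · exfalso; apply hy; linarith
      have hy0 : y₁ ≠ 0 := by rintro rfl; apply hy; rw [← hy2]; simp
      obtain ⟨l, hl⟩ : ∃ l, l = 3 * x₁ ^ 2 / (2 * y₁) := ⟨_, rfl⟩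
      obtain ⟨H, e⟩ := MC_add_self h.k_ne h₁ h₂ hx hy2 hy0 l _ _ hl rfl rfl
      rw [e]
      simp only [dl]
      subst hy2 hx
      refine h.third (c := y₁ - l * x₁) (MC_eq_of_ns H) ?_
      have hl' : 2 * (y₁ : ℂ) * l = 3 * x₁ ^ 2 := by
        have : 2 * y₁ * l = 3 * x₁ ^ 2 := by rw [hl]; field_simp
        exact_mod_cast this
      push_cast
      have := line_id (z := x₁) (L := l) f1 hsq (by linear_combination -hl')
      rw [← this]; ring
  · obtain ⟨l, hl⟩ : ∃ l, l = (y₁ - y₂) / (x₁ - x₂) := ⟨_, rfl⟩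
    obtain ⟨H, e⟩ := MC_add_ne h.k_ne h₁ h₂ hx l _ _ hl rfl rfl
    rw [e]
    simp only [dl]
    refine h.third (c := y₁ - l * x₁) (MC_eq_of_ns H) ?_
    have hl' : (y₂ : ℂ) = y₁ - l * (x₁ - x₂) := by
      have : y₂ = y₁ - l * (x₁ - x₂) := by
        have : x₁ - x₂ ≠ 0 := sub_ne_zero.2 hx
        rw [hl]; field_simp; ring
      rw [this]; push_cast; ring
    have hx' : (x₁ : ℂ) - x₂ ≠ 0 := by
      have : x₁ - x₂ ≠ 0 := sub_ne_zero.2 hx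
      exact_mod_cast this
    rw [hl'] at f2 ⊢
    push_cast
    have hf : (x₁ : ℂ) ^ 2 + x₁ * x₂ + x₂ ^ 2 = l * (2 * y₁ - l * (x₁ - x₂)) := by
      apply mul_left_cancel₀ hx'
      linear_combination f2 - f1
    exact line_id f1 hsq hf

lemma IsRt.cube_data (h : IsRt k κ) {x y : ℚ} (e : y ^ 2 = x ^ 3 + k) (hc : cubK κ (y - κ)) :
    ∃ u v : ℚ, v ≠ 0 ∧ k = (-1 - 3 * u ^ 2 * v) / v ^ 3 ∧ y = u ^ 3 + 3 * k * u * v ^ 2 ∧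
      x = u ^ 2 - k * v ^ 2 := by
  obtain ⟨w, ⟨u, v, rfl⟩, hw, e1⟩ := hc
  have e2 : ((y : ℚ) : ℂ) + ((-1 : ℚ) : ℂ) * κ =
      ((u ^ 3 + 3 * k * u * v ^ 2 : ℚ) : ℂ) + ((3 * u ^ 2 * v + k * v ^ 3 : ℚ) : ℂ) * κ := by
    push_cast
    linear_combination e1 + (3 * u * v ^ 2 + v ^ 3 * κ : ℂ) * h.sq
  obtain ⟨hy, hm⟩ := h.inj e2
  have hv : v ≠ 0 := by rintro rfl; norm_num at hm
  refine ⟨u, v, hv, ?_, hy, ?_⟩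
  · field_simp; linarith
  · have : x ^ 3 = (u ^ 2 - k * v ^ 2) ^ 3 := by
      have : x ^ 3 = y ^ 2 - k * (-1) ^ 2 := by linear_combination -e
      rw [this, hy, hm]; ring
    exact (Odd.strictMono_pow (by decide : Odd 3)).injective this

lemma IsRt.ker_g (h : IsRt k κ) (hk : k ≠ 0) (P : (MC k).toAffine.Point) (hc : cubK κ (dl κ P)) :
    ∃ P', embA hk P = TT hk (embB hk P') := by
  rcases P with _ | ⟨x, y, hP⟩
  · exact ⟨0, by rw [map_zero, map_zero]; rfl⟩
  obtain ⟨u, v, hv, h1, h2, h3⟩ := h.cube_data (MC_eq_of_ns hP) hc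
  have hn : (MC (-27 * k)).toAffine.Nonsingular (-3 / v) (9 * u / v) := by
    apply MC_nonsingular (hkneg hk)
    rw [h1]; field_simp; ring
  refine ⟨Point.some _ _ hn, ?_⟩
  obtain ⟨H, e⟩ := embA_some hk hP
  obtain ⟨H', e'⟩ := embB_some hk hn
  have hv' : (v : ℂ) ≠ 0 := by exact_mod_cast hv
  obtain ⟨H2, e2⟩ := TT_some hk H' (by push_cast; field_simp; simpa using hv)
  rw [e, e', e2]
  apply some_congr
  · rw [h3, h1]
    push_cast
    rw [div_pow, mul_pow, s3_sq]
    field_simp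
    ring
  · rw [h2, h1]
    push_cast
    rw [show s3 * (s3 * (9 * u / v) / 9) = s3 ^ 2 * ((u : ℂ) / v) by field_simp,
        show (s3 * (9 * (u : ℂ) / v) / 9) ^ 2 = s3 ^ 2 * (u / v) ^ 2 by field_simp, s3_sq]
    field_simp
    ring

lemma IsRt.ker_f {κ' : ℂ} (h : IsRt (-27 * k) κ') (hk : k ≠ 0) (P : (MC (-27 * k)).toAffine.Point)
    (hc : cubK κ' (dl κ' P)) :
    ∃ P', embB hk P = TT hk (embA hk P') := by
  rcases P with _ | ⟨x, y, hP⟩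
  · exact ⟨0, by rw [map_zero, map_zero]; rfl⟩
  obtain ⟨u, v, hv, h1, h2, h3⟩ := h.cube_data (MC_eq_of_ns hP) hc
  have h1' : k = (-1 - 3 * u ^ 2 * v) / (-27 * v ^ 3) := by
    have : k = (-27 * k) / (-27) := by ring
    rw [this, h1]; field_simp
  have hn : (MC k).toAffine.Nonsingular (-1 / (3 * v)) (-u / (3 * v)) := by
    apply MC_nonsingular hk
    rw [h1']; field_simp; ring
  refine ⟨Point.some _ _ hn, ?_⟩
  obtain ⟨H, e⟩ := embB_some hk hP
  obtain ⟨H', e'⟩ := embA_some hk hn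
  have hv' : (v : ℂ) ≠ 0 := by exact_mod_cast hv
  obtain ⟨H2, e2⟩ := TT_some hk H' (by push_cast; field_simp; simpa using hv)
  rw [e, e', e2]
  apply some_congr
  · rw [h3, h1]
    push_cast
    field_simp
    ring
  · rw [h2, h1]
    push_cast
    field_simp
    ring

end delta

section idx
open WeierstrassCurve WeierstrassCurve.Affine

lemma index_le_of_rel {G α : Type*} [AddCommGroup G] (H : AddSubgroup G) (S : Finset α)
    (R : G → α → Prop) (h1 : ∀ P, P ∉ H → ∃ s ∈ S, R P s)
    (h2 : ∀ P Q s, R P s → R Q s → P - Q ∈ H) : H.index ≠ 0 ∧ H.index ≤ S.card + 1 := by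
  classical
  choose F hF using h1
  let φ : G ⧸ H → Option S := fun q ↦
    if hq : q.out ∈ H then none else some ⟨F q.out hq, (hF _ hq).1⟩
  have hφ : Function.Injective φ := by
    intro p q hpq
    simp only [φ] at hpq
    rw [← QuotientAddGroup.out_eq' p, ← QuotientAddGroup.out_eq' q, QuotientAddGroup.eq]
    split_ifs at hpq with hp hq hq
    · exact H.add_mem (H.neg_mem hp) hq
    · simp only [Option.some.injEq, Subtype.mk.injEq] at hpq
      have := h2 _ _ (F p.out hp) (by rw [hpq]; exact (hF _ hq).2) (hF _ hp).2
      rwa [sub_eq_add_neg, add_comm] at this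
  have hfin : Finite (G ⧸ H) := Finite.of_injective φ hφ
  refine ⟨AddSubgroup.index_ne_zero_of_finite, ?_⟩
  have := Nat.card_le_card_of_injective φ hφ
  simpa [AddSubgroup.index] using this

lemma index_eq_pow {G : Type*} [AddCommGroup G] (H : AddSubgroup G) (h0 : H.index ≠ 0)
    (h3 : ∀ P : G, 3 • P ∈ H) : ∃ r, H.index = 3 ^ r := by
  have hfin : Finite (G ⧸ H) := by
    have : H.FiniteIndex := ⟨h0⟩
    infer_instance
  have hp : IsPGroup 3 (Multiplicative (G ⧸ H)) := by
    intro g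
    refine ⟨1, ?_⟩
    induction g using Multiplicative.rec with
    | _ g => 
      induction g using QuotientAddGroup.induction_on with
      | H z =>
        rw [pow_one, ← ofAdd_nsmul, ← QuotientAddGroup.mk_nsmul, (QuotientAddGroup.eq_zero_iff _).2 (h3 z)]
        rfl
  have : Fact (Nat.Prime 3) := ⟨Nat.prime_three⟩
  obtain ⟨n, hn⟩ := (IsPGroup.iff_card).1 hp
  exact ⟨n, by rw [← hn]; rfl⟩

lemma index_three_le {G G' : Type*} [AddCommGroup G] [AddCommGroup G'] (f : G →+ G') (g : G' →+ G)
    (hgf : ∀ P, g (f P) = -(3 • P)) (h1 : g.range.index ≠ 0) (h2 : f.range.index ≠ 0) :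
    (nsmulAddMonoidHom (α := G) 3).range.index ≠ 0 ∧
    (nsmulAddMonoidHom (α := G) 3).range.index ≤ g.range.index * f.range.index := by
  have e : (nsmulAddMonoidHom (α := G) 3).range = f.range.map g := by
    ext x
    simp only [AddMonoidHom.mem_range, AddSubgroup.mem_map, nsmulAddMonoidHom_apply]
    constructor
    · rintro ⟨y, rfl⟩
      exact ⟨f (-y), ⟨-y, rfl⟩, by rw [hgf]; simp⟩
    · rintro ⟨_, ⟨y, rfl⟩, rfl⟩
      exact ⟨-y, by rw [hgf]; simp⟩
  rw [e, AddSubgroup.index_map]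
  have hd : (f.range ⊔ g.ker).index ∣ f.range.index := AddSubgroup.index_dvd_of_le le_sup_left
  have h0 : (f.range ⊔ g.ker).index ≠ 0 := fun h ↦ h2 (by rw [h] at hd; exact Nat.eq_zero_of_zero_dvd hd)
  constructor
  · exact mul_ne_zero h0 h1
  · rw [mul_comm]
    exact Nat.mul_le_mul_left _ (Nat.le_of_dvd (Nat.pos_of_ne_zero h2) hd)

variable {k : ℚ} {κ κ' : ℂ}

lemma IsRt.dl_sub (h : IsRt k κ) {P Q : (MC k).toAffine.Point}
    (hc : cubK κ (dl κ P / dl κ Q)) : cubK κ (dl κ (P - Q)) := by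
  have := h.dl_add (P - Q) Q
  rw [sub_add_cancel] at this
  have h2 := h.cub_mul this hc
  have hP := h.dl_ne P
  have hQ := h.dl_ne Q
  convert h2 using 1
  field_simp

theorem rank_le_of_classes {α β : Type*} (h : IsRt k κ) (h' : IsRt (-27 * k) κ')
    (S : Finset α) (S' : Finset β)
    (R : (MC k).toAffine.Point → α → Prop) (R' : (MC (-27 * k)).toAffine.Point → β → Prop)
    (h1 : ∀ P, ¬ cubK κ (dl κ P) → ∃ s ∈ S, R P s)
    (h2 : ∀ P Q s, R P s → R Q s → cubK κ (dl κ P / dl κ Q))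
    (h1' : ∀ P, ¬ cubK κ' (dl κ' P) → ∃ s ∈ S', R' P s)
    (h2' : ∀ P Q s, R' P s → R' Q s → cubK κ' (dl κ' P / dl κ' Q)) :
    ∃ r r' : ℕ, Module.finrank ℤ (MC k).toAffine.Point ≤ r + r' ∧
      3 ^ r ≤ S.card + 1 ∧ 3 ^ r' ≤ S'.card + 1 := by
  have hk := h.k_ne
  choose f hf using exists_f hk
  choose g hg using exists_g hk
  have iA : Function.Injective (embA hk) := scale_inj _ _ _ _
  have iB : Function.Injective (embB hk) := scale_inj _ _ _ _
  let f' : (MC k).toAffine.Point →+ (MC (-27 * k)).toAffine.Point := AddMonoidHom.mk' f (by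
    intro P Q; apply iB; rw [← hf, map_add, map_add, hf, hf, map_add])
  let g' : (MC (-27 * k)).toAffine.Point →+ (MC k).toAffine.Point := AddMonoidHom.mk' g (by
    intro P Q; apply iA; rw [← hg, map_add, map_add, hg, hg, map_add])
  have hgf : ∀ P, g' (f' P) = -(3 • P) := by
    intro P; apply iA
    change embA hk (g (f P)) = _
    rw [← hg, ← hf, TT_TT, map_neg, map_nsmul]
  have hfg : ∀ P, f' (g' P) = -(3 • P) := by
    intro P; apply iB
    change embB hk (f (g P)) = _
    rw [← hf, ← hg, TT_TT, map_neg, map_nsmul]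
  have mg : ∀ P, cubK κ (dl κ P) → P ∈ g'.range := by
    intro P hP
    obtain ⟨P', e⟩ := h.ker_g hk P hP
    refine ⟨P', iA ?_⟩
    rw [e, hg]; rfl
  have mf : ∀ P, cubK κ' (dl κ' P) → P ∈ f'.range := by
    intro P hP
    obtain ⟨P', e⟩ := h'.ker_f hk P hP
    refine ⟨P', iB ?_⟩
    rw [e, hf]; rfl
  obtain ⟨a0, a1⟩ := index_le_of_rel g'.range S R (fun P hP ↦ h1 P (fun hc ↦ hP (mg P hc)))
    (fun P Q s hP hQ ↦ mg _ (h.dl_sub (h2 P Q s hP hQ)))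
  obtain ⟨b0, b1⟩ := index_le_of_rel f'.range S' R' (fun P hP ↦ h1' P (fun hc ↦ hP (mf P hc)))
    (fun P Q s hP hQ ↦ mf _ (h'.dl_sub (h2' P Q s hP hQ)))
  obtain ⟨r, hr⟩ := index_eq_pow g'.range a0 (fun P ↦ ⟨f' (-P), by rw [hgf]; simp⟩)
  obtain ⟨r', hr'⟩ := index_eq_pow f'.range b0 (fun P ↦ ⟨g' (-P), by rw [hfg]; simp⟩)
  obtain ⟨c0, c1⟩ := index_three_le f' g' hgf a0 b0
  refine ⟨r, r', ?_, hr ▸ a1, hr' ▸ b1⟩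
  apply MC_rank_le hk c0
  rw [pow_add, ← hr, ← hr']
  exact c1

end idx

section forms
open WeierstrassCurve WeierstrassCurve.Affine

/-- leading coefficient of the cubic covariant for `(a, 3 b, 3 c, d)`. -/
def cG {R : Type*} [CommRing R] (a b c d : R) : R := 2 * b ^ 3 - 3 * a * b * c + a ^ 2 * d

/-- reduced discriminant of `(a, 3 b, 3 c, d)`. -/
def qD {R : Type*} [CommRing R] (a b c d : R) : R :=
  a ^ 2 * d ^ 2 - 6 * a * b * c * d + 4 * a * c ^ 3 + 4 * b ^ 3 * d - 3 * b ^ 2 * c ^ 2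

/-- the coefficients after the substitution `(X, Y) ↦ (p X + q Y, r X + s Y)`. -/
def tA {R : Type*} [CommRing R] (a b c d p r : R) : R :=
  a * p ^ 3 + 3 * b * p ^ 2 * r + 3 * c * p * r ^ 2 + d * r ^ 3
def tB {R : Type*} [CommRing R] (a b c d p q r s : R) : R :=
  a * p ^ 2 * q + b * (p ^ 2 * s + 2 * p * q * r) + c * (q * r ^ 2 + 2 * p * r * s) + d * r ^ 2 * s
def tC {R : Type*} [CommRing R] (a b c d p q r s : R) : R :=
  a * p * q ^ 2 + b * (q ^ 2 * r + 2 * p * q * s) + c * (p * s ^ 2 + 2 * q * r * s) + d * r * s ^ 2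

lemma qD_trans {R : Type*} [CommRing R] (a b c d p q r s : R) (h : p * s - q * r = 1) :
    qD (tA a b c d p r) (tB a b c d p q r s) (tC a b c d p q r s) (tA a b c d q s) = qD a b c d := by
  have : qD (tA a b c d p r) (tB a b c d p q r s) (tC a b c d p q r s) (tA a b c d q s) =
    (p * s - q * r) ^ 6 * qD a b c d := by
    simp only [qD, tA, tB, tC]; ring
  rw [this, h]; ring

lemma syz {R : Type*} [CommRing R] (a b c d : R) :
    cG a b c d ^ 2 - 4 * (b ^ 2 - a * c) ^ 3 = a ^ 2 * qD a b c d := by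
  simp only [cG, qD]; ring

/-- invariance of `G + δ f` modulo cubes -/
lemma theta_id {R : Type*} [CommRing R] (a b c d p q r s δ : R) (h : p * s - q * r = 1)
    (hδ : δ ^ 2 = qD a b c d) :
    (cG (tA a b c d p r) (tB a b c d p q r s) (tC a b c d p q r s) (tA a b c d q s)
      + δ * tA a b c d p r) * (cG a b c d + δ * a) ^ 2 =
    ((cG a b c d + δ * a) * p + (a * b * d - 2 * a * c ^ 2 + b ^ 2 * c + δ * b) * r) ^ 3 := by
  have e : cG (tA a b c d p r) (tB a b c d p q r s) (tC a b c d p q r s) (tA a b c d q s) =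
      (p * s - q * r) ^ 3 * (cG a b c d * p ^ 3 + 3 * (a * b * d - 2 * a * c ^ 2 + b ^ 2 * c) * p ^ 2 * r
        - 3 * (a * c * d - 2 * b ^ 2 * d + b * c ^ 2) * p * r ^ 2
        - (a * d ^ 2 - 3 * b * c * d + 2 * c ^ 3) * r ^ 3) := by
    simp only [cG, tA, tB, tC]; ring
  rw [e, h]
  have e1 : (cG a b c d + δ * a) * (-(a * c * d - 2 * b ^ 2 * d + b * c ^ 2) + δ * c) =
      (a * b * d - 2 * a * c ^ 2 + b ^ 2 * c + δ * b) ^ 2 := by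
    simp only [cG, qD] at *
    linear_combination (a * c - b ^ 2) * hδ
  have e2 : (cG a b c d + δ * a) * (-(a * d ^ 2 - 3 * b * c * d + 2 * c ^ 3) + δ * d) =
      (a * b * d - 2 * a * c ^ 2 + b ^ 2 * c + δ * b) *
      (-(a * c * d - 2 * b ^ 2 * d + b * c ^ 2) + δ * c) := by
    simp only [cG, qD] at *
    linear_combination (a * d - b * c) * hδ
  rw [tA]
  generalize cG a b c d = g at *
  linear_combination (3 * p * r ^ 2 * (g + δ * a) + r ^ 3 * (a * b * d - 2 * a * c ^ 2 + b ^ 2 * c + δ * b)) * e1 + r ^ 3 * (g + δ * a) * e2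
end forms

section classes
variable {k : ℚ} {κ : ℂ}

/-- the class `θ_f` attached to a form. -/
noncomputable def th (μ : ℚ) (κ : ℂ) (a b c d : ℚ) : ℂ := (((cG a b c d / 2 : ℚ) : ℂ) + ((μ * a / 2 : ℚ) : ℂ) * κ)

lemma IsRt.th_ne (h : IsRt k κ) {μ a b c d : ℚ} (hμ : μ ≠ 0) (hq : qD a b c d = μ ^ 2 * k) :
    th μ κ a b c d ≠ 0 := by
  intro e
  obtain ⟨h1, h2⟩ := h.indep e
  have ha : a = 0 := by
    rcases mul_eq_zero.1 ((div_eq_zero_iff.1 h2).resolve_right two_ne_zero) with h | h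
    · exact absurd h hμ
    · exact h
  subst ha
  have hb : b = 0 := by
    simp only [cG] at h1
    have : b ^ 3 = 0 := by linear_combination h1
    exact pow_eq_zero_iff (by norm_num) |>.1 this
  subst hb
  have : μ ^ 2 * k = 0 := by rw [← hq]; simp [qD]
  rcases mul_eq_zero.1 this with h3 | h3
  · exact hμ (pow_eq_zero_iff (by norm_num) |>.1 h3)
  · exact h.k_ne h3

lemma IsRt.class_trans (h : IsRt k κ) {μ a b c d : ℚ} (hμ : μ ≠ 0) (hq : qD a b c d = μ ^ 2 * k)
    {p q r s : ℚ} (hdet : p * s - q * r = 1) {z : ℂ} (hz : cubK κ (z * th μ κ a b c d)) :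
    cubK κ (z * th μ κ (tA a b c d p r) (tB a b c d p q r s) (tC a b c d p q r s) (tA a b c d q s)) := by
  set θ := th μ κ a b c d with hθ
  set θ' := th μ κ (tA a b c d p r) (tB a b c d p q r s) (tC a b c d p q r s) (tA a b c d q s) with hθ'
  have h0 : θ ≠ 0 := h.th_ne hμ hq
  have h0' : θ' ≠ 0 := h.th_ne hμ (by rw [qD_trans _ _ _ _ _ _ _ _ hdet, hq])
  have hδ : ((μ : ℂ) * κ) ^ 2 = qD (a : ℂ) b c d := by
    have : ((qD a b c d : ℚ) : ℂ) = qD (a : ℂ) b c d := by simp [qD]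
    rw [← this, hq, mul_pow, h.sq]; push_cast; ring
  have hid := theta_id (a : ℂ) b c d p q r s (μ * κ) (by exact_mod_cast hdet) hδ
  have e1 : 2 * θ = cG (a : ℂ) b c d + μ * κ * a := by
    rw [hθ]; simp only [th, cG]; push_cast; ring
  have e2 : 2 * θ' = cG (tA (a : ℂ) b c d p r) (tB (a : ℂ) b c d p q r s) (tC (a : ℂ) b c d p q r s)
      (tA (a : ℂ) b c d q s) + μ * κ * tA (a : ℂ) b c d p r := by
    rw [hθ']; simp only [th, cG, tA, tB, tC]; push_cast; ring
  rw [← e1, ← e2] at hid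
  set w : ℂ := 2 * θ * p + (a * b * d - 2 * a * c ^ 2 + b ^ 2 * c + μ * κ * b) * r with hw
  have hθK : inK κ θ := ⟨_, _, rfl⟩
  have hwK : inK κ w := by
    rw [hw]
    refine (h.mul (h.mul (by simpa using inK_rat (κ := κ) 2) hθK) (inK_rat p)).add (h.mul ?_ (inK_rat r))
    refine inK.add ?_ ⟨0, μ * b, by push_cast; ring⟩
    exact ⟨a * b * d - 2 * a * c ^ 2 + b ^ 2 * c, 0, by push_cast; ring⟩
  have hw0 : w ≠ 0 := by
    intro e
    rw [e] at hid
    have : θ' * θ ^ 2 = 0 := by linear_combination hid / 8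
    rcases mul_eq_zero.1 this with h3 | h3
    · exact h0' h3
    · exact h0 (pow_eq_zero_iff (by norm_num) |>.1 h3)
  have e3 : z * θ' = z * θ * (w * (2 * θ)⁻¹) ^ 3 := by
    field_simp
    linear_combination z * hid
  rw [e3]
  exact h.cub_mul hz ⟨_, h.mul hwK (h.inv (h.mul (by simpa using inK_rat (κ := κ) 2) hθK)),
    mul_ne_zero hw0 (inv_ne_zero (mul_ne_zero two_ne_zero h0)), rfl⟩

lemma IsRt.class_zero (h : IsRt k κ) {μ b c d : ℚ} (hμ : μ ≠ 0) (hq : qD 0 b c d = μ ^ 2 * k)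
    {z : ℂ} (hz : cubK κ (z * th μ κ 0 b c d)) : cubK κ z := by
  have h0 := h.th_ne hμ hq
  have e : th μ κ 0 b c d = (b : ℂ) ^ 3 := by simp [th, cG]
  have hb : (b : ℂ) ≠ 0 := by
    rintro h1; rw [e, h1] at h0; simp at h0
  have : z = z * th μ κ 0 b c d * ((b : ℂ)⁻¹) ^ 3 := by
    rw [e]; field_simp
  rw [this]
  exact h.cub_mul hz ⟨_, h.inv (inK_rat b), inv_ne_zero hb, rfl⟩
end classes

section points

lemma rat_coords {x y : ℚ} {K : ℤ} (e : y ^ 2 = x ^ 3 + K) :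
    ∃ r s t : ℤ, t ≠ 0 ∧ IsCoprime r t ∧ x = r / t ^ 2 ∧ y = s / t ^ 3 ∧ s ^ 2 = r ^ 3 + K * t ^ 6 := by
  have hx := Rat.num_div_den x
  have hy := Rat.num_div_den y
  have hx0 : (x.den : ℚ) ≠ 0 := by exact_mod_cast x.den_nz
  have hy0 : (y.den : ℚ) ≠ 0 := by exact_mod_cast y.den_nz
  have e1 : y.num ^ 2 * (x.den : ℤ) ^ 3 = (y.den : ℤ) ^ 2 * (x.num ^ 3 + K * (x.den : ℤ) ^ 3) := by
    rw [← hx, ← hy] at e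
    field_simp at e
    have : ((y.num ^ 2 * (x.den : ℤ) ^ 3 : ℤ) : ℚ) = ((y.den : ℤ) ^ 2 * (x.num ^ 3 + K * (x.den : ℤ) ^ 3) : ℤ) := by
      push_cast; linear_combination e
    exact_mod_cast this
  have cx : IsCoprime x.num (x.den : ℤ) := Int.isCoprime_iff_nat_coprime.2 (by simpa using x.reduced)
  have cy : IsCoprime y.num (y.den : ℤ) := Int.isCoprime_iff_nat_coprime.2 (by simpa using y.reduced)
  have d1 : (y.den : ℤ) ^ 2 ∣ (x.den : ℤ) ^ 3 :=
    (cy.symm.pow (m := 2) (n := 2)).dvd_of_dvd_mul_left ⟨_, e1⟩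
  have d2 : (x.den : ℤ) ^ 3 ∣ (y.den : ℤ) ^ 2 := by
    have c3 : IsCoprime ((x.den : ℤ) ^ 3) (x.num ^ 3 + K * (x.den : ℤ) ^ 3) := by
      have := (cx.symm.pow (m := 3) (n := 3)).add_mul_left_right K
      rwa [mul_comm ((x.den : ℤ) ^ 3) K] at this
    exact c3.dvd_of_dvd_mul_right ⟨y.num ^ 2, by linear_combination -e1⟩
  have d1' : y.den ^ 2 ∣ x.den ^ 3 := by exact_mod_cast d1
  have d2' : x.den ^ 3 ∣ y.den ^ 2 := by exact_mod_cast d2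
  have d3 : y.den ^ 2 = x.den ^ 3 := Nat.dvd_antisymm d1' d2'
  have d4 : x.den ∣ y.den := by
    rw [← Nat.pow_dvd_pow_iff (n := 2) (by norm_num), d3]
    exact pow_dvd_pow _ (by norm_num)
  obtain ⟨t, ht⟩ := d4
  have d5 : x.den = t ^ 2 := by
    rw [ht] at d3
    have : x.den ^ 2 * t ^ 2 = x.den ^ 2 * x.den := by linear_combination d3
    exact (Nat.eq_of_mul_eq_mul_left (pow_pos x.den_pos 2) this).symm
  have d6 : y.den = t ^ 3 := by rw [ht, d5]; ring
  have t0 : t ≠ 0 := by rintro rfl; exact x.den_nz (by simpa using d5)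
  have t0' : (t : ℤ) ≠ 0 := by exact_mod_cast t0
  refine ⟨x.num, y.num, t, t0', ?_, ?_, ?_, ?_⟩
  · have : IsCoprime x.num ((t : ℤ) ^ 2) := by simpa [d5] using cx
    exact (IsCoprime.pow_right_iff (by norm_num)).1 this
  · conv_lhs => rw [← hx, d5]
    push_cast; rfl
  · conv_lhs => rw [← hy, d6]
    push_cast; rfl
  · rw [d5, d6] at e1
    push_cast at e1
    have : ((t : ℤ) ^ 6) * (y.num ^ 2) = (t : ℤ) ^ 6 * (x.num ^ 3 + K * t ^ 6) := by linear_combination e1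
    exact mul_left_cancel₀ (pow_ne_zero 6 t0') this

lemma lift_b {g s r M : ℤ} (hc : IsCoprime r M) (h : M ∣ g * s ^ 2 - r ^ 3) :
    ∃ b, M ∣ g * b ^ 2 - r ∧ M ∣ g * b ^ 3 - 3 * b * r + 2 * s := by
  obtain ⟨u, v, huv⟩ := hc
  obtain ⟨w, hw⟩ := h
  have key : M ∣ g * (s * u) ^ 2 - r := by
    refine ⟨w * u ^ 2 - v * r * (u * r + 1), ?_⟩
    linear_combination u ^ 2 * hw + (r * (u * r + 1)) * huv
  refine ⟨s * u, key, ?_⟩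
  have : g * (s * u) ^ 3 - 3 * (s * u) * r + 2 * s = (s * u) * (g * (s * u) ^ 2 - r) + M * (2 * s * v) := by
    linear_combination (-2 * s) * huv
  rw [this]
  exact dvd_add (Dvd.dvd.mul_left key _) (dvd_mul_right _ _)

lemma gcd_split {D r t s C u : ℤ} (hD : Squarefree D) (hrt : IsCoprime r t) (hu : IsCoprime u D)
    (e : u * s ^ 2 = r ^ 3 + C * D ^ 3 * t ^ 6) :
    ∃ g D' r' s', g ≠ 0 ∧ D = g * D' ∧ r = g * r' ∧ s = g ^ 2 * s' ∧ IsCoprime r' (D' * t) ∧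
      u * g * s' ^ 2 = r' ^ 3 + C * D' ^ 3 * t ^ 6 := by
  have hD0 : D ≠ 0 := hD.ne_zero
  set g : ℤ := (Int.gcd r D : ℤ) with hg
  have hgpos : 0 < Int.gcd r D := Int.gcd_pos_of_ne_zero_right _ hD0
  have hg0 : g ≠ 0 := by rw [hg]; exact_mod_cast hgpos.ne'
  obtain ⟨r', hr⟩ : g ∣ r := Int.gcd_dvd_left r D
  obtain ⟨D', hD'⟩ : g ∣ D := Int.gcd_dvd_right r D
  have hgs : Squarefree g := hD.squarefree_of_dvd ⟨D', hD'⟩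
  have hug : IsCoprime g u := (hu.of_isCoprime_of_dvd_right ⟨D', hD'⟩).symm
  have e1 : u * s ^ 2 = g ^ 3 * (r' ^ 3 + C * D' ^ 3 * t ^ 6) := by
    rw [e, hr, hD']; ring
  have h1 : g ∣ s := by
    have : g ∣ u * s ^ 2 := ⟨g ^ 2 * (r' ^ 3 + C * D' ^ 3 * t ^ 6), by rw [e1]; ring⟩
    exact (hgs.dvd_pow_iff_dvd (by norm_num)).1 (hug.dvd_of_dvd_mul_left this)
  obtain ⟨s1, hs1⟩ := h1
  have e2 : u * s1 ^ 2 = g * (r' ^ 3 + C * D' ^ 3 * t ^ 6) := by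
    apply mul_left_cancel₀ (pow_ne_zero 2 hg0)
    rw [hs1] at e1; linear_combination e1
  have h2 : g ∣ s1 :=
    (hgs.dvd_pow_iff_dvd (by norm_num)).1 (hug.dvd_of_dvd_mul_left (x := g) (y := u) (z := s1 ^ 2) ⟨_, e2⟩)
  obtain ⟨s2, hs2⟩ := h2
  have e3 : u * g * s2 ^ 2 = r' ^ 3 + C * D' ^ 3 * t ^ 6 := by
    apply mul_left_cancel₀ hg0
    rw [hs2] at e2; linear_combination e2
  refine ⟨g, D', r', s2, hg0, hD', hr, by rw [hs1, hs2]; ring, ?_, e3⟩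
  refine IsCoprime.mul_right ?_ (hrt.of_isCoprime_of_dvd_left ⟨g, by rw [hr]; ring⟩)
  rw [Int.isCoprime_iff_gcd_eq_one]
  have := Int.gcd_div_gcd_div_gcd (i := r) (j := D) hgpos
  have a1 : r / (Int.gcd r D : ℤ) = r' := by
    rw [← hg]; exact Int.ediv_eq_of_eq_mul_right hg0 hr
  have a2 : D / (Int.gcd r D : ℤ) = D' := by
    rw [← hg]; exact Int.ediv_eq_of_eq_mul_right hg0 hD'
  rwa [a1, a2] at this

lemma form_I {D r t s C : ℤ} (hD : Squarefree D) (ht : t ≠ 0) (hrt : IsCoprime r t)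
    (e : s ^ 2 = r ^ 3 + C * D ^ 3 * t ^ 6) :
    ∃ b c d : ℤ, cG (D * t ^ 3) b c d = 2 * s ∧ b ^ 2 - (D * t ^ 3) * c = r ∧ qD (D * t ^ 3) b c d = 4 * (C * D) := by
  obtain ⟨g, D', r', s', hg, hD', hr, hs, hc, e1⟩ := gcd_split hD hrt isCoprime_one_left
    (by rw [one_mul]; exact e)
  rw [one_mul] at e1
  set m := D' * t ^ 3 with hm
  have hcm : IsCoprime r' m := by
    rw [hm]
    exact IsCoprime.mul_right hc.of_mul_right_left (hc.of_mul_right_right.pow_right)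
  obtain ⟨b, ⟨w1, h1⟩, ⟨w2, h2⟩⟩ := lift_b (g := g) (s := s') (r := r') (M := m ^ 2) hcm.pow_right
    ⟨C * D', by rw [hm]; linear_combination e1⟩
  have ha : D * t ^ 3 = g * m := by rw [hD', hm]; ring
  have hG : cG (D * t ^ 3) (g * b) (m * w1) w2 = 2 * s := by
    rw [ha, hs]; simp only [cG]
    linear_combination (3 * g ^ 2 * b) * h1 - g ^ 2 * h2
  have hP : (g * b) ^ 2 - (D * t ^ 3) * (m * w1) = r := by
    rw [ha, hr]; linear_combination g * h1
  refine ⟨g * b, m * w1, w2, hG, hP, ?_⟩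
  have hsy := syz (D * t ^ 3) (g * b) (m * w1) w2
  rw [hG, hP] at hsy
  have h0 : (D * t ^ 3) ^ 2 ≠ 0 := pow_ne_zero 2 (mul_ne_zero hD.ne_zero (pow_ne_zero 3 ht))
  apply mul_left_cancel₀ h0
  rw [← hsy]; linear_combination 4 * e

/-- plain discriminant -/
def pD {R : Type*} [CommRing R] (a b c d : R) : R :=
  b ^ 2 * c ^ 2 - 4 * a * c ^ 3 - 4 * b ^ 3 * d - 27 * a ^ 2 * d ^ 2 + 18 * a * b * c * d

lemma syz2 {R : Type*} [CommRing R] (a b c d : R) :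
    4 * (b ^ 2 - 3 * a * c) ^ 3 - (2 * b ^ 3 - 9 * a * b * c + 27 * a ^ 2 * d) ^ 2 = 27 * a ^ 2 * pD a b c d := by
  simp only [pD]; ring

lemma form_II {A D r t s : ℤ} (hA : A % 9 = 1 ∨ A % 9 = 7) (hD : Squarefree D) (hD3 : D % 3 = 1)
    (ht : t ≠ 0) (hrt : IsCoprime r t)
    (e : s ^ 2 = r ^ 3 + 27 * A * D ^ 3 * t ^ 6) :
    ∃ b c d : ℤ, 2 * b ^ 3 - 9 * (D * t ^ 3) * b * c + 27 * (D * t ^ 3) ^ 2 * d = 2 * s ∧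
      pD (D * t ^ 3) b c d = 4 * (-A * D) := by
  have h3D : IsCoprime (3 : ℤ) D := by
    refine ⟨-(D / 3), 1, ?_⟩; omega
  have h27D : IsCoprime (27 : ℤ) D := by
    have := h3D.pow_left (m := 3); norm_num at this; exact this
  suffices H : ∃ b c d : ℤ, 2 * b ^ 3 - 9 * (D * t ^ 3) * b * c + 27 * (D * t ^ 3) ^ 2 * d = 2 * s ∧
      b ^ 2 - 3 * (D * t ^ 3) * c = r by
    obtain ⟨b, c, d, hG, hP⟩ := H
    refine ⟨b, c, d, hG, ?_⟩
    have hsy := syz2 (D * t ^ 3) b c d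
    rw [hG, hP] at hsy
    have h0 : 27 * (D * t ^ 3) ^ 2 ≠ 0 :=
      mul_ne_zero (by norm_num) (pow_ne_zero 2 (mul_ne_zero hD.ne_zero (pow_ne_zero 3 ht)))
    apply mul_left_cancel₀ h0
    rw [← hsy]; linear_combination -4 * e
  by_cases h3 : (3 : ℤ) ∣ r
  · obtain ⟨r1, hr1⟩ := h3
    have h3t : IsCoprime (3 : ℤ) t := hrt.of_isCoprime_of_dvd_left ⟨r1, hr1⟩
    have hs : (3 : ℤ) ∣ s := by
      have : (3 : ℤ) ∣ s ^ 2 := ⟨9 * r1 ^ 3 + 9 * A * D ^ 3 * t ^ 6, by rw [e, hr1]; ring⟩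
      exact Int.prime_three.dvd_of_dvd_pow this
    obtain ⟨sa, hsa⟩ := hs
    have e1 : sa ^ 2 = 3 * (r1 ^ 3 + A * D ^ 3 * t ^ 6) := by
      rw [hsa, hr1] at e; linarith
    obtain ⟨s1, hs1⟩ : (3 : ℤ) ∣ sa := Int.prime_three.dvd_of_dvd_pow (n := 2) ⟨_, e1⟩
    have e2 : 3 * s1 ^ 2 = r1 ^ 3 + A * D ^ 3 * t ^ 6 := by
      rw [hs1] at e1; linarith
    have hs1' : (3 : ℤ) ∣ s1 := by
      have hz : ((3 * s1 ^ 2 : ℤ) : ZMod 9) = ((r1 ^ 3 + A * D ^ 3 * t ^ 6 : ℤ) : ZMod 9) := by rw [e2]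
      push_cast at hz
      have hA' : (A : ZMod 9) = 1 ∨ (A : ZMod 9) = 7 := by
        rcases hA with h | h
        · left; have := (ZMod.intCast_eq_intCast_iff' A 1 9).2 (by push_cast; omega); simpa using this
        · right; have := (ZMod.intCast_eq_intCast_iff' A 7 9).2 (by push_cast; omega); simpa using this
      have hD' : (D : ZMod 9) ^ 3 = 1 := by
        have : D % 9 = 1 ∨ D % 9 = 4 ∨ D % 9 = 7 := by omega
        rcases this with h | h | h
        · have := (ZMod.intCast_eq_intCast_iff' D 1 9).2 (by push_cast; omega); rw [this]; decide
        · have := (ZMod.intCast_eq_intCast_iff' D 4 9).2 (by push_cast; omega); rw [this]; decide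
        · have := (ZMod.intCast_eq_intCast_iff' D 7 9).2 (by push_cast; omega); rw [this]; decide
      have ht' : (t : ZMod 9) ^ 6 = 1 := by
        obtain ⟨p, q, hpq⟩ := h3t
        have h4 : ((p * 3 + q * t : ℤ) : ZMod 9) = 1 := by rw [hpq]; simp
        push_cast at h4
        generalize (t : ZMod 9) = t' at *
        generalize (q : ZMod 9) = q' at *
        generalize (p : ZMod 9) = p' at *
        clear * - h4
        revert p' q' t'
        decide
      rw [hD', ht', mul_one, mul_one] at hz
      have h5 : (s1 : ZMod 9) * 3 = 0 := by
        generalize (s1 : ZMod 9) = s' at *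
        generalize (r1 : ZMod 9) = r' at *
        generalize (A : ZMod 9) = A' at *
        clear * - hz hA'
        revert s' r' A'
        decide
      have h6 : ((s1 * 3 : ℤ) : ZMod 9) = 0 := by push_cast; exact h5
      rw [ZMod.intCast_zmod_eq_zero_iff_dvd] at h6
      push_cast at h6
      omega
    obtain ⟨s2, hs2⟩ := hs1'
    have e3 : 27 * s2 ^ 2 = r1 ^ 3 + A * D ^ 3 * t ^ 6 := by rw [← e2, hs2]; ring
    have hr1t : IsCoprime r1 t := hrt.of_isCoprime_of_dvd_left ⟨3, by rw [hr1]; ring⟩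
    obtain ⟨g, D', r', s', hg, hD', hr, hs, hc, e4⟩ := gcd_split hD hr1t h27D e3
    set m := D' * t ^ 3 with hm
    have hcm : IsCoprime r' m := by
      rw [hm]
      exact IsCoprime.mul_right hc.of_mul_right_left (hc.of_mul_right_right.pow_right)
    have h3m : IsCoprime m 3 := by
      rw [hm]
      exact (IsCoprime.mul_right (h3D.of_isCoprime_of_dvd_right ⟨g, by rw [hD']; ring⟩) h3t.pow_right).symm
    obtain ⟨b, ⟨w1, h1⟩, h2⟩ := lift_b (g := 3 * g) (s := 3 * s') (r := r') (M := m ^ 2) hcm.pow_right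
      ⟨A * D', by rw [hm]; linear_combination e4⟩
    have h2' : m ^ 2 ∣ g * b ^ 3 - b * r' + 2 * s' := by
      refine (h3m.pow_left (m := 2)).dvd_of_dvd_mul_left (y := 3) ?_
      obtain ⟨w, hw⟩ := h2
      exact ⟨w, by linear_combination hw⟩
    obtain ⟨w2, h2⟩ := h2'
    have ha : D * t ^ 3 = g * m := by rw [hD', hm]; ring
    refine ⟨3 * g * b, m * w1, w2, ?_, ?_⟩
    · rw [ha, hsa, hs1, hs2, hs]
      linear_combination (27 * g ^ 2 * b) * h1 - 27 * g ^ 2 * h2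
    · rw [ha, hr1, hr]; linear_combination 3 * g * h1
  · obtain ⟨g, D', r', s', hg, hD', hr, hs, hc, e1⟩ := gcd_split (C := 27 * A) hD hrt isCoprime_one_left
      (by rw [one_mul]; exact e)
    rw [one_mul] at e1
    set m := D' * t ^ 3 with hm
    have hcm : IsCoprime r' m := by
      rw [hm]
      exact IsCoprime.mul_right hc.of_mul_right_left (hc.of_mul_right_right.pow_right)
    have h3r : IsCoprime r' 27 := by
      have : IsCoprime (3 : ℤ) r' := by
        rw [Int.prime_three.coprime_iff_not_dvd]
        intro h; apply h3; rw [hr]; exact h.mul_left g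
      have := this.symm.pow_right (n := 3); norm_num at this; exact this
    obtain ⟨b, ⟨w1, h1⟩, ⟨w2, h2⟩⟩ := lift_b (g := g) (s := s') (r := r') (M := 27 * m ^ 2)
      (h3r.mul_right hcm.pow_right)
      ⟨A * D', by rw [hm]; linear_combination e1⟩
    have ha : D * t ^ 3 = g * m := by rw [hD', hm]; ring
    refine ⟨g * b, 9 * m * w1, w2, ?_, ?_⟩
    · rw [ha, hs]
      linear_combination (3 * g ^ 2 * b) * h1 - g ^ 2 * h2
    · rw [ha, hr]; linear_combination g * h1
end points

section reduce
open Complex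

lemma sl2_fd (τ : ℂ) (hτ : 0 < τ.im) : ∃ p q r s : ℤ, p * s - q * r = 1 ∧ ∃ x y : ℝ, 0 < y ∧ |x| ≤ 1 / 2 ∧
    1 ≤ x ^ 2 + y ^ 2 ∧ τ * (r * (x + y * I) + s) = p * (x + y * I) + q := by
  obtain ⟨g, hg⟩ := ModularGroup.exists_smul_mem_fd (⟨τ, hτ⟩ : UpperHalfPlane)
  set z := g • (⟨τ, hτ⟩ : UpperHalfPlane) with hz
  have h1 : (⟨τ, hτ⟩ : UpperHalfPlane) = g⁻¹ • z := by rw [hz, inv_smul_smul]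
  have h2 := UpperHalfPlane.coe_specialLinearGroup_apply g⁻¹ z
  have h4 : τ = ((g⁻¹ • z : UpperHalfPlane) : ℂ) := by rw [← h1]
  rw [← h4] at h2
  have hdet := Matrix.SpecialLinearGroup.det_coe g⁻¹
  rw [Matrix.det_fin_two] at hdet
  generalize (g⁻¹) 0 0 = p at *
  generalize (g⁻¹) 0 1 = q at *
  generalize (g⁻¹) 1 0 = r at *
  generalize (g⁻¹) 1 1 = s at *
  refine ⟨p, q, r, s, hdet, z.re, z.im, z.im_pos, hg.2, ?_, ?_⟩
  · have := hg.1
    rw [Complex.normSq_apply] at this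
    calc (1:ℝ) ≤ _ := this
      _ = _ := by simp only [UpperHalfPlane.coe_re, UpperHalfPlane.coe_im]; ring
  · have e : ((z.re : ℂ) + z.im * I) = z := by
      apply Complex.ext <;> simp
    rw [e]
    have h3 : ((r : ℂ) * (z : ℂ) + s : ℂ) ≠ 0 := by
      intro h
      have hi := congrArg Complex.im h
      have hr := congrArg Complex.re h
      simp at hi hr
      have hr0 : r = 0 := by
        rcases hi with h | h
        · exact h
        · exact absurd h z.im_pos.ne'
      subst hr0
      simp at hr
      subst hr
      simp at hdet
    simp only [algebraMap_int_eq, eq_intCast, ofReal_intCast] at h2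
    rw [h2, div_mul_cancel₀ _ h3]

/-- The parametrization of binary cubic forms; `(β,γ,ε,s) = (1,1,1,3)` for the first family and
`(3,-3,-1,1)` for the second one. -/
noncomputable def Phi (β γ ε s u v x y : ℝ) : Fin 4 → ℝ :=
  ![u, (-3 * u * x + β * v * y) / s, (3 * u * x ^ 2 - 2 * β * v * x * y + γ * u * y ^ 2) / s,
    -u * x ^ 3 + β * v * x ^ 2 * y - γ * u * x * y ^ 2 + ε * v * y ^ 3]

/-- reduced integral forms -/
def Red (β γ ε s : ℝ) (f : Fin 4 → ℤ) : Prop :=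
  ∃ u v x y : ℝ, 0 < u ∧ 0 < y ∧ |x| ≤ 1 / 2 ∧ 1 ≤ x ^ 2 + y ^ 2 ∧
    (fun i => (f i : ℝ)) = Phi β γ ε s u v x y

lemma qD_Phi (u v x y : ℝ) :
    qD (Phi 1 1 1 3 u v x y 0) (Phi 1 1 1 3 u v x y 1) (Phi 1 1 1 3 u v x y 2) (Phi 1 1 1 3 u v x y 3) =
      4 / 27 * y ^ 6 * (u ^ 2 + v ^ 2) ^ 2 := by
  simp [Phi, qD]; ring

lemma pD_Phi (u v x y : ℝ) :
    pD (Phi 3 (-3) (-1) 1 u v x y 0) (Phi 3 (-3) (-1) 1 u v x y 1) (Phi 3 (-3) (-1) 1 u v x y 2)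
      (Phi 3 (-3) (-1) 1 u v x y 3) =
      108 * y ^ 6 * (u ^ 2 + v ^ 2) ^ 2 := by
  simp [Phi, pD]; ring

lemma cubic_root (a b c d : ℝ) (ha : a ≠ 0) (hq : 0 < qD a b c d) :
    ∃ τ : ℂ, 0 < τ.im ∧ (a : ℂ) * τ ^ 3 + 3 * b * τ ^ 2 + 3 * c * τ + d = 0 := by
  have hC : ∃ z : ℂ, (a : ℂ) * z ^ 3 + 3 * b * z ^ 2 + 3 * c * z + d = 0 := by
    have hd : (Cubic.toPoly ⟨(a : ℂ), 3 * b, 3 * c, d⟩).degree ≠ 0 := by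
      rw [Cubic.degree_of_a_ne_zero (show (a : ℂ) ≠ 0 from ofReal_ne_zero.2 ha)]; norm_num
    obtain ⟨z, hz⟩ := IsAlgClosed.exists_root _ hd
    refine ⟨z, ?_⟩
    simpa [Cubic.toPoly, Polynomial.IsRoot] using hz
  obtain ⟨z, hz⟩ := hC
  rcases lt_trichotomy z.im 0 with h | h | h
  · refine ⟨(starRingEnd ℂ) z, by simpa using h, ?_⟩
    have := congrArg (starRingEnd ℂ) hz
    have c3 : (starRingEnd ℂ) 3 = 3 := by apply Complex.ext <;> simp
    simpa [c3] using this
  · have hzr : z = (z.re : ℂ) := by apply Complex.ext <;> simp [h]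
    set ρ := z.re with hρ
    rw [hzr] at hz
    have hz' : a * ρ ^ 3 + 3 * b * ρ ^ 2 + 3 * c * ρ + d = 0 := by exact_mod_cast hz
    have hdd : d = -(a * ρ ^ 3 + 3 * b * ρ ^ 2 + 3 * c * ρ) := by linarith
    set Δ := (3 * b + a * ρ) ^ 2 - 4 * a * (3 * c + 3 * b * ρ + a * ρ ^ 2) with hΔ
    have e1 : -27 * qD a b c d = Δ * (3 * a * ρ ^ 2 + 6 * b * ρ + 3 * c) ^ 2 := by
      rw [hdd, hΔ]; simp only [qD]; ring
    have hΔ0 : Δ < 0 := by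
      by_contra hcon
      have := mul_nonneg (not_lt.1 hcon) (sq_nonneg (3 * a * ρ ^ 2 + 6 * b * ρ + 3 * c))
      linarith
    set w := Real.sqrt (-Δ) with hw
    have hw0 : 0 < w := Real.sqrt_pos.2 (by linarith)
    have hw2 : w ^ 2 = -Δ := Real.sq_sqrt (by linarith)
    refine ⟨⟨-(3 * b + a * ρ) / (2 * a), w / (2 * |a|)⟩, div_pos hw0 (by positivity), ?_⟩
    have ha' : (a : ℂ) ≠ 0 := by exact_mod_cast ha
    set τ : ℂ := ⟨-(3 * b + a * ρ) / (2 * a), w / (2 * |a|)⟩ with hτ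
    have e2 : (a : ℂ) * τ ^ 2 + (3 * b + a * ρ) * τ + (3 * c + 3 * b * ρ + a * ρ ^ 2) = 0 := by
      have haa : |a| ^ 2 = a ^ 2 := sq_abs a
      have hab : |a| ≠ 0 := abs_ne_zero.2 ha
      apply Complex.ext
      · simp only [pow_two, add_re, mul_re, ofReal_re, ofReal_im, mul_im, add_im, hτ, zero_re, re_ofNat, im_ofNat]
        have e : w / (2 * |a|) * (w / (2 * |a|)) = -Δ / (4 * a ^ 2) := by
          rw [← hw2, ← haa]; field_simp; norm_num
        simp only [zero_mul, mul_zero, add_zero, sub_zero, e]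
        rw [hΔ]; field_simp; ring
      · simp only [pow_two, add_re, mul_re, ofReal_re, ofReal_im, mul_im, add_im, hτ, zero_im, re_ofNat, im_ofNat]
        field_simp; ring
    have hdC : (d : ℂ) = -(a * ρ ^ 3 + 3 * b * ρ ^ 2 + 3 * c * ρ) := by exact_mod_cast hdd
    rw [hdC]
    linear_combination (τ - ρ) * e2
  · exact ⟨z, h, hz⟩

lemma quad_root (P Q R : ℝ) (h : Q ^ 2 - 4 * P * R < 0) :
    ∃ τ : ℂ, 0 < τ.im ∧ (P : ℂ) * τ ^ 2 + Q * τ + R = 0 := by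
  have hP : P ≠ 0 := by rintro rfl; nlinarith [sq_nonneg Q]
  set w := Real.sqrt (-(Q ^ 2 - 4 * P * R)) with hw
  have hw0 : 0 < w := Real.sqrt_pos.2 (by linarith)
  have hw2 : w ^ 2 = -(Q ^ 2 - 4 * P * R) := Real.sq_sqrt (by linarith)
  refine ⟨⟨-Q / (2 * P), w / (2 * |P|)⟩, div_pos hw0 (by positivity), ?_⟩
  have haa : |P| ^ 2 = P ^ 2 := sq_abs P
  have hab : |P| ≠ 0 := abs_ne_zero.2 hP
  apply Complex.ext
  · simp only [pow_two, add_re, mul_re, ofReal_re, ofReal_im, mul_im, add_im, zero_re]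
    have e : w / (2 * |P|) * (w / (2 * |P|)) = -(Q ^ 2 - 4 * P * R) / (4 * P ^ 2) := by
      rw [← hw2, ← haa]; field_simp; norm_num
    simp only [zero_mul, mul_zero, add_zero, sub_zero, e]
    field_simp; ring
  · simp only [pow_two, add_re, mul_re, ofReal_re, ofReal_im, mul_im, add_im, zero_im]
    field_simp; ring

/-- the cast of an integral form -/
lemma param_I {a b c d x y : ℝ} (hy : 0 < y)
    (h : (a : ℂ) * (x + y * I) ^ 3 + 3 * b * (x + y * I) ^ 2 + 3 * c * (x + y * I) + d = 0) :
    ∃ v, ![a, b, c, d] = Phi 1 1 1 3 a v x y := by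
  have e : (a : ℂ) * (x + y * I) ^ 3 + 3 * b * (x + y * I) ^ 2 + 3 * c * (x + y * I) + d =
     ((a * (x ^ 3 - 3 * x * y ^ 2) + 3 * b * (x ^ 2 - y ^ 2) + 3 * c * x + d : ℝ) : ℂ) +
     ((y * (a * (3 * x ^ 2 - y ^ 2) + 6 * b * x + 3 * c) : ℝ) : ℂ) * I := by
    have : I ^ 2 = -1 := I_sq
    push_cast
    linear_combination (3 * a * x * y ^ 2 + a * y ^ 3 * I + 3 * b * y ^ 2) * this
  rw [e] at h
  have hr := congrArg Complex.re h
  have hi := congrArg Complex.im h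
  simp only [add_re, mul_re, ofReal_re, ofReal_im, I_re, I_im, add_im, mul_im, zero_re, zero_im] at hr hi
  have hi' : a * (3 * x ^ 2 - y ^ 2) + 6 * b * x + 3 * c = 0 := by
    have : y * (a * (3 * x ^ 2 - y ^ 2) + 6 * b * x + 3 * c) = 0 := by linarith
    exact (mul_eq_zero.1 this).resolve_left hy.ne'
  refine ⟨(3 * b + 3 * a * x) / y, ?_⟩
  have hc : c = -(a * (3 * x ^ 2 - y ^ 2) + 6 * b * x) / 3 := by linarith
  have hd : d = -(a * (x ^ 3 - 3 * x * y ^ 2) + 3 * b * (x ^ 2 - y ^ 2) + 3 * c * x) := by linarith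
  rw [hc] at hd
  rw [Phi, hc, hd]
  ext i
  fin_cases i
  · simp
  · simp; field_simp; ring
  · simp; field_simp; ring
  · simp; field_simp; ring

lemma param_II {a b c d x y : ℝ} (hy : 0 < y) (ha : a ≠ 0) (hp : 0 < pD a b c d)
    (h : ((b ^ 2 - 3 * a * c : ℝ) : ℂ) * (x + y * I) ^ 2 + ((b * c - 9 * a * d : ℝ) : ℂ) * (x + y * I) +
      ((c ^ 2 - 3 * b * d : ℝ) : ℂ) = 0) :
    ∃ v, ![a, b, c, d] = Phi 3 (-3) (-1) 1 a v x y := by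
  set P := b ^ 2 - 3 * a * c with hP
  set Q := b * c - 9 * a * d with hQ
  set R := c ^ 2 - 3 * b * d with hR
  have hPQ : Q ^ 2 - 4 * P * R = -3 * pD a b c d := by
    rw [hP, hQ, hR]; simp only [pD]; ring
  have hP0 : P ≠ 0 := by
    intro h0; rw [h0] at hPQ; nlinarith [sq_nonneg Q]
  have e : (P : ℂ) * (x + y * I) ^ 2 + Q * (x + y * I) + R =
     ((P * (x ^ 2 - y ^ 2) + Q * x + R : ℝ) : ℂ) + ((y * (2 * P * x + Q) : ℝ) : ℂ) * I := by
    have : I ^ 2 = -1 := I_sq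
    push_cast
    linear_combination (P * y ^ 2) * this
  rw [e] at h
  have hr := congrArg Complex.re h
  have hi := congrArg Complex.im h
  simp only [add_re, mul_re, ofReal_re, ofReal_im, I_re, I_im, add_im, mul_im, zero_re, zero_im] at hr hi
  have hi' : 2 * P * x + Q = 0 := by
    have : y * (2 * P * x + Q) = 0 := by linarith
    exact (mul_eq_zero.1 this).resolve_left hy.ne'
  -- translate
  set b0 := b + 3 * a * x with hb0
  set c0 := c + 2 * b * x + 3 * a * x ^ 2 with hc0
  set d0 := d + c * x + b * x ^ 2 + a * x ^ 3 with hd0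
  have hP1 : b0 ^ 2 - 3 * a * c0 = P := by rw [hb0, hc0, hP]; ring
  have hQ1 : b0 * c0 - 9 * a * d0 = 0 := by
    have : b0 * c0 - 9 * a * d0 = Q + 2 * P * x := by rw [hb0, hc0, hd0, hP, hQ]; ring
    rw [this]; linarith
  have hR1 : c0 ^ 2 - 3 * b0 * d0 = y ^ 2 * P := by
    have : c0 ^ 2 - 3 * b0 * d0 = R + Q * x + P * x ^ 2 := by rw [hb0, hc0, hd0, hP, hQ, hR]; ring
    rw [this]; linarith
  have hdd : d0 = b0 * c0 / (9 * a) := by field_simp; linarith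
  have key : P * (c0 + 3 * a * y ^ 2) = 0 := by
    rw [hdd] at hR1
    have h1 : 3 * a * c0 ^ 2 - b0 ^ 2 * c0 = 3 * a * y ^ 2 * P := by
      field_simp at hR1
      linear_combination hR1 / 3
    rw [← hP1] at h1 ⊢
    linear_combination -h1
  have hc1 : c0 = -3 * a * y ^ 2 := by
    have := (mul_eq_zero.1 key).resolve_left hP0
    linarith
  have hd1 : d0 = -(b0 * y ^ 2) / 3 := by
    rw [hdd, hc1]; field_simp; try norm_num
  refine ⟨b0 / (3 * y), ?_⟩
  have hc : c = -3 * a * y ^ 2 - 2 * b * x - 3 * a * x ^ 2 := by linarith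
  have hd : d = -(b0 * y ^ 2) / 3 - c * x - b * x ^ 2 - a * x ^ 3 := by linarith
  have hb : b = b0 - 3 * a * x := by rw [hb0]; ring
  rw [hc, hb] at hd
  rw [hb] at hc
  rw [Phi, hb, hc, hd]
  ext i
  clear_value b0
  fin_cases i
  · simp
  · simp; field_simp; ring
  · simp; field_simp; ring
  · simp; field_simp; ring

end reduce

section reduce2
open Complex

lemma red_I_aux {a b c d p q r s : ℤ} {x y : ℝ} {τ : ℂ} (hy : 0 < y) (hx : |x| ≤ 1 / 2) (hxy : 1 ≤ x ^ 2 + y ^ 2)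
    (hpos : 0 < tA a b c d p r)
    (h : (a : ℂ) * τ ^ 3 + 3 * b * τ ^ 2 + 3 * c * τ + d = 0)
    (e : τ * (r * (x + y * I) + s) = p * (x + y * I) + q) :
    Red 1 1 1 3 ![tA a b c d p r, tB a b c d p q r s, tC a b c d p q r s, tA a b c d q s] := by
  obtain ⟨v, hv⟩ := param_I (a := (tA a b c d p r : ℤ)) (b := (tB a b c d p q r s : ℤ))
    (c := (tC a b c d p q r s : ℤ)) (d := (tA a b c d q s : ℤ)) (x := x) hy (by
      generalize (x : ℂ) + y * I = z at *
      have : (a : ℂ) * (p * z + q) ^ 3 + 3 * b * (p * z + q) ^ 2 * (r * z + s) +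
         3 * c * (p * z + q) * (r * z + s) ^ 2 + d * (r * z + s) ^ 3 = 0 := by
        rw [← e]; linear_combination (r * z + s) ^ 3 * h
      simp only [tA, tB, tC]; push_cast
      linear_combination this)
  refine ⟨_, v, x, y, Int.cast_pos.2 hpos, hy, hx, hxy, ?_⟩
  rw [← hv]
  ext i; fin_cases i <;> simp

lemma tA_neg (a b c d p r : ℤ) : tA a b c d (-p) (-r) = -tA a b c d p r := by
  simp only [tA]; ring

lemma red_I (a b c d : ℤ) (ha : a ≠ 0) (hq : 0 < qD a b c d) :
    ∃ p q r s : ℤ, p * s - q * r = 1 ∧ (tA a b c d p r = 0 ∨ 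
      Red 1 1 1 3 ![tA a b c d p r, tB a b c d p q r s, tC a b c d p q r s, tA a b c d q s]) := by
  have hq' : 0 < qD (a : ℝ) b c d := by
    have : ((qD a b c d : ℤ) : ℝ) = qD (a : ℝ) b c d := by simp [qD]
    rw [← this]; exact_mod_cast hq
  obtain ⟨τ, hτ, h⟩ := cubic_root a b c d (by exact_mod_cast ha) hq'
  obtain ⟨p, q, r, s, hdet, x, y, hy, hx, hxy, e⟩ := sl2_fd τ hτ
  simp only [ofReal_intCast] at h
  rcases lt_trichotomy (tA a b c d p r) 0 with h0 | h0 | h0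
  · refine ⟨-p, -q, -r, -s, by linarith, Or.inr ?_⟩
    exact red_I_aux hy hx hxy (by rw [tA_neg]; linarith) h (by push_cast; linear_combination -e)
  · exact ⟨p, q, r, s, hdet, Or.inl h0⟩
  · exact ⟨p, q, r, s, hdet, Or.inr (red_I_aux hy hx hxy h0 h e)⟩

/-- plain transforms -/
def pA {R : Type*} [CommRing R] (a b c d p r : R) : R :=
  a * p ^ 3 + b * p ^ 2 * r + c * p * r ^ 2 + d * r ^ 3
def pB {R : Type*} [CommRing R] (a b c d p q r s : R) : R :=
  3 * a * p ^ 2 * q + b * (p ^ 2 * s + 2 * p * q * r) + c * (q * r ^ 2 + 2 * p * r * s) + 3 * d * r ^ 2 * s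
def pC {R : Type*} [CommRing R] (a b c d p q r s : R) : R :=
  3 * a * p * q ^ 2 + b * (q ^ 2 * r + 2 * p * q * s) + c * (p * s ^ 2 + 2 * q * r * s) + 3 * d * r * s ^ 2

lemma pD_trans {R : Type*} [CommRing R] (a b c d p q r s : R) (h : p * s - q * r = 1) :
    pD (pA a b c d p r) (pB a b c d p q r s) (pC a b c d p q r s) (pA a b c d q s) = pD a b c d := by
  have : pD (pA a b c d p r) (pB a b c d p q r s) (pC a b c d p q r s) (pA a b c d q s) =
    (p * s - q * r) ^ 6 * pD a b c d := by
    simp only [pD, pA, pB, pC]; ring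
  rw [this, h]; ring

lemma red_II_aux {a b c d p q r s : ℤ} {x y : ℝ} {τ : ℂ} (hy : 0 < y) (hx : |x| ≤ 1 / 2) (hxy : 1 ≤ x ^ 2 + y ^ 2)
    (hdet : p * s - q * r = 1) (hp : 0 < pD a b c d)
    (hpos : 0 < pA a b c d p r)
    (h : (b ^ 2 - 3 * a * c : ℂ) * τ ^ 2 + (b * c - 9 * a * d) * τ + (c ^ 2 - 3 * b * d) = 0)
    (e : τ * (r * (x + y * I) + s) = p * (x + y * I) + q) :
    Red 3 (-3) (-1) 1 ![pA a b c d p r, pB a b c d p q r s, pC a b c d p q r s, pA a b c d q s] := by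
  obtain ⟨v, hv⟩ := param_II (a := (pA a b c d p r : ℤ)) (b := (pB a b c d p q r s : ℤ))
    (c := (pC a b c d p q r s : ℤ)) (d := (pA a b c d q s : ℤ)) (x := x) hy (by exact_mod_cast hpos.ne')
    (by
      have h1 := pD_trans a b c d p q r s hdet
      have : ((pD (pA a b c d p r) (pB a b c d p q r s) (pC a b c d p q r s) (pA a b c d q s) : ℤ) : ℝ) =
        pD ((pA a b c d p r : ℤ) : ℝ) ((pB a b c d p q r s : ℤ) : ℝ) ((pC a b c d p q r s : ℤ) : ℝ)
          ((pA a b c d q s : ℤ) : ℝ) := by generalize pA a b c d p r = a1; simp [pD]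
      rw [← this, h1]; exact_mod_cast hp)
    (by
      generalize (x : ℂ) + y * I = z at *
      have hdet' : (p * s - q * r : ℂ) = 1 := by exact_mod_cast hdet
      have : (b ^ 2 - 3 * a * c : ℂ) * (p * z + q) ^ 2 + (b * c - 9 * a * d) * (p * z + q) * (r * z + s)
         + (c ^ 2 - 3 * b * d) * (r * z + s) ^ 2 = 0 := by
        rw [← e]; linear_combination (r * z + s) ^ 2 * h
      have this2 : (p * s - q * r : ℂ) ^ 2 * ((b ^ 2 - 3 * a * c : ℂ) * (p * z + q) ^ 2 + (b * c - 9 * a * d) * (p * z + q) * (r * z + s)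
         + (c ^ 2 - 3 * b * d) * (r * z + s) ^ 2) = 0 := by rw [this, mul_zero]
      simp only [pA, pB, pC]; push_cast
      linear_combination this2)
  refine ⟨_, v, x, y, Int.cast_pos.2 hpos, hy, hx, hxy, ?_⟩
  rw [← hv]
  ext i; fin_cases i <;> simp

lemma pA_neg (a b c d p r : ℤ) : pA a b c d (-p) (-r) = -pA a b c d p r := by
  simp only [pA]; ring

lemma red_II (a b c d : ℤ) (hq : 0 < pD a b c d) :
    ∃ p q r s : ℤ, p * s - q * r = 1 ∧ (pA a b c d p r = 0 ∨ 
      Red 3 (-3) (-1) 1 ![pA a b c d p r, pB a b c d p q r s, pC a b c d p q r s, pA a b c d q s]) := by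
  have hq' : 0 < pD (a : ℝ) b c d := by
    have : ((pD a b c d : ℤ) : ℝ) = pD (a : ℝ) b c d := by simp [pD]
    rw [← this]; exact_mod_cast hq
  obtain ⟨τ, hτ, h⟩ := quad_root (b ^ 2 - 3 * a * c) (b * c - 9 * a * d) (c ^ 2 - 3 * b * d)
    (by simp only [pD] at hq'; linarith)
  obtain ⟨p, q, r, s, hdet, x, y, hy, hx, hxy, e⟩ := sl2_fd τ hτ
  push_cast at h
  rcases lt_trichotomy (pA a b c d p r) 0 with h0 | h0 | h0
  · refine ⟨-p, -q, -r, -s, by linarith, Or.inr ?_⟩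
    exact red_II_aux hy hx hxy (by linarith) hq (by rw [pA_neg]; linarith) h (by push_cast; linear_combination -e)
  · exact ⟨p, q, r, s, hdet, Or.inl h0⟩
  · exact ⟨p, q, r, s, hdet, Or.inr (red_II_aux hy hx hxy hdet hq h0 h e)⟩

end reduce2

section rankbound
open WeierstrassCurve.Affine

/-- reduced forms of the first family with given invariant -/
def S1 (N : ℤ) : Set (Fin 4 → ℤ) := {f | Red 1 1 1 3 f ∧ qD (f 0) (f 1) (f 2) (f 3) = 4 * N}
/-- reduced forms of the second family with given invariant -/
def S2 (N : ℤ) : Set (Fin 4 → ℤ) := {f | Red 3 (-3) (-1) 1 f ∧ pD (f 0) (f 1) (f 2) (f 3) = 4 * N}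

lemma exists_I {A D : ℤ} (hN : 0 < -A * D) (hD : Squarefree D) {k : ℚ} {κ : ℂ} (h : IsRt k κ)
    (hk : k = ((-(A * D ^ 3) : ℤ) : ℚ)) (P : (MC k).toAffine.Point) (hP : ¬ cubK κ (dl κ P)) :
    ∃ f ∈ S1 (-A * D), cubK κ (dl κ P * th (2 / D) κ (f 0) (f 1) (f 2) (f 3)) := by
  rcases P with _ | ⟨x, y, hxy⟩
  · exact absurd cub_one hP
  have e := MC_eq_of_ns hxy
  have hx0 := h.x_ne e
  have hD0 : (D : ℚ) ≠ 0 := by exact_mod_cast hD.ne_zero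
  have hD0' : (D : ℂ) ≠ 0 := by exact_mod_cast hD.ne_zero
  have e' := e
  rw [hk] at e'
  obtain ⟨r, s, t, ht, hrt, hx, hy, e1⟩ := rat_coords e'
  obtain ⟨b, c, d, hG, hPP, hq⟩ := form_I (C := -A) hD ht hrt (by rw [e1]; ring)
  have ht' : (t : ℂ) ≠ 0 := by exact_mod_cast ht
  have hμ : (2 / D : ℚ) ≠ 0 := div_ne_zero two_ne_zero hD0
  have hqm : ∀ a b c d : ℤ, qD a b c d = 4 * (-A * D) → qD (a : ℚ) b c d = (2 / D : ℚ) ^ 2 * k := by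
    intro a b c d hq
    have : ((qD a b c d : ℤ) : ℚ) = qD (a : ℚ) b c d := by simp [qD]
    rw [← this, hq, hk]; push_cast; field_simp; ring
  have hcls : cubK κ (dl κ (Point.some x y hxy) * th (2 / D) κ ((D * t ^ 3 : ℤ) : ℚ) b c d) := by
    have e2 : th (2 / D) κ ((D * t ^ 3 : ℤ) : ℚ) b c d = s + t ^ 3 * κ := by
      have : cG ((D * t ^ 3 : ℤ) : ℚ) b c d = ((cG (D * t ^ 3) b c d : ℤ) : ℚ) := by simp [cG]
      rw [th, this, hG]; push_cast; field_simp
    have e3 : dl κ (Point.some x y hxy) = y - κ := rfl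
    have e4 : (y : ℂ) ^ 2 = x ^ 3 + k := by exact_mod_cast e
    have e5 : (s : ℂ) = y * t ^ 3 := by rw [hy]; push_cast; field_simp
    refine ⟨((x * t : ℚ) : ℂ), inK_rat _, ?_, ?_⟩
    · push_cast; exact mul_ne_zero (by exact_mod_cast hx0) ht'
    · rw [e2, e3, e5]; push_cast
      linear_combination t ^ 3 * e4 - t ^ 3 * h.sq
  obtain ⟨p, q, r', s', hdet, hcase⟩ := red_I (D * t ^ 3) b c d
    (mul_ne_zero hD.ne_zero (pow_ne_zero 3 ht)) (by rw [hq]; linarith)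
  have hdet' : (p : ℚ) * s' - q * r' = 1 := by exact_mod_cast hdet
  have htr := h.class_trans hμ (hqm _ _ _ _ hq) hdet' hcls
  have hq2 := qD_trans (D * t ^ 3) b c d p q r' s' hdet
  rw [hq] at hq2
  have c1 : ((tA (D * t ^ 3) b c d p r' : ℤ) : ℚ) = tA ((D * t ^ 3 : ℤ) : ℚ) b c d p r' := by
    simp only [tA]; push_cast; ring
  have c2 : ((tB (D * t ^ 3) b c d p q r' s' : ℤ) : ℚ) = tB ((D * t ^ 3 : ℤ) : ℚ) b c d p q r' s' := by
    simp only [tB]; push_cast; ring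
  have c3 : ((tC (D * t ^ 3) b c d p q r' s' : ℤ) : ℚ) = tC ((D * t ^ 3 : ℤ) : ℚ) b c d p q r' s' := by
    simp only [tC]; push_cast; ring
  have c4 : ((tA (D * t ^ 3) b c d q s' : ℤ) : ℚ) = tA ((D * t ^ 3 : ℤ) : ℚ) b c d q s' := by
    simp only [tA]; push_cast; ring
  rw [← c1, ← c2, ← c3, ← c4] at htr
  rcases hcase with h0 | hred
  · exfalso
    apply hP
    have hq3 := hqm _ _ _ _ hq2
    rw [h0] at htr hq3
    rw [Int.cast_zero] at htr hq3
    exact h.class_zero hμ hq3 htr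
  · exact ⟨_, ⟨hred, hq2⟩, htr⟩

lemma exists_II {A D : ℤ} (hN : 0 < -A * D) (hA : A % 9 = 1 ∨ A % 9 = 7) (hD : Squarefree D) (hD3 : D % 3 = 1)
    {k : ℚ} {κ : ℂ} (h : IsRt k κ)
    (hk : k = ((27 * A * D ^ 3 : ℤ) : ℚ)) (P : (MC k).toAffine.Point) (hP : ¬ cubK κ (dl κ P)) :
    ∃ f ∈ S2 (-A * D), cubK κ (dl κ P * th (2 / (27 * D)) κ (f 0) (f 1 / 3) (f 2 / 3) (f 3)) := by
  rcases P with _ | ⟨x, y, hxy⟩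
  · exact absurd cub_one hP
  have e := MC_eq_of_ns hxy
  have hx0 := h.x_ne e
  have hD0 : (D : ℚ) ≠ 0 := by exact_mod_cast hD.ne_zero
  have hD0' : (D : ℂ) ≠ 0 := by exact_mod_cast hD.ne_zero
  have e' := e
  rw [hk] at e'
  obtain ⟨r, s, t, ht, hrt, hx, hy, e1⟩ := rat_coords e'
  obtain ⟨b, c, d, hG, hq⟩ := form_II hA hD hD3 ht hrt e1
  have ht' : (t : ℂ) ≠ 0 := by exact_mod_cast ht
  have hμ : (2 / (27 * D) : ℚ) ≠ 0 := div_ne_zero two_ne_zero (mul_ne_zero (by norm_num) hD0)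
  have hqm : ∀ a b c d : ℤ, pD a b c d = 4 * (-A * D) →
      qD (a : ℚ) (b / 3) (c / 3) d = (2 / (27 * D) : ℚ) ^ 2 * k := by
    intro a b c d hq
    have : ((pD a b c d : ℤ) : ℚ) = -27 * qD (a : ℚ) (b / 3) (c / 3) d := by simp [qD, pD]; ring
    have h2 : qD (a : ℚ) (b / 3) (c / 3) d = -((pD a b c d : ℤ) : ℚ) / 27 := by rw [this]; ring
    rw [h2, hq, hk]; push_cast; field_simp; ring
  have hcls : cubK κ (dl κ (Point.some x y hxy) * th (2 / (27 * D)) κ ((D * t ^ 3 : ℤ) : ℚ) (b / 3) (c / 3) d) := by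
    have e2 : th (2 / (27 * D)) κ ((D * t ^ 3 : ℤ) : ℚ) (b / 3) (c / 3) d = (s + t ^ 3 * κ) / 27 := by
      have : cG ((D * t ^ 3 : ℤ) : ℚ) (b / 3) (c / 3) d =
        ((2 * b ^ 3 - 9 * (D * t ^ 3) * b * c + 27 * (D * t ^ 3) ^ 2 * d : ℤ) : ℚ) / 27 := by simp [cG]; ring
      rw [th, this, hG]; push_cast; field_simp
    have e3 : dl κ (Point.some x y hxy) = y - κ := rfl
    have e4 : (y : ℂ) ^ 2 = x ^ 3 + k := by exact_mod_cast e
    have e5 : (s : ℂ) = y * t ^ 3 := by rw [hy]; push_cast; field_simp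
    refine ⟨((x * t / 3 : ℚ) : ℂ), inK_rat _, ?_, ?_⟩
    · push_cast; exact div_ne_zero (mul_ne_zero (by exact_mod_cast hx0) ht') (by norm_num)
    · rw [e2, e3, e5]; push_cast
      linear_combination t ^ 3 / 27 * e4 - t ^ 3 / 27 * h.sq
  obtain ⟨p, q, r', s', hdet, hcase⟩ := red_II (D * t ^ 3) b c d (by rw [hq]; linarith)
  have hdet' : (p : ℚ) * s' - q * r' = 1 := by exact_mod_cast hdet
  have htr := h.class_trans hμ (hqm _ _ _ _ hq) hdet' hcls
  have hq2 := pD_trans (D * t ^ 3) b c d p q r' s' hdet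
  rw [hq] at hq2
  have c1 : ((pA (D * t ^ 3) b c d p r' : ℤ) : ℚ) = tA ((D * t ^ 3 : ℤ) : ℚ) (b / 3) (c / 3) d p r' := by
    simp only [tA, pA]; push_cast; ring
  have c2 : ((pB (D * t ^ 3) b c d p q r' s' : ℤ) : ℚ) / 3 = tB ((D * t ^ 3 : ℤ) : ℚ) (b / 3) (c / 3) d p q r' s' := by
    simp only [tB, pB]; push_cast; ring
  have c3 : ((pC (D * t ^ 3) b c d p q r' s' : ℤ) : ℚ) / 3 = tC ((D * t ^ 3 : ℤ) : ℚ) (b / 3) (c / 3) d p q r' s' := by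
    simp only [tC, pC]; push_cast; ring
  have c4 : ((pA (D * t ^ 3) b c d q s' : ℤ) : ℚ) = tA ((D * t ^ 3 : ℤ) : ℚ) (b / 3) (c / 3) d q s' := by
    simp only [tA, pA]; push_cast; ring
  rw [← c1, ← c2, ← c3, ← c4] at htr
  rcases hcase with h0 | hred
  · exfalso
    apply hP
    have hq3 := hqm _ _ _ _ hq2
    rw [h0] at htr hq3
    rw [Int.cast_zero] at htr hq3
    exact h.class_zero hμ hq3 htr
  · exact ⟨_, ⟨hred, hq2⟩, htr⟩

lemma pow3_a (r : ℕ) : 6 * r ≤ 3 ^ r + 3 := by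
  rcases r with _ | _ | _ | r
  · norm_num
  · norm_num
  · norm_num
  · induction r with
    | zero => norm_num
    | succ n ih =>
      have : 3 ^ (n + 1 + 1 + 1 + 1) = 3 * 3 ^ (n + 1 + 1 + 1) := by ring
      rw [this]; omega

lemma pow3_b (r : ℕ) : 2 * r + 1 ≤ 3 ^ r := by
  induction r with
  | zero => norm_num
  | succ n ih => rw [pow_succ]; omega

theorem rank_bound {A D : ℤ} (hA : A % 9 = 1 ∨ A % 9 = 7) (hA0 : A < 0) (hD0 : 0 < D)
    (hA4 : A % 4 = 1) (hD : Squarefree D) (hD12 : D % 12 = 1)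
    (f1 : (S1 (-A * D)).Finite) (f2 : (S2 (-A * D)).Finite) :
    (mordellRank (-(A * D ^ 3)) : ℝ) ≤ ((S1 (-A * D)).ncard + 4) / 6 + ((S2 (-A * D)).ncard : ℝ) / 2 := by
  have hN : 0 < -A * D := by nlinarith
  set k : ℚ := ((-(A * D ^ 3) : ℤ) : ℚ) with hk
  have hk27 : -27 * k = ((27 * A * D ^ 3 : ℤ) : ℚ) := by rw [hk]; push_cast; ring
  have hD0' : (D : ℚ) ≠ 0 := by exact_mod_cast hD0.ne'
  have irr : ¬ IsSquare k := by
    rintro ⟨z, hz⟩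
    have h1 : IsSquare (((-A * D : ℤ)) : ℚ) := by
      refine ⟨z / D, ?_⟩
      field_simp
      rw [pow_two z, ← hz, hk]; push_cast; ring
    rw [Rat.isSquare_intCast_iff] at h1
    obtain ⟨w, hw⟩ := h1
    have h2 : (-A * D) % 4 = 3 := by
      have h3 : (-A) % 4 = 3 := by omega
      have h4 : D % 4 = 1 := by omega
      rw [Int.mul_emod, h3, h4]; rfl
    rw [hw] at h2
    have : w % 4 = 0 ∨ w % 4 = 1 ∨ w % 4 = 2 ∨ w % 4 = 3 := by omega
    rcases this with h | h | h | h <;> rw [Int.mul_emod, h] at h2 <;> norm_num at h2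
  have hkpos : 0 < k := by
    rw [hk]; have : 0 < -(A * D ^ 3) := by nlinarith [pow_pos hD0 3, mul_pos (neg_pos.2 hA0) (pow_pos hD0 3)]
    exact_mod_cast this
  have irr' : ¬ IsSquare (-27 * k) := by
    rintro ⟨z, hz⟩; nlinarith [mul_self_nonneg z]
  obtain ⟨κ, hκ⟩ := IsAlgClosed.exists_pow_nat_eq (k : ℂ) (n := 2) (by norm_num)
  obtain ⟨κ', hκ'⟩ := IsAlgClosed.exists_pow_nat_eq ((-27 * k : ℚ) : ℂ) (n := 2) (by norm_num)
  have h : IsRt k κ := ⟨hκ, irr⟩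
  have h' : IsRt (-27 * k) κ' := ⟨hκ', irr'⟩
  have hdiv : ∀ (κ z w θ : ℂ) (k : ℚ), IsRt k κ → w ≠ 0 → cubK κ (z * θ) → cubK κ (w * θ) → cubK κ (z / w) := by
    intro κ z w θ k hk hw0 hz hw
    have h0 : θ ≠ 0 := by
      rintro rfl
      obtain ⟨u, -, hu, e⟩ := hz
      rw [mul_zero] at e
      exact hu (pow_eq_zero_iff (by norm_num) |>.1 e.symm)
    have := hk.cub_div hz hw
    rwa [mul_div_mul_right _ _ h0] at this
  obtain ⟨r, r', hr, hr1, hr2⟩ := rank_le_of_classes h h' f1.toFinset f2.toFinset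
    (fun P f => cubK κ (dl κ P * th (2 / D) κ (f 0) (f 1) (f 2) (f 3)))
    (fun P f => cubK κ' (dl κ' P * th (2 / (27 * D)) κ' (f 0) (f 1 / 3) (f 2 / 3) (f 3)))
    (fun P hP => by
      obtain ⟨f, hf, hc⟩ := exists_I hN hD h hk P hP
      exact ⟨f, by simpa using hf, hc⟩)
    (fun P Q s hP hQ => hdiv _ _ _ _ _ h (h.dl_ne Q) hP hQ)
    (fun P hP => by
      obtain ⟨f, hf, hc⟩ := exists_II hN hA hD (by omega) h' hk27 P hP
      exact ⟨f, by simpa using hf, hc⟩)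
    (fun P Q s hP hQ => hdiv _ _ _ _ _ h' (h'.dl_ne Q) hP hQ)
  have hrk : mordellRank (-(A * D ^ 3)) ≤ r + r' := hr
  rw [← Set.ncard_eq_toFinset_card _ f1] at hr1
  rw [← Set.ncard_eq_toFinset_card _ f2] at hr2
  have a1 := pow3_a r
  have a2 := pow3_b r'
  have b1 : 6 * (r : ℝ) ≤ (S1 (-A * D)).ncard + 4 := by
    have : 6 * r ≤ (S1 (-A * D)).ncard + 4 := by omega
    exact_mod_cast this
  have b2 : 2 * (r' : ℝ) ≤ (S2 (-A * D)).ncard := by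
    have : 2 * r' ≤ (S2 (-A * D)).ncard := by omega
    exact_mod_cast this
  have b3 : (mordellRank (-(A * D ^ 3)) : ℝ) ≤ r + r' := by exact_mod_cast hrk
  linarith
end rankbound

section volume
open MeasureTheory Real

/-- matrix as a continuous linear map -/
noncomputable def mL (J : Matrix (Fin 4) (Fin 4) ℝ) : (Fin 4 → ℝ) →L[ℝ] (Fin 4 → ℝ) :=
  (Matrix.toLin' J).toContinuousLinearMap

lemma mL_det (J : Matrix (Fin 4) (Fin 4) ℝ) : (mL J).det = J.det := by
  simp [mL, ContinuousLinearMap.det]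

lemma mL_apply (J : Matrix (Fin 4) (Fin 4) ℝ) (v : Fin 4 → ℝ) (i : Fin 4) :
    mL J v i = J i 0 * v 0 + J i 1 * v 1 + J i 2 * v 2 + J i 3 * v 3 := by
  simp [mL, Matrix.mulVec, dotProduct, Fin.sum_univ_succ]; ring

lemma det4 (a b c d e f g h i j k l m n o p : ℝ) :
    (Matrix.of ![![a,b,c,d],![e,f,g,h],![i,j,k,l],![m,n,o,p]]).det =
    a*(f*(k*p-l*o) - g*(j*p-l*n) + h*(j*o-k*n)) - b*(e*(k*p-l*o) - g*(i*p-l*m) + h*(i*o-k*m))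
    + c*(e*(j*p-l*n) - f*(i*p-l*m) + h*(i*n-j*m)) - d*(e*(j*o-k*n) - f*(i*o-k*m)+g*(i*n-j*m)) := by
  rw [Matrix.det_succ_row_zero]
  simp [Fin.sum_univ_succ, Matrix.det_fin_three, Matrix.submatrix, Fin.succAbove, Matrix.of_apply]
  ring

lemma hp (i : Fin 4) (p : Fin 4 → ℝ) : HasFDerivAt (fun q : Fin 4 → ℝ => q i) (ContinuousLinearMap.proj (R := ℝ) (φ := fun _ : Fin 4 => ℝ) i) p :=
  hasFDerivAt_apply i p

noncomputable def M1 (p : Fin 4 → ℝ) : Fin 4 → ℝ := ![p 0, p 1, sin (p 2), cos (p 2) * (p 3)⁻¹]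
noncomputable def M2 (p : Fin 4 → ℝ) : Fin 4 → ℝ :=
  ![p 0 * (p 3) ^ (-3 / 2 : ℝ) * cos (p 1), p 0 * (p 3) ^ (-3 / 2 : ℝ) * sin (p 1), p 2, p 3]
noncomputable def M3 (β γ ε s : ℝ) (p : Fin 4 → ℝ) : Fin 4 → ℝ := Phi β γ ε s (p 0) (p 1) (p 2) (p 3)

noncomputable def J1 (p : Fin 4 → ℝ) : Matrix (Fin 4) (Fin 4) ℝ :=
  Matrix.of ![![1,0,0,0],![0,1,0,0],![0,0,cos (p 2),0],![0,0,-sin (p 2) * (p 3)⁻¹, -cos (p 2) * ((p 3) ^ 2)⁻¹]]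
noncomputable def J2 (p : Fin 4 → ℝ) : Matrix (Fin 4) (Fin 4) ℝ :=
  Matrix.of ![![(p 3) ^ (-3 / 2 : ℝ) * cos (p 1), -(p 0 * (p 3) ^ (-3 / 2 : ℝ) * sin (p 1)), 0,
      p 0 * (-3 / 2 * (p 3) ^ (-3 / 2 - 1 : ℝ)) * cos (p 1)],
    ![(p 3) ^ (-3 / 2 : ℝ) * sin (p 1), (p 0 * (p 3) ^ (-3 / 2 : ℝ) * cos (p 1)), 0,
      p 0 * (-3 / 2 * (p 3) ^ (-3 / 2 - 1 : ℝ)) * sin (p 1)],![0,0,1,0],![0,0,0,1]]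
noncomputable def J3 (β γ ε s : ℝ) (p : Fin 4 → ℝ) : Matrix (Fin 4) (Fin 4) ℝ :=
  Matrix.of ![![1,0,0,0],
    ![-3 * p 2 / s, β * p 3 / s, -3 * p 0 / s, β * p 1 / s],
    ![(3 * p 2 ^ 2 + γ * p 3 ^ 2) / s, -2 * β * p 2 * p 3 / s, (6 * p 0 * p 2 - 2 * β * p 1 * p 3) / s,
      (-2 * β * p 1 * p 2 + 2 * γ * p 0 * p 3) / s],
    ![-p 2 ^ 3 - γ * p 2 * p 3 ^ 2, β * p 2 ^ 2 * p 3 + ε * p 3 ^ 3,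
      -3 * p 0 * p 2 ^ 2 + 2 * β * p 1 * p 2 * p 3 - γ * p 0 * p 3 ^ 2,
      β * p 1 * p 2 ^ 2 - 2 * γ * p 0 * p 2 * p 3 + 3 * ε * p 1 * p 3 ^ 2]]

lemma M1_d (p : Fin 4 → ℝ) (h3 : p 3 ≠ 0) : HasFDerivAt M1 (mL (J1 p)) p := by
  rw [hasFDerivAt_pi']
  intro i
  fin_cases i
  · refine (hp 0 p).congr_fderiv ?_
    ext v; simp [mL_apply, J1]
  · refine (hp 1 p).congr_fderiv ?_
    ext v; simp [mL_apply, J1]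
  · refine ((hp 2 p).sin).congr_fderiv ?_
    ext v; simp [mL_apply, J1]
  · have := ((hp 2 p).cos).mul ((hasDerivAt_inv h3).comp_hasFDerivAt p (hp 3 p))
    refine this.congr_fderiv ?_
    ext v; simp [mL_apply, J1]; ring

lemma M2_d (p : Fin 4 → ℝ) (h3 : p 3 ≠ 0) : HasFDerivAt M2 (mL (J2 p)) p := by
  rw [hasFDerivAt_pi']
  have hr := (Real.hasDerivAt_rpow_const (x := p 3) (p := (-3 / 2 : ℝ)) (Or.inl h3)).comp_hasFDerivAt p (hp 3 p)
  intro i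
  fin_cases i
  · refine (((hp 0 p).mul hr).mul (hp 1 p).cos).congr_fderiv ?_
    ext v; simp [mL_apply, J2]; ring
  · refine (((hp 0 p).mul hr).mul (hp 1 p).sin).congr_fderiv ?_
    ext v; simp [mL_apply, J2]; ring
  · refine (hp 2 p).congr_fderiv ?_
    ext v; simp [mL_apply, J2]
  · refine (hp 3 p).congr_fderiv ?_
    ext v; simp [mL_apply, J2]

lemma M3_d (β γ ε s : ℝ) (p : Fin 4 → ℝ) : HasFDerivAt (M3 β γ ε s) (mL (J3 β γ ε s p)) p := by
  rw [hasFDerivAt_pi']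
  intro i
  have h0 := hp 0 p
  have h1 := hp 1 p
  have h2 := hp 2 p
  have h3 := hp 3 p
  fin_cases i
  · refine h0.congr_fderiv ?_
    ext v; simp [mL_apply, J3]
  · refine ((((h0.const_mul (-3)).mul h2).add ((h1.const_mul β).mul h3)).mul_const (s⁻¹)).congr_fderiv ?_
    ext v; simp [mL_apply, J3]; ring
  · refine ((((h0.const_mul 3).mul (h2.pow 2)).sub (((h1.const_mul (2 * β)).mul h2).mul h3)
       |>.add ((h0.const_mul γ).mul (h3.pow 2))).mul_const (s⁻¹)).congr_fderiv ?_
    ext v; simp [mL_apply, J3]; ring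
  · refine (((h0.neg.mul (h2.pow 3)).add (((h1.const_mul β).mul (h2.pow 2)).mul h3)
       |>.sub (((h0.const_mul γ).mul h2).mul (h3.pow 2))
       |>.add ((h1.const_mul ε).mul (h3.pow 3)))).congr_fderiv ?_
    ext v; simp [mL_apply, J3]; ring

lemma J1_det (p : Fin 4 → ℝ) : (J1 p).det = -(cos (p 2) * (p 3)⁻¹) ^ 2 := by
  rw [J1, det4]; ring

lemma J2_det (p : Fin 4 → ℝ) (h3 : 0 < p 3) : (J2 p).det = p 0 * ((p 3) ^ 3)⁻¹ := by
  rw [J2, det4]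
  have e : (p 3) ^ (-3 / 2 : ℝ) * (p 3) ^ (-3 / 2 : ℝ) = ((p 3) ^ 3)⁻¹ := by
    rw [← Real.rpow_add h3, show (-3 / 2 + -3 / 2 : ℝ) = -(3 : ℕ) by norm_num, Real.rpow_neg h3.le,
      Real.rpow_natCast]
  rw [← e]
  linear_combination (p 0 * (p 3) ^ (-3 / 2 : ℝ) * (p 3) ^ (-3 / 2 : ℝ)) * (Real.sin_sq_add_cos_sq (p 1))

lemma J3_det (β γ ε s : ℝ) (p : Fin 4 → ℝ) : (J3 β γ ε s p).det =
    p 3 ^ 4 * ((2 * β * γ ^ 2 - 6 * ε * γ) * p 0 ^ 2 - 4 * β ^ 2 * ε * p 1 ^ 2) / s ^ 2 := by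
  rw [J3, det4]; ring
end volume

section volume2
open MeasureTheory Real

noncomputable def bxa (w0 : ℝ) : Fin 4 → ℝ := ![0, -(π / 2), -(π / 6), w0]
noncomputable def bxb (R : ℝ) : Fin 4 → ℝ := ![R, π / 2, π / 6, 1]
/-- compact parameter box -/
def bx (R w0 : ℝ) : Set (Fin 4 → ℝ) := Set.Icc (bxa w0) (bxb R)

noncomputable def FF (β γ ε s : ℝ) (p : Fin 4 → ℝ) : Fin 4 → ℝ := M3 β γ ε s (M2 (M1 p))

lemma bx_mem {R w0 : ℝ} {p : Fin 4 → ℝ} : p ∈ bx R w0 ↔ (0 ≤ p 0 ∧ p 0 ≤ R) ∧ (-(π / 2) ≤ p 1 ∧ p 1 ≤ π / 2) ∧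
    (-(π / 6) ≤ p 2 ∧ p 2 ≤ π / 6) ∧ (w0 ≤ p 3 ∧ p 3 ≤ 1) := by
  simp only [bx, Set.mem_Icc, Pi.le_def, Fin.forall_fin_succ, bxa, bxb]
  simp
  tauto

lemma FF_d {β γ ε s K : ℝ} (hK1 : 2 * β * γ ^ 2 - 6 * ε * γ = K) (hK2 : -4 * β ^ 2 * ε = K)
    {R w0 : ℝ} (hw : 0 < w0) {p : Fin 4 → ℝ} (hp : p ∈ bx R w0) :
    ∃ L : (Fin 4 → ℝ) →L[ℝ] (Fin 4 → ℝ), HasFDerivAt (FF β γ ε s) L p ∧ |L.det| = |K| / s ^ 2 * p 0 ^ 3 := by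
  obtain ⟨⟨h0, -⟩, -, ⟨h2, h2'⟩, ⟨h3, -⟩⟩ := bx_mem.1 hp
  have h3' : 0 < p 3 := lt_of_lt_of_le hw h3
  have hc : 0 < cos (p 2) := cos_pos_of_mem_Ioo ⟨by linarith [pi_pos], by linarith [pi_pos]⟩
  set y := cos (p 2) * (p 3)⁻¹ with hy
  have hy0 : 0 < y := mul_pos hc (inv_pos.2 h3')
  have y1 : M1 p 3 = y := by simp [M1, hy]
  have y2 : M2 (M1 p) 3 = y := by simp [M2, y1]
  have hM1 := M1_d p h3'.ne'
  have hM2 := M2_d (M1 p) (by rw [y1]; exact hy0.ne')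
  have hM3 := M3_d β γ ε s (M2 (M1 p))
  refine ⟨_, hM3.comp p (hM2.comp p hM1), ?_⟩
  have e : ∀ A B : (Fin 4 → ℝ) →L[ℝ] (Fin 4 → ℝ), (A.comp B).det = A.det * B.det := by
    intro A B; simp [ContinuousLinearMap.det, LinearMap.det_comp]
  rw [e, e, mL_det, mL_det, mL_det, J1_det, J2_det _ (by rw [y1]; exact hy0), J3_det, y1, y2, ← hy]
  have e1 : M2 (M1 p) 0 ^ 2 + M2 (M1 p) 1 ^ 2 = p 0 ^ 2 * (y ^ 3)⁻¹ := by
    have e2 : y ^ (-3 / 2 : ℝ) * y ^ (-3 / 2 : ℝ) = (y ^ 3)⁻¹ := by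
      rw [← Real.rpow_add hy0, show (-3 / 2 + -3 / 2 : ℝ) = -(3 : ℕ) by norm_num, Real.rpow_neg hy0.le,
        Real.rpow_natCast]
    rw [← e2]
    simp only [M2, y1]
    simp [M1]
    linear_combination (p 0 ^ 2 * y ^ (-3 / 2 : ℝ) * y ^ (-3 / 2 : ℝ)) * (Real.sin_sq_add_cos_sq (p 1))
  have e3 : (2 * β * γ ^ 2 - 6 * ε * γ) * M2 (M1 p) 0 ^ 2 - 4 * β ^ 2 * ε * M2 (M1 p) 1 ^ 2 =
      K * (p 0 ^ 2 * (y ^ 3)⁻¹) := by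
    rw [← e1, hK1]; linear_combination M2 (M1 p) 1 ^ 2 * hK2
  rw [e3]
  have e4 : M1 p 0 = p 0 := by simp [M1]
  rw [e4]
  have : y ^ 4 * (K * (p 0 ^ 2 * (y ^ 3)⁻¹)) / s ^ 2 * (p 0 * (y ^ 3)⁻¹ * -y ^ 2) = -(K / s ^ 2 * p 0 ^ 3) := by
    field_simp
  rw [this, abs_neg, abs_mul, abs_div, abs_of_nonneg (sq_nonneg s), abs_of_nonneg (pow_nonneg h0 3)]

lemma bx_int {C R w0 : ℝ} (hC : 0 ≤ C) (hR : 0 ≤ R) (hw : 0 < w0) :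
    ∫⁻ p in bx R w0, ENNReal.ofReal (C * p 0 ^ 3) ≤ ENNReal.ofReal (C * (R ^ 4 / 4) * π * (π / 3)) := by
  rw [bx, ← Set.pi_univ_Icc, volume_pi, Measure.restrict_pi_pi]
  have hm : Measurable (fun x : ℝ => ENNReal.ofReal (C * x ^ 3)) := by fun_prop
  have h1 := lintegral_map (μ := Measure.pi fun i => (volume : Measure ℝ).restrict (Set.Icc (bxa w0 i) (bxb R i)))
    hm (measurable_pi_apply (0 : Fin 4))
  have h2 : ∫⁻ p, ENNReal.ofReal (C * p 0 ^ 3) ∂(Measure.pi fun i => (volume : Measure ℝ).restrict (Set.Icc (bxa w0 i) (bxb R i))) = _ := h1.symm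
  rw [h2]
  have h3 := Measure.pi_map_eval (fun i => (volume : Measure ℝ).restrict (Set.Icc (bxa w0 i) (bxb R i))) 0
  have h3' : Measure.map (fun p : Fin 4 → ℝ => p 0) (Measure.pi fun i => (volume : Measure ℝ).restrict (Set.Icc (bxa w0 i) (bxb R i))) = _ := h3
  rw [h3', lintegral_smul_measure]
  have e1 : ∫⁻ x in Set.Icc (bxa w0 0) (bxb R 0), ENNReal.ofReal (C * x ^ 3) = ENNReal.ofReal (C * (R ^ 4 / 4)) := by
    have i1 : bxa w0 0 = 0 := rfl
    have i2 : bxb R 0 = R := rfl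
    rw [i1, i2, ← ofReal_integral_eq_lintegral_ofReal]
    · rw [integral_Icc_eq_integral_Ioc, ← intervalIntegral.integral_of_le hR]
      congr 1
      rw [intervalIntegral.integral_const_mul, integral_pow]; norm_num
    · exact (by fun_prop : Continuous fun x : ℝ => C * x ^ 3).continuousOn.integrableOn_Icc
    · filter_upwards [ae_restrict_mem measurableSet_Icc] with x hx
      exact mul_nonneg hC (pow_nonneg hx.1 3)
  rw [e1]
  have e2 : (Finset.univ.erase (0 : Fin 4)) = {1, 2, 3} := by decide
  rw [e2, Finset.prod_insert (by decide), Finset.prod_insert (by decide), Finset.prod_singleton]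
  simp only [Measure.restrict_apply_univ, Real.volume_Icc]
  have i1 : bxb R 1 - bxa w0 1 = π := by simp [bxb, bxa]
  have i2 : bxb R 2 - bxa w0 2 = π / 3 := by simp [bxb, bxa]; ring
  have i3 : bxb R 3 - bxa w0 3 ≤ 1 := by simp [bxb, bxa]; exact hw.le
  rw [i1, i2, smul_eq_mul]
  calc _ ≤ ENNReal.ofReal π * (ENNReal.ofReal (π / 3) * 1) * ENNReal.ofReal (C * (R ^ 4 / 4)) := by
        gcongr; rw [← ENNReal.ofReal_one]; exact ENNReal.ofReal_le_ofReal i3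
    _ = _ := by
        rw [mul_one, ← ENNReal.ofReal_mul pi_pos.le, ← ENNReal.ofReal_mul (by positivity)]
        congr 1; ring

/-- the compact region -/
def Reg (β γ ε s R w0 : ℝ) : Set (Fin 4 → ℝ) := FF β γ ε s '' bx R w0

lemma Reg_compact {β γ ε s K : ℝ} (hK1 : 2 * β * γ ^ 2 - 6 * ε * γ = K) (hK2 : -4 * β ^ 2 * ε = K)
    {R w0 : ℝ} (hw : 0 < w0) : IsCompact (Reg β γ ε s R w0) := by
  refine IsCompact.image_of_continuousOn isCompact_Icc ?_
  intro p hp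
  obtain ⟨L, hL, -⟩ := FF_d (s := s) hK1 hK2 hw hp
  exact hL.continuousAt.continuousWithinAt

lemma Reg_vol {β γ ε s K : ℝ} (hK1 : 2 * β * γ ^ 2 - 6 * ε * γ = K) (hK2 : -4 * β ^ 2 * ε = K)
    {R w0 : ℝ} (hR : 0 ≤ R) (hw : 0 < w0) :
    volume (Reg β γ ε s R w0) ≤ ENNReal.ofReal (|K| / s ^ 2 * R ^ 4 * (π ^ 2 / 12)) := by
  choose! L hL hdet using fun p (hp : p ∈ bx R w0) => FF_d (s := s) hK1 hK2 hw hp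
  refine (addHaar_image_le_lintegral_abs_det_fderiv volume (measurableSet_Icc : MeasurableSet (bx R w0))
    (fun p hp => (hL p hp).hasFDerivWithinAt)).trans ?_
  have : ∫⁻ p in bx R w0, ENNReal.ofReal |(L p).det| = ∫⁻ p in bx R w0, ENNReal.ofReal (|K| / s ^ 2 * p 0 ^ 3) :=
    setLIntegral_congr_fun measurableSet_Icc (fun p hp => by simp only [hdet p hp])
  refine (le_of_eq this).trans ?_
  refine (bx_int (by positivity) hR hw).trans (le_of_eq ?_)
  congr 1; ring

/-- reduced points lie in the region -/
lemma mem_Reg {β γ ε s u v x y R w0 : ℝ} (hu : 0 < u) (hy : 0 < y) (hx : |x| ≤ 1 / 2) (hxy : 1 ≤ x ^ 2 + y ^ 2)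
    (hR : 0 ≤ R) (h : y ^ 6 * (u ^ 2 + v ^ 2) ^ 2 ≤ R ^ 4) (hw : w0 * y ≤ 1 / 2) :
    Phi β γ ε s u v x y ∈ Reg β γ ε s R w0 := by
  have hx' := abs_le.1 hx
  set r := Real.sqrt (u ^ 2 + v ^ 2) * y ^ (3 / 2 : ℝ) with hr
  have hW : 0 < u ^ 2 + v ^ 2 := by positivity
  have hyy : y ^ (3 / 2 : ℝ) * y ^ (-3 / 2 : ℝ) = 1 := by
    rw [← Real.rpow_add hy]; norm_num
  have hy2 : (y ^ (3 / 2 : ℝ)) ^ 2 = y ^ 3 := by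
    rw [← Real.rpow_natCast, ← Real.rpow_mul hy.le, ← Real.rpow_natCast]; norm_num
  have hr0 : 0 ≤ r := by positivity
  have hr4 : r ^ 4 = y ^ 6 * (u ^ 2 + v ^ 2) ^ 2 := by
    have : r ^ 4 = ((Real.sqrt (u ^ 2 + v ^ 2)) ^ 2) ^ 2 * ((y ^ (3 / 2 : ℝ)) ^ 2) ^ 2 := by rw [hr]; ring
    rw [this, hy2, Real.sq_sqrt hW.le]; ring
  set θ := Complex.arg ⟨u, v⟩ with hθ
  have hnorm : ‖(⟨u, v⟩ : ℂ)‖ = Real.sqrt (u ^ 2 + v ^ 2) := by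
    rw [Complex.norm_def, Complex.normSq_mk]; ring_nf
  have hθ1 : Real.sqrt (u ^ 2 + v ^ 2) * cos θ = u := by
    rw [← hnorm]; exact Complex.norm_mul_cos_arg _
  have hθ2 : Real.sqrt (u ^ 2 + v ^ 2) * sin θ = v := by
    rw [← hnorm]; exact Complex.norm_mul_sin_arg _
  have hθ3 : |θ| ≤ π / 2 := Complex.abs_arg_le_pi_div_two_iff.2 (by simpa using hu.le)
  have hθ4 := abs_le.1 hθ3
  set φ := Real.arcsin x with hφ
  have hs : sin φ = x := Real.sin_arcsin (by linarith) (by linarith)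
  have hs6 : Real.arcsin (1 / 2) = π / 6 := by
    rw [← Real.sin_pi_div_six]; exact Real.arcsin_sin (by linarith [pi_pos]) (by linarith [pi_pos])
  have hφ1 : φ ≤ π / 6 := by rw [← hs6]; exact Real.monotone_arcsin hx'.2
  have hφ2 : -(π / 6) ≤ φ := by
    rw [← hs6, ← Real.arcsin_neg]; exact Real.monotone_arcsin hx'.1
  have hc0 : 0 < cos φ := cos_pos_of_mem_Ioo ⟨by linarith [pi_pos], by linarith [pi_pos]⟩
  have hcs := Real.sin_sq_add_cos_sq φ
  rw [hs] at hcs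
  have hc1 : cos φ ≤ y := by
    apply le_of_sq_le_sq _ hy.le
    linarith
  have hc2 : 1 / 2 ≤ cos φ := by
    apply le_of_sq_le_sq _ hc0.le
    nlinarith
  refine ⟨![r, θ, φ, cos φ / y], ?_, ?_⟩
  · rw [bx_mem]
    refine ⟨⟨hr0, ?_⟩, hθ4, ⟨hφ2, hφ1⟩, ?_, ?_⟩
    · exact le_of_pow_le_pow_left₀ (n := 4) (by norm_num) hR (by simpa [hr4] using h)
    · change w0 ≤ cos φ / y
      rw [le_div_iff₀ hy]; linarith
    · change cos φ / y ≤ 1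
      rw [div_le_one hy]; exact hc1
  · have hyv : cos φ * (cos φ / y)⁻¹ = y := by field_simp
    simp only [FF, M3, M2, M1]
    simp only [Matrix.cons_val_zero, Matrix.cons_val_one, Matrix.cons_val, hyv, hs]
    congr 1
    · rw [hr]; linear_combination (Real.sqrt (u ^ 2 + v ^ 2) * cos θ) * hyy + hθ1
    · rw [hr]; linear_combination (Real.sqrt (u ^ 2 + v ^ 2) * sin θ) * hyy + hθ2
end volume2

section lattice
open MeasureTheory Topology Filter

/-- reduction mod `M` -/
def rd (M : ℕ) (f : Fin 4 → ℤ) : Fin 4 → ZMod M := fun i => (f i : ZMod M)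

/-- the cube attached to a lattice point -/
def cub (M : ℕ) (l : ℝ) (f : Fin 4 → ℤ) : Set (Fin 4 → ℝ) :=
  Set.pi Set.univ fun i => Set.Ico ((f i : ℝ) / l) ((f i : ℝ) / l + M / l)

lemma cub_vol (M : ℕ) {l : ℝ} (hl : 0 < l) (f : Fin 4 → ℤ) : volume (cub M l f) = ENNReal.ofReal ((M / l) ^ 4) := by
  rw [cub, Real.volume_pi_Ico]
  simp only [add_sub_cancel_left, Finset.prod_const, Finset.card_univ, Fintype.card_fin]
  rw [ENNReal.ofReal_pow (by positivity)]

lemma cub_disj {M : ℕ} {l : ℝ} (hl : 0 < l) {f g : Fin 4 → ℤ} (h : rd M f = rd M g) (hne : f ≠ g) :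
    Disjoint (cub M l f) (cub M l g) := by
  rw [Set.disjoint_left]
  intro p hf hg
  apply hne
  funext i
  have h1 := hf i (Set.mem_univ i)
  have h2 := hg i (Set.mem_univ i)
  have h3 : ((f i : ℤ) : ZMod M) = (g i : ZMod M) := congrFun h i
  rw [ZMod.intCast_eq_intCast_iff_dvd_sub] at h3
  simp only [Set.mem_Ico] at h1 h2
  rw [← add_div] at h1 h2
  have a1 : (f i : ℝ) < g i + M := (div_lt_div_iff_of_pos_right hl).1 (lt_of_le_of_lt h1.1 h2.2)
  have a2 : (g i : ℝ) < f i + M := (div_lt_div_iff_of_pos_right hl).1 (lt_of_le_of_lt h2.1 h1.2)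
  have b1 : f i < g i + M := by exact_mod_cast a1
  have b2 : g i < f i + M := by exact_mod_cast a2
  have := Int.eq_zero_of_abs_lt_dvd h3 (by rw [abs_lt]; constructor <;> linarith)
  linarith

lemma cub_sub {M : ℕ} {l : ℝ} (hl : 0 < l) {K : Set (Fin 4 → ℝ)} {f : Fin 4 → ℤ}
    (h : (fun i => (f i : ℝ) / l) ∈ K) : cub M l f ⊆ Metric.cthickening (M / l) K := by
  intro p hp
  refine Metric.mem_cthickening_of_dist_le p _ _ K h ?_
  rw [dist_pi_le_iff (by positivity)]
  intro i
  have h1 := hp i (Set.mem_univ i)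
  simp only [Set.mem_Ico] at h1
  rw [Real.dist_eq, abs_le]
  constructor <;> linarith [div_nonneg (Nat.cast_nonneg (α := ℝ) M) hl.le]

lemma lattice_one {M : ℕ} {l : ℝ} (hl : 0 < l) {K : Set (Fin 4 → ℝ)} {V : ℝ} (hV : 0 ≤ V)
    (hK : volume (Metric.cthickening (M / l) K) ≤ ENNReal.ofReal V) (F : Finset (Fin 4 → ℤ)) (w : Fin 4 → ZMod M)
    (h1 : ∀ f ∈ F, rd M f = w) (h2 : ∀ f ∈ F, (fun i => (f i : ℝ) / l) ∈ K) :
    (F.card : ℝ) * M ^ 4 ≤ V * l ^ 4 := by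
  have h3 : volume (⋃ f ∈ F, cub M l f) = ∑ f ∈ F, volume (cub M l f) := by
    refine measure_biUnion_finset ?_ ?_
    · intro f hf g hg hne
      exact cub_disj hl ((h1 f hf).trans (h1 g hg).symm) hne
    · intro f _
      exact MeasurableSet.univ_pi fun i => measurableSet_Ico
  have h4 : volume (⋃ f ∈ F, cub M l f) ≤ ENNReal.ofReal V :=
    (measure_mono (Set.iUnion₂_subset fun f hf => cub_sub hl (h2 f hf))).trans hK
  rw [h3, Finset.sum_congr rfl (fun f _ => cub_vol M hl f), Finset.sum_const, nsmul_eq_mul,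
    ← ENNReal.ofReal_natCast, ← ENNReal.ofReal_mul (by positivity), ENNReal.ofReal_le_ofReal_iff hV, div_pow,
    ← mul_div_assoc, div_le_iff₀ (by positivity)] at h4
  exact h4

/-- lattice points in dilates of a compact set with residues in `G` -/
theorem lattice_count {K : Set (Fin 4 → ℝ)} (hK : IsCompact K) {V : ℝ} (hV : volume K ≤ ENNReal.ofReal V) (hV0 : 0 ≤ V)
    {M : ℕ} (hM : 0 < M) (G : Finset (Fin 4 → ZMod M)) {e : ℝ} (he : 0 < e) :
    ∀ᶠ l : ℝ in atTop, ∀ F : Finset (Fin 4 → ℤ), (∀ f ∈ F, rd M f ∈ G) → (∀ f ∈ F, (fun i => (f i : ℝ) / l) ∈ K) →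
      (F.card : ℝ) * M ^ 4 ≤ G.card * ((V + e) * l ^ 4) := by
  have t1 : Tendsto (fun l : ℝ => (M : ℝ) / l) atTop (𝓝 0) := tendsto_const_nhds.div_atTop tendsto_id
  have t2 := (tendsto_measure_cthickening_of_isCompact (μ := volume) hK).comp t1
  have t3 : volume K < ENNReal.ofReal (V + e) :=
    lt_of_le_of_lt hV ((ENNReal.ofReal_lt_ofReal_iff (by linarith)).2 (by linarith))
  filter_upwards [t2.eventually_lt_const t3, eventually_gt_atTop 0] with l hl hl0 F h1 h2
  classical
  have := Finset.card_eq_sum_card_fiberwise (s := F) (t := G) (f := rd M) (fun f hf => h1 f hf)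
  rw [this]
  push_cast
  rw [Finset.sum_mul, ← nsmul_eq_mul, ← Finset.sum_const]
  refine Finset.sum_le_sum fun w _ => ?_
  exact lattice_one hl0 (by linarith) (le_of_lt hl) _ w (fun f hf => (Finset.mem_filter.1 hf).2)
    (fun f hf => h2 f (Finset.mem_filter.1 hf).1)

end lattice

section tail
open Filter

lemma Phi_bd {β γ ε s u v x y U Y : ℝ} (hβ : |β| ≤ 3) (hγ : |γ| ≤ 3) (hε : |ε| ≤ 3) (hs : 1 ≤ s)
    (hu : |u| ≤ U) (hv : |v| ≤ U) (hx : |x| ≤ 3 * Y) (hy : |y| ≤ 2 * Y) :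
    |Phi β γ ε s u v x y 0| ≤ U ∧ |Phi β γ ε s u v x y 1| ≤ 15 * U * Y ∧ |Phi β γ ε s u v x y 2| ≤ 75 * U * Y ^ 2 ∧
    |Phi β γ ε s u v x y 3| ≤ 141 * U * Y ^ 3 := by
  have hU : 0 ≤ U := (abs_nonneg _).trans hu
  have hY : 0 ≤ Y := by linarith [(abs_nonneg _).trans hy]
  have dv : ∀ z B : ℝ, |z| ≤ B → |z / s| ≤ B := by
    intro z B h
    rw [abs_div, abs_of_pos (by linarith : 0 < s)]
    exact (div_le_self (abs_nonneg _) hs).trans h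
  refine ⟨by simpa [Phi] using hu, ?_, ?_, ?_⟩
  · simp only [Phi, Matrix.cons_val_one, Matrix.cons_val_zero]
    apply dv
    have h1 : |(-3) * u * x| ≤ 3 * U * (3 * Y) := by
      rw [abs_mul, abs_mul, abs_neg, abs_of_pos (by norm_num : (0:ℝ) < 3)]; gcongr
    have h2 : |β * v * y| ≤ 3 * U * (2 * Y) := by
      rw [abs_mul, abs_mul]; gcongr
    refine (abs_add_le _ _).trans ?_
    linarith
  · simp only [Phi, Matrix.cons_val]
    apply dv
    have h1 : |3 * u * x ^ 2| ≤ 3 * U * (3 * Y) ^ 2 := by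
      rw [abs_mul, abs_mul, abs_pow, abs_of_pos (by norm_num : (0:ℝ) < 3)]; gcongr
    have h2 : |2 * β * v * x * y| ≤ 2 * 3 * U * (3 * Y) * (2 * Y) := by
      rw [abs_mul, abs_mul, abs_mul, abs_mul, abs_of_pos (by norm_num : (0:ℝ) < 2)]; gcongr
    have h3 : |γ * u * y ^ 2| ≤ 3 * U * (2 * Y) ^ 2 := by
      rw [abs_mul, abs_mul, abs_pow]; gcongr
    refine (abs_add_le _ _).trans ?_
    have := abs_sub (3 * u * x ^ 2) (2 * β * v * x * y)
    nlinarith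
  · simp only [Phi, Matrix.cons_val]
    have h1 : |-u * x ^ 3| ≤ U * (3 * Y) ^ 3 := by
      rw [abs_mul, abs_neg, abs_pow]; gcongr
    have h2 : |β * v * x ^ 2 * y| ≤ 3 * U * (3 * Y) ^ 2 * (2 * Y) := by
      rw [abs_mul, abs_mul, abs_mul, abs_pow]; gcongr
    have h3 : |γ * u * x * y ^ 2| ≤ 3 * U * (3 * Y) * (2 * Y) ^ 2 := by
      rw [abs_mul, abs_mul, abs_mul, abs_pow]; gcongr
    have h4 : |ε * v * y ^ 3| ≤ 3 * U * (2 * Y) ^ 3 := by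
      rw [abs_mul, abs_mul, abs_pow]; gcongr
    refine (abs_add_le _ _).trans ?_
    have a1 := abs_sub (-u * x ^ 3 + β * v * x ^ 2 * y) (γ * u * x * y ^ 2)
    have a2 := abs_add_le (-u * x ^ 3) (β * v * x ^ 2 * y)
    nlinarith

/-- reduced with height at most `L` and `T ≤ y` -/
def RedL (β γ ε s L T : ℝ) (f : Fin 4 → ℤ) : Prop :=
  ∃ u v x y : ℝ, 0 < u ∧ 0 < y ∧ |x| ≤ 1/2 ∧ 1 ≤ x^2+y^2 ∧ (fun i => (f i : ℝ)) = Phi β γ ε s u v x y ∧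
    y ^ 6 * (u ^ 2 + v ^ 2) ^ 2 ≤ L ^ 4 ∧ T ≤ y

/-- integer translation -/
def tr (s r k : ℤ) (f : Fin 4 → ℤ) : Fin 4 → ℤ :=
  ![f 0, f 1 + r * k * f 0, f 2 + 2 * k * f 1 + r * k ^ 2 * f 0, f 3 + s * f 2 * k + s * f 1 * k ^ 2 + f 0 * k ^ 3]

lemma tr_inj (s r k : ℤ) : Function.Injective (tr s r k) := by
  intro f g h
  have h0 := congrFun h 0
  have h1 := congrFun h 1
  have h2 := congrFun h 2
  have h3 := congrFun h 3
  simp only [tr, Matrix.cons_val] at h0 h1 h2 h3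
  have e1 : f 1 = g 1 := by rw [h0] at h1; linarith
  have e2 : f 2 = g 2 := by rw [h0, e1] at h2; linarith
  have e3 : f 3 = g 3 := by rw [h0, e1, e2] at h3; linarith
  funext i; fin_cases i <;> assumption

lemma tr_Phi {β γ ε s : ℝ} {si r : ℤ} (hs : (si : ℝ) = s) (hr : si * r = 3) {f : Fin 4 → ℤ} {u v x y : ℝ}
    (h : (fun i => (f i : ℝ)) = Phi β γ ε s u v x y) (k : ℤ) :
    (fun i => (tr si r k f i : ℝ)) = Phi β γ ε s u v (x - k) y := by
  have hr' : s * (r : ℝ) = 3 := by rw [← hs]; exact_mod_cast hr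
  have hs0 : s ≠ 0 := by rintro h; rw [h] at hr'; norm_num at hr'
  have hr2 : (r : ℝ) = 3 / s := by field_simp; linarith
  have h0 := congrFun h 0
  have h1 := congrFun h 1
  have h2 := congrFun h 2
  have h3 := congrFun h 3
  simp only [Phi, Matrix.cons_val] at h0 h1 h2 h3
  funext i
  fin_cases i
  · simp [tr, Phi, h0]
  · simp [tr, Phi, h0, h1, hr2]; field_simp; ring
  · simp [tr, Phi, h0, h1, h2, hr2]; field_simp; ring
  · simp [tr, Phi, h0, h1, h2, h3, hs]; field_simp; ring


def PhiInj (β γ ε s : ℝ) : Prop := ∀ u v x y u' v' x' y' : ℝ, 0 < u → 0 < u' → 0 < y → 0 < y' →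
  Phi β γ ε s u v x y = Phi β γ ε s u' v' x' y' → x = x'

lemma uv_bd {u v y L U Y : ℝ} (hU : 0 ≤ U) (hUY : U ^ 2 * Y ^ 3 = L ^ 2) (hY : 0 < Y) (hy : Y ≤ y)
    (h : y ^ 6 * (u ^ 2 + v ^ 2) ^ 2 ≤ L ^ 4) : |u| ≤ U ∧ |v| ≤ U := by
  have h1 : y ^ 3 * (u ^ 2 + v ^ 2) ≤ L ^ 2 := by
    refine abs_le_of_sq_le_sq' ?_ (by positivity) |>.2
    nlinarith
  have h2 : Y ^ 3 ≤ y ^ 3 := by gcongr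
  have h3 : u ^ 2 + v ^ 2 ≤ U ^ 2 := by
    have : Y ^ 3 * (u ^ 2 + v ^ 2) ≤ Y ^ 3 * U ^ 2 := by
      nlinarith [mul_le_mul_of_nonneg_right h2 (by positivity : 0 ≤ u ^ 2 + v ^ 2)]
    exact le_of_mul_le_mul_left this (by positivity)
  exact ⟨abs_le_of_sq_le_sq (by nlinarith [sq_nonneg v]) hU, abs_le_of_sq_le_sq (by nlinarith [sq_nonneg u]) hU⟩

lemma Icc_bd {B : ℝ} (hB : 1 ≤ B) : ((Finset.Icc (-⌊B⌋) ⌊B⌋).card : ℝ) ≤ 3 * B := by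
  have h0 : 0 ≤ ⌊B⌋ := Int.floor_nonneg.2 (by linarith)
  have : ((Finset.Icc (-⌊B⌋) ⌊B⌋).card : ℤ) = 2 * ⌊B⌋ + 1 := by
    rw [Int.card_Icc, Int.toNat_of_nonneg (by omega)]; ring
  have h2 : ((Finset.Icc (-⌊B⌋) ⌊B⌋).card : ℝ) = 2 * (⌊B⌋ : ℝ) + 1 := by exact_mod_cast this
  rw [h2]
  linarith [Int.floor_le B]

lemma mem_Icc_bd {B : ℝ} {n : ℤ} (h : |(n : ℝ)| ≤ B) : n ∈ Finset.Icc (-⌊B⌋) ⌊B⌋ := by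
  have := abs_le.1 h
  rw [Finset.mem_Icc]
  refine ⟨?_, Int.le_floor.2 this.2⟩
  have : -n ≤ ⌊B⌋ := Int.le_floor.2 (by push_cast; linarith)
  omega

lemma shell {β γ ε s : ℝ} (hβ : |β| ≤ 3) (hγ : |γ| ≤ 3) (hε : |ε| ≤ 3) (hs1 : 1 ≤ s) {si r : ℤ}
    (hs : (si : ℝ) = s) (hr : si * r = 3) (hinj : PhiInj β γ ε s) {L Y : ℝ} (hY : 1 ≤ Y) (F : Finset (Fin 4 → ℤ))
    (hF : ∀ f ∈ F, ∃ u v x y : ℝ, 0 < u ∧ |x| ≤ 1/2 ∧ (fun i => (f i : ℝ)) = Phi β γ ε s u v x y ∧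
    y ^ 6 * (u ^ 2 + v ^ 2) ^ 2 ≤ L ^ 4 ∧ Y ≤ y ∧ y < 2 * Y) : (F.card : ℝ) * Y ≤ 5000000 * L ^ 4 := by
  classical
  rcases F.eq_empty_or_nonempty with rfl | ⟨f0, hf0⟩
  · simp; positivity
  have hY0 : 0 < Y := by linarith
  set U := Real.sqrt (L ^ 2 / Y ^ 3) with hUdef
  have hU0 : 0 ≤ U := Real.sqrt_nonneg _
  have hUY : U ^ 2 * Y ^ 3 = L ^ 2 := by
    rw [hUdef, Real.sq_sqrt (by positivity)]; field_simp
  have hU1 : 1 ≤ U := by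
    obtain ⟨u, v, x, y, hu, hx, he, h6, hy1, hy2⟩ := hF f0 hf0
    have h0 := congrFun he 0
    simp only [Phi, Matrix.cons_val] at h0
    have : 1 ≤ u := by
      rw [← h0] at hu ⊢
      have : 0 < f0 0 := by exact_mod_cast hu
      exact_mod_cast this
    exact this.trans ((le_abs_self u).trans (uv_bd hU0 hUY hY0 hy1 h6).1)
  choose! u v x y hu hx he h6 hy1 hy2 using hF
  set n := ⌈Y⌉₊
  have hnY : Y ≤ n := Nat.le_ceil Y
  have hnk : ∀ k ∈ Finset.range n, (k : ℝ) < Y := fun k hk => Nat.lt_ceil.1 (Finset.mem_range.1 hk)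
  let bb : Fin 4 → Finset ℤ := ![Finset.Icc 1 ⌊U⌋, Finset.Icc (-⌊15 * U * Y⌋) ⌊15 * U * Y⌋,
    Finset.Icc (-⌊75 * U * Y ^ 2⌋) ⌊75 * U * Y ^ 2⌋, Finset.Icc (-⌊141 * U * Y ^ 3⌋) ⌊141 * U * Y ^ 3⌋]
  have hphi : ∀ f ∈ F, ∀ k : ℕ, (fun i => (tr si r (2 * k) f i : ℝ)) = Phi β γ ε s (u f) (v f) (x f - 2 * k) (y f) := by
    intro f hf k
    have := tr_Phi hs hr (he f hf) (2 * k)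
    push_cast at this
    exact this
  have hcard : (F ×ˢ Finset.range n).card ≤ (Fintype.piFinset bb).card := by
    refine Finset.card_le_card_of_injOn (fun p => tr si r (2 * p.2) p.1) ?_ ?_
    · rintro ⟨f, k⟩ hp
      obtain ⟨hf, hk⟩ := Finset.mem_product.1 (Finset.mem_coe.1 hp)
      simp only at hf hk
      rw [Finset.mem_coe, Fintype.mem_piFinset]
      have hk' := hnk k hk
      have hxk : |x f - 2 * k| ≤ 3 * Y := by
        have := abs_le.1 (hx f hf)
        have k0 : (0 : ℝ) ≤ k := Nat.cast_nonneg k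
        rw [abs_le]; constructor <;> linarith
      obtain ⟨b1, b2⟩ := uv_bd hU0 hUY hY0 (hy1 f hf) (h6 f hf)
      have hyy : |y f| ≤ 2 * Y := by
        rw [abs_of_pos (by linarith [hy1 f hf])]; exact (hy2 f hf).le
      obtain ⟨c0, c1, c2, c3⟩ := Phi_bd hβ hγ hε hs1 b1 b2 hxk hyy
      rw [← hphi f hf k] at c0 c1 c2 c3
      have hpos : 0 < tr si r (2 * k) f 0 := by
        have := congrFun (hphi f hf k) 0
        simp only [Phi, Matrix.cons_val] at this
        have h' : (0 : ℝ) < tr si r (2 * k) f 0 := by rw [this]; exact hu f hf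
        exact_mod_cast h'
      intro i
      fin_cases i
      · exact Finset.mem_Icc.2 ⟨hpos, (Finset.mem_Icc.1 (mem_Icc_bd c0)).2⟩
      · exact mem_Icc_bd c1
      · exact mem_Icc_bd c2
      · exact mem_Icc_bd c3
    · rintro ⟨f, k⟩ hp ⟨g, m⟩ hq heq
      obtain ⟨hf, hk⟩ := Finset.mem_product.1 (Finset.mem_coe.1 hp)
      obtain ⟨hg, hm⟩ := Finset.mem_product.1 (Finset.mem_coe.1 hq)
      simp only at hf hk hg hm heq
      have e1 := hphi f hf k
      have e2 := hphi g hg m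
      rw [heq] at e1
      have e3 := hinj _ _ _ _ _ _ _ _ (hu f hf) (hu g hg) (by linarith [hy1 f hf]) (by linarith [hy1 g hg]) (e1.symm.trans e2)
      have a1 := abs_le.1 (hx f hf)
      have a2 := abs_le.1 (hx g hg)
      have b1 : (k : ℝ) < m + 1 := by linarith
      have b2 : (m : ℝ) < k + 1 := by linarith
      have b3 : k < m + 1 := by exact_mod_cast b1
      have b4 : m < k + 1 := by exact_mod_cast b2
      have b5 : k = m := by omega
      subst b5
      rw [tr_inj _ _ _ heq]
  rw [Finset.card_product, Finset.card_range, Fintype.card_piFinset, Fin.prod_univ_four] at hcard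
  have hcard' : (F.card : ℝ) * n ≤ ((Finset.Icc 1 ⌊U⌋).card : ℝ) * ((Finset.Icc (-⌊15 * U * Y⌋) ⌊15 * U * Y⌋).card : ℝ) *
    ((Finset.Icc (-⌊75 * U * Y ^ 2⌋) ⌊75 * U * Y ^ 2⌋).card : ℝ) *
      ((Finset.Icc (-⌊141 * U * Y ^ 3⌋) ⌊141 * U * Y ^ 3⌋).card : ℝ) := by exact_mod_cast hcard
  have k0 : ((Finset.Icc 1 ⌊U⌋).card : ℝ) ≤ U := by
    have h0 : 0 ≤ ⌊U⌋ := Int.floor_nonneg.2 hU0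
    have h2 : ((Finset.Icc 1 ⌊U⌋).card : ℤ) = ⌊U⌋ := by
      rw [Int.card_Icc, Int.toNat_of_nonneg (by omega)]; ring
    have h3 : ((Finset.Icc 1 ⌊U⌋).card : ℝ) = (⌊U⌋ : ℝ) := by exact_mod_cast h2
    rw [h3]; exact Int.floor_le U
  have y2 : 1 ≤ Y ^ 2 := one_le_pow₀ hY
  have y3 : 1 ≤ Y ^ 3 := one_le_pow₀ hY
  have k1 := Icc_bd (B := 15 * U * Y) (by nlinarith)
  have k2 := Icc_bd (B := 75 * U * Y ^ 2) (by nlinarith)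
  have k3 := Icc_bd (B := 141 * U * Y ^ 3) (by nlinarith)
  calc (F.card : ℝ) * Y ≤ F.card * n := by gcongr
    _ ≤ U * (3 * (15 * U * Y)) * (3 * (75 * U * Y ^ 2)) * (3 * (141 * U * Y ^ 3)) := hcard'.trans (by gcongr)
    _ = 4282875 * (U ^ 2 * Y ^ 3) ^ 2 := by ring
    _ = 4282875 * L ^ 4 := by rw [hUY]; ring
    _ ≤ _ := by nlinarith [(by positivity : 0 ≤ L ^ 4)]

theorem tail {β γ ε s : ℝ} (hβ : |β| ≤ 3) (hγ : |γ| ≤ 3) (hε : |ε| ≤ 3) (hs1 : 1 ≤ s) {si r : ℤ}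
    (hs : (si : ℝ) = s) (hr : si * r = 3) (hinj : PhiInj β γ ε s) {L T : ℝ} (hT : 1 ≤ T) (F : Finset (Fin 4 → ℤ))
    (hF : ∀ f ∈ F, RedL β γ ε s L T f) : (F.card : ℝ) * T ≤ 10000000 * L ^ 4 := by
  classical
  have hT0 : 0 < T := by linarith
  have h1 : ∀ f ∈ F, ∃ j : ℕ, ∃ u v x y : ℝ, 0 < u ∧ |x| ≤ 1/2 ∧ (fun i => (f i : ℝ)) = Phi β γ ε s u v x y ∧
    y ^ 6 * (u ^ 2 + v ^ 2) ^ 2 ≤ L ^ 4 ∧ T * 2 ^ j ≤ y ∧ y < 2 * (T * 2 ^ j) := by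
    intro f hf
    obtain ⟨u, v, x, y, hu, hy, hx, hxy, he, h6, hTy⟩ := hF f hf
    obtain ⟨j, j1, j2⟩ := exists_nat_pow_near (x := y / T) (y := 2) (by rwa [le_div_iff₀ hT0, one_mul]) (by norm_num)
    rw [le_div_iff₀ hT0] at j1
    rw [div_lt_iff₀ hT0] at j2
    exact ⟨j, u, v, x, y, hu, hx, he, h6, by linarith, by rw [pow_succ] at j2; linarith⟩
  choose! j hj using h1
  have h2 := Finset.card_eq_sum_card_fiberwise (s := F) (t := F.image j) (f := j)
    (fun f hf => Finset.mem_coe.2 (Finset.mem_image_of_mem j hf))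
  have h3 : ∀ i, ((F.filter fun f => j f = i).card : ℝ) * T ≤ 5000000 * L ^ 4 * (1 / 2) ^ i := by
    intro i
    have := shell hβ hγ hε hs1 hs hr hinj (L := L) (Y := T * 2 ^ i)
      (by nlinarith [one_le_pow₀ (n := i) (by norm_num : (1 : ℝ) ≤ 2)]) (F.filter fun f => j f = i) (by
        intro f hf
        obtain ⟨hf1, hf2⟩ := Finset.mem_filter.1 hf
        rw [← hf2]; exact hj f hf1)
    rw [← mul_assoc] at this
    rw [one_div, inv_pow, ← div_eq_mul_inv, le_div_iff₀ (by positivity)]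
    exact this
  rw [h2]; push_cast
  rw [Finset.sum_mul]
  calc _ ≤ ∑ i ∈ F.image j, 5000000 * L ^ 4 * (1 / 2 : ℝ) ^ i := Finset.sum_le_sum fun i _ => h3 i
    _ = 5000000 * L ^ 4 * ∑ i ∈ F.image j, (1 / 2 : ℝ) ^ i := by rw [Finset.mul_sum]
    _ ≤ 5000000 * L ^ 4 * 2 := by
      gcongr
      exact (summable_geometric_two.sum_le_tsum _ (fun i _ => by positivity)).trans (le_of_eq tsum_geometric_two)
    _ = _ := by ring

theorem RedL_finite {β γ ε s : ℝ} (hβ : |β| ≤ 3) (hγ : |γ| ≤ 3) (hε : |ε| ≤ 3) (hs1 : 1 ≤ s) (L : ℝ) :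
    {f | RedL β γ ε s L (1 / 2) f}.Finite := by
  set U := Real.sqrt (8 * L ^ 2) with hU
  have hU0 : 0 ≤ U := Real.sqrt_nonneg _
  have hUY : U ^ 2 * (1 / 2) ^ 3 = L ^ 2 := by
    rw [hU, Real.sq_sqrt (by positivity)]; ring
  set Y := L ^ 2 + 1
  have hY : 1 ≤ Y := by simp [Y]; positivity
  set B := U + 15 * U * Y + 75 * U * Y ^ 2 + 141 * U * Y ^ 3
  refine (Set.finite_Icc (fun _ : Fin 4 => -⌊B⌋) (fun _ => ⌊B⌋)).subset ?_
  rintro f ⟨u, v, x, y, hu, hy, hx, hxy, he, h6, hTy⟩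
  obtain ⟨b1, b2⟩ := uv_bd hU0 hUY (by norm_num) hTy h6
  have h0 := congrFun he 0
  simp only [Phi, Matrix.cons_val] at h0
  have u1 : 1 ≤ u := by
    rw [← h0] at hu ⊢
    have : 0 < f 0 := by exact_mod_cast hu
    exact_mod_cast this
  have hyL : y ≤ Y := by
    have h1 : y ^ 3 * (u ^ 2 + v ^ 2) ≤ L ^ 2 := by
      refine abs_le_of_sq_le_sq' ?_ (by positivity) |>.2
      nlinarith
    have h2 : 1 ≤ u ^ 2 + v ^ 2 := by nlinarith [sq_nonneg v]
    have h3 : y ^ 3 ≤ L ^ 2 := by nlinarith [pow_pos hy 3]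
    by_contra hcon
    push Not at hcon
    have : y ≤ y ^ 3 := by nlinarith [pow_pos hy 2, mul_pos hy hy]
    simp only [Y] at hcon
    linarith
  obtain ⟨c0, c1, c2, c3⟩ := Phi_bd hβ hγ hε hs1 b1 b2 (x := x) (y := y) (Y := Y) (by linarith)
    (by rw [abs_of_pos hy]; linarith)
  rw [← he] at c0 c1 c2 c3
  have p1 : 0 ≤ 15 * U * Y := by positivity
  have p2 : 0 ≤ 75 * U * Y ^ 2 := by positivity
  have p3 : 0 ≤ 141 * U * Y ^ 3 := by positivity
  have key : ∀ i, |(f i : ℝ)| ≤ B := by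
    intro i
    fin_cases i
    · exact c0.trans (by simp only [B]; linarith)
    · exact c1.trans (by simp only [B]; linarith)
    · exact c2.trans (by simp only [B]; linarith)
    · exact c3.trans (by simp only [B]; linarith)
  exact ⟨fun i => (Finset.mem_Icc.1 (mem_Icc_bd (key i))).1, fun i => (Finset.mem_Icc.1 (mem_Icc_bd (key i))).2⟩

lemma PhiInj_II : PhiInj 3 (-3) (-1) 1 := by
  intro u v x y u' v' x' y' hu hu' hy hy' h
  have h0 := congrFun h 0
  have h1 := congrFun h 1
  have h2 := congrFun h 2
  have h3 := congrFun h 3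
  have hP : ∀ u v x y : ℝ, (Phi 3 (-3) (-1) 1 u v x y 1) ^ 2 - 3 * Phi 3 (-3) (-1) 1 u v x y 0 * Phi 3 (-3) (-1) 1 u v x y 2
      = 9 * (u ^ 2 + v ^ 2) * y ^ 2 := by
    intro u v x y; simp [Phi]; ring
  have hQ : ∀ u v x y : ℝ, Phi 3 (-3) (-1) 1 u v x y 1 * Phi 3 (-3) (-1) 1 u v x y 2
      - 9 * Phi 3 (-3) (-1) 1 u v x y 0 * Phi 3 (-3) (-1) 1 u v x y 3 = -2 * x * (9 * (u ^ 2 + v ^ 2) * y ^ 2) := by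
    intro u v x y; simp [Phi]; ring
  have p1 := hP u v x y
  have p2 := hP u' v' x' y'
  have q1 := hQ u v x y
  have q2 := hQ u' v' x' y'
  rw [h0, h1, h2] at p1
  rw [h0, h1, h2, h3] at q1
  have e := p1.symm.trans p2
  have e' := q1.symm.trans q2
  rw [e] at e'
  have : 9 * (u' ^ 2 + v' ^ 2) * y' ^ 2 ≠ 0 := by positivity
  have := mul_right_cancel₀ this e'
  linarith

lemma PhiInj_I : PhiInj 1 1 1 3 := by
  intro u v x y u' v' x' y' hu hu' hy hy' h
  have h0 := congrFun h 0
  have h1 := congrFun h 1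
  have h2 := congrFun h 2
  have h3 := congrFun h 3
  have hP : ∀ (u v x y : ℝ) (X : ℂ), (Phi 1 1 1 3 u v x y 0) * X ^ 3 + 3 * (Phi 1 1 1 3 u v x y 1) * X ^ 2
      + 3 * (Phi 1 1 1 3 u v x y 2) * X + Phi 1 1 1 3 u v x y 3 = (u * (X - x) + v * y) * ((X - x) ^ 2 + y ^ 2) := by
    intro u v x y X; simp [Phi]; ring
  have p1 := hP u v x y (x + y * Complex.I)
  have p2 := hP u' v' x' y' (x + y * Complex.I)
  rw [h0, h1, h2, h3, p2] at p1
  have hz : ((u : ℂ) * ((x + y * Complex.I) - x) + v * y) * (((x + y * Complex.I) - x) ^ 2 + y ^ 2) = 0 := by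
    have : ((x + y * Complex.I : ℂ) - x) ^ 2 = -(y : ℂ) ^ 2 := by
      rw [add_sub_cancel_left, mul_pow, Complex.I_sq]; ring
    rw [this]; ring
  rw [hz] at p1
  rcases mul_eq_zero.1 p1 with h | h
  · have := congrArg Complex.im h
    simp at this
    rcases this with h | h <;> linarith
  · have e : ((x : ℂ) + y * Complex.I - x' + y' * Complex.I) * ((x : ℂ) + y * Complex.I - x' - y' * Complex.I) = 0 := by
      rw [← h]; linear_combination (-(y' : ℂ) ^ 2) * Complex.I_sq
    rcases mul_eq_zero.1 e with h | h
    · have := congrArg Complex.re h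
      simp at this; linarith
    · have := congrArg Complex.re h
      simp at this; linarith

end tail

section count
open Filter

lemma Phi_scale (β γ ε s u v x y l : ℝ) : (fun i => Phi β γ ε s u v x y i / l) = Phi β γ ε s (u / l) (v / l) x y := by
  funext i; fin_cases i <;> simp [Phi] <;> ring

theorem count {β γ ε s K : ℝ} (hK1 : 2 * β * γ ^ 2 - 6 * ε * γ = K) (hK2 : -4 * β ^ 2 * ε = K)
    (hβ : |β| ≤ 3) (hγ : |γ| ≤ 3) (hε : |ε| ≤ 3) (hs1 : 1 ≤ s) {si r : ℤ}
    (hs : (si : ℝ) = s) (hr : si * r = 3) (hinj : PhiInj β γ ε s) {R : ℝ} (hR : 0 ≤ R)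
    {M : ℕ} (hM : 0 < M) (G : Finset (Fin 4 → ZMod M)) {e : ℝ} (he : 0 < e) :
    ∀ᶠ l : ℝ in atTop, ∀ F : Finset (Fin 4 → ℤ), (∀ f ∈ F, rd M f ∈ G) → (∀ f ∈ F, RedL β γ ε s (R * l) (1 / 2) f) →
      (F.card : ℝ) ≤ (G.card / M ^ 4 * (|K| / s ^ 2 * R ^ 4 * (Real.pi ^ 2 / 12)) + e) * l ^ 4 := by
  classical
  set V := |K| / s ^ 2 * R ^ 4 * (Real.pi ^ 2 / 12)
  have hV : 0 ≤ V := by positivity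
  set T := 1 + 20000000 * R ^ 4 / e with hT
  have hT1 : 1 ≤ T := by simp [T]; positivity
  have hT0 : 0 < T := by linarith
  have hTe : 10000000 * R ^ 4 ≤ e / 2 * T := by
    rw [hT, mul_add]; field_simp; nlinarith
  have hw : 0 < 1 / (2 * T) := by positivity
  set e' := e / (2 * (G.card + 1)) with he'
  have hG0 : (0 : ℝ) < G.card + 1 := by positivity
  have hee : 0 < e' := by positivity
  have hGe : G.card * e' ≤ e / 2 := by
    have : (G.card + 1) * e' = e / 2 := by rw [he']; field_simp
    nlinarith
  have hc := lattice_count (Reg_compact (s := s) (R := R) hK1 hK2 hw) (Reg_vol hK1 hK2 hR hw) hV hM G hee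
  filter_upwards [hc, eventually_gt_atTop 0] with l hl hl0 F hF1 hF2
  have hM1 : (1 : ℝ) ≤ (M : ℝ) ^ 4 := one_le_pow₀ (by exact_mod_cast hM)
  have hl4 : 0 < l ^ 4 := by positivity
  set F1 := F.filter fun f => RedL β γ ε s (R * l) T f
  set F2 := F.filter fun f => ¬ RedL β γ ε s (R * l) T f
  have hsum : (F.card : ℝ) = F1.card + F2.card := by
    exact_mod_cast (Finset.card_filter_add_card_filter_not (s := F) (fun f => RedL β γ ε s (R * l) T f)).symm
  have b1 : (F1.card : ℝ) ≤ e / 2 * l ^ 4 := by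
    have := tail hβ hγ hε hs1 hs hr hinj hT1 F1 (fun f hf => (Finset.mem_filter.1 hf).2)
    rw [mul_pow] at this
    have h2 : (F1.card : ℝ) * T ≤ (e / 2 * l ^ 4) * T := by
      nlinarith
    exact le_of_mul_le_mul_right h2 hT0
  have b2 := hl F2 (fun f hf => hF1 f (Finset.mem_filter.1 hf).1) (by
    intro f hf
    obtain ⟨hf1, hf2⟩ := Finset.mem_filter.1 hf
    obtain ⟨u, v, x, y, hu, hy, hx, hxy, he, h6, hTy⟩ := hF2 f hf1
    have hyT : y ≤ T := by
      by_contra hcon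
      exact hf2 ⟨u, v, x, y, hu, hy, hx, hxy, he, h6, (not_le.1 hcon).le⟩
    have h1 : (fun i => (f i : ℝ) / l) = fun i => Phi β γ ε s u v x y i / l := by
      funext i; rw [← he]
    rw [h1, Phi_scale]
    refine mem_Reg (by positivity) hy hx hxy hR ?_ ?_
    · have : y ^ 6 * ((u / l) ^ 2 + (v / l) ^ 2) ^ 2 = y ^ 6 * (u ^ 2 + v ^ 2) ^ 2 / l ^ 4 := by field_simp
      rw [this, div_le_iff₀ hl4]
      rw [mul_pow] at h6; exact h6
    · rw [div_mul_eq_mul_div, one_mul, div_le_iff₀ (by positivity)]; linarith)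
  have b3 : (F2.card : ℝ) ≤ (G.card / M ^ 4 * V + e / 2) * l ^ 4 := by
    have hM0 : (0 : ℝ) < (M : ℝ) ^ 4 := by linarith
    have : (F2.card : ℝ) ≤ G.card * ((V + e') * l ^ 4) / M ^ 4 := by rwa [le_div_iff₀ hM0]
    refine this.trans ?_
    have h3 : G.card * ((V + e') * l ^ 4) / M ^ 4 = (G.card / M ^ 4 * V + (G.card * e') / M ^ 4) * l ^ 4 := by
      field_simp
    rw [h3]
    have h4 : (G.card * e') / (M : ℝ) ^ 4 ≤ e / 2 := (div_le_self (by positivity) hM1).trans hGe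
    exact mul_le_mul_of_nonneg_right (by linarith) hl4.le
  rw [hsum]
  linarith

end count

section local17

variable {Z : Type*} [CommRing Z]

lemma pD_zero_of_nil (hI : ∀ x y : Z, ¬ IsUnit x → ¬ IsUnit y → x * y = 0) {a b c : Z} (d : Z) (ha : ¬ IsUnit a)
    (hb : ¬ IsUnit b) (hc : ¬ IsUnit c) : pD a b c d = 0 := by
  have h1 := hI a b ha hb
  have h2 := hI a c ha hc
  have h3 := hI b c hb hc
  have h4 := hI a a ha ha
  have h5 := hI b b hb hb
  unfold pD
  linear_combination (b * c) * h3 - 4 * c ^ 2 * h2 - 4 * b * d * h5 - 27 * d ^ 2 * h4 + 18 * c * d * h1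

/-- parametrisation, `a` unit, `P` unit -/
def Ph1 (i2 i3 t : Z) (z : Zˣ × Z × Zˣ) : Fin 4 → Z :=
  let a : Z := z.1; let a' : Z := ↑(z.1⁻¹); let b := z.2.1; let w : Z := z.2.2; let w' : Z := ↑(z.2.2⁻¹)
  let P := w ^ 2 + 27 * a ^ 2 * t * i2 ^ 2 * w' ^ 4
  let G := 2 * P * w
  let c := (b ^ 2 - P) * i3 * a'
  ![a, b, c, (G - 2 * b ^ 3 + 9 * a * b * c) * i3 ^ 3 * a' ^ 2]

def Ph1' (i3 : Z) (z : Zˣ × Z × {x : Z // ¬ IsUnit x} × {x : Z // ¬ IsUnit x}) : Fin 4 → Z :=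
  let a : Z := z.1; let a' : Z := ↑(z.1⁻¹); let b := z.2.1; let P : Z := z.2.2.1; let G : Z := z.2.2.2
  let c := (b ^ 2 - P) * i3 * a'
  ![a, b, c, (G - 2 * b ^ 3 + 9 * a * b * c) * i3 ^ 3 * a' ^ 2]

def Ph2 (i2 t : Z) (z : {x : Z // ¬ IsUnit x} × Zˣ × Z) : Fin 4 → Z :=
  let a : Z := z.1; let b : Z := z.2.1; let b' : Z := ↑(z.2.1⁻¹); let c := z.2.2
  ![a, b, c, (b ^ 2 * c ^ 2 - 4 * a * c ^ 3 - t) * (1 + 9 * a * c * i2 * b' ^ 2) * i2 ^ 2 * b' ^ 3]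

def Ph3 (i2 t : Z) (z : {x : Z // ¬ IsUnit x} × Zˣ × Z) : Fin 4 → Z :=
  let b : Z := z.1; let c : Z := z.2.1; let c' : Z := ↑(z.2.1⁻¹)
  ![-t * i2 ^ 2 * c' ^ 3, b, c, z.2.2]

lemma vec4 {f : Fin 4 → Z} {a b c d : Z} (h0 : f 0 = a) (h1 : f 1 = b) (h2 : f 2 = c) (h3 : f 3 = d) : f = ![a, b, c, d] := by
  funext i; fin_cases i <;> assumption

lemma nu_mul {x y : Z} (hx : ¬ IsUnit x) : ¬ IsUnit (x * y) := fun h => hx (isUnit_of_mul_isUnit_left h)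

lemma upper_cover (hI : ∀ x y : Z, ¬ IsUnit x → ¬ IsUnit y → x * y = 0) {i2 i3 : Z} (h2 : 2 * i2 = 1) (h3 : 3 * i3 = 1)
    {t : Z} (ht : ¬ IsUnit t) (ht0 : t ≠ 0) (f : Fin 4 → Z) (hf : pD (f 0) (f 1) (f 2) (f 3) = t) :
    (∃ z, Ph1 i2 i3 t z = f) ∨ (∃ z, Ph2 i2 t z = f) ∨ (∃ z, Ph3 i2 t z = f) := by
  by_cases ha : IsUnit (f 0)
  · left
    obtain ⟨a, ha⟩ := ha
    have haa : (a : Z) * ↑(a⁻¹) = 1 := Units.mul_inv a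
    generalize hav : ((a⁻¹ : Zˣ) : Z) = a' at haa
    set b := f 1 with hb
    set c := f 2 with hc
    set d := f 3 with hd
    rw [← ha] at hf
    set P := b ^ 2 - 3 * a * c with hP
    set G := 2 * b ^ 3 - 9 * a * b * c + 27 * a ^ 2 * d with hG
    have key : 4 * P ^ 3 - G ^ 2 = 27 * (a : Z) ^ 2 * t := by
      rw [← hf, hP, hG]; unfold pD; ring
    have hPu : IsUnit P := by
      by_contra hPn
      have e1 := hI P P hPn hPn
      have hGn : ¬ IsUnit G := by
        intro hGu
        have : G ^ 2 = t * (-27 * (a : Z) ^ 2) := by linear_combination 4 * P * e1 - key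
        have h5 := hGu.pow 2
        rw [this] at h5
        exact nu_mul ht h5
      have e2 := hI G G hGn hGn
      apply ht0
      linear_combination (-t) * (3 * i3 + 1) * h3 + (-t) * (3 * i3) ^ 2 * h3 - t * 27 * i3 ^ 3 * (a * a' + 1) * haa + i3 ^ 3 * a' ^ 2 * (4 * P * e1 - e2) - i3 ^ 3 * a' ^ 2 * key
    obtain ⟨Pu, hPu⟩ := hPu
    have hpp : P * ↑(Pu⁻¹) = 1 := by rw [← hPu]; exact Units.mul_inv Pu
    generalize ((Pu⁻¹ : Zˣ) : Z) = P' at hpp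
    set w := G * i2 * P' with hw
    have hGw : G = 2 * P * w := by rw [hw]; linear_combination (-G) * h2 - 2 * G * i2 * hpp
    set e := P - w ^ 2 with he
    set τ := 27 * (a : Z) ^ 2 * t * i2 ^ 2 with hτ
    have k1 : P ^ 2 * e = τ := by
      have : 4 * (P ^ 2 * e) = 27 * (a : Z) ^ 2 * t := by rw [← key, hGw, he]; ring
      rw [hτ]
      linear_combination i2 ^ 2 * this - P ^ 2 * e * (2 * i2 + 1) * h2
    have k2 : e = τ * P' ^ 2 := by rw [← k1]; linear_combination (-e) * (P * P' + 1) * hpp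
    have hen : ¬ IsUnit e := by
      rw [k2, hτ]
      have : 27 * (a : Z) ^ 2 * t * i2 ^ 2 * P' ^ 2 = t * (27 * a ^ 2 * i2 ^ 2 * P' ^ 2) := by ring
      rw [this]; exact nu_mul ht
    have hee := hI e e hen hen
    have hwu : IsUnit w := by
      have : w * (w * (P' * (1 + e * P'))) = 1 := by
        have : w ^ 2 = P - e := by rw [he]; ring
        linear_combination (P' * (1 + e * P')) * this + (1 + e * P') * hpp - P' ^ 2 * hee
      exact IsUnit.of_mul_eq_one _ this
    obtain ⟨wu, hwu⟩ := hwu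
    have hww : w * ↑(wu⁻¹) = 1 := by rw [← hwu]; exact Units.mul_inv wu
    have hPe : P = w ^ 2 + τ * ↑(wu⁻¹) ^ 4 := by
      have hPP : P = w ^ 2 + e := by rw [he]; ring
      have k3 : w ^ 4 * e = τ := by
        rw [← k1]
        have : P ^ 2 * e = w ^ 4 * e + (2 * w ^ 2 + e) * (e * e) := by rw [hPP]; ring
        rw [this, hee]; ring
      have k4 : e = τ * ↑(wu⁻¹) ^ 4 := by
        have : (w * ↑(wu⁻¹)) ^ 4 = 1 := by rw [hww]; ring
        rw [← k3]; linear_combination (-e) * this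
      rw [← k4]; exact hPP
    refine ⟨(a, b, wu), ?_⟩
    symm
    have hcf : c = (b ^ 2 - P) * i3 * a' := by
      rw [hP]; linear_combination (-c) * h3 - 3 * c * i3 * haa
    have hPh : Ph1 i2 i3 t (a, b, wu) = ![(a : Z), b, (b ^ 2 - P) * i3 * a',
        (2 * P * w - 2 * b ^ 3 + 9 * a * b * ((b ^ 2 - P) * i3 * a')) * i3 ^ 3 * a' ^ 2] := by
      rw [hPe, hτ]
      simp only [Ph1, hwu, hav]
    rw [hPh]
    refine vec4 ha.symm hb.symm hcf ?_
    rw [← hcf, ← hGw, ← hd, hG]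
    linear_combination (-d) * (3 * i3 + 1) * h3 + (-d) * (3 * i3) ^ 2 * h3 - d * 27 * i3 ^ 3 * (a * a' + 1) * haa
  · right
    have haa := hI _ _ ha ha
    by_cases hb : IsUnit (f 1)
    · left
      obtain ⟨b, hb⟩ := hb
      have hbb : (b : Z) * ↑(b⁻¹) = 1 := Units.mul_inv b
      refine ⟨(⟨f 0, ha⟩, b, f 2), ?_⟩
      symm
      rw [← hb] at hf
      refine vec4 rfl hb.symm rfl ?_
      simp only
      generalize ((b⁻¹ : Zˣ) : Z) = b' at *
      generalize f 0 = a at *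
      generalize f 2 = c at *
      generalize f 3 = d at *
      unfold pD at hf
      have e1 : (b ^ 2 * c ^ 2 - 4 * a * c ^ 3 - t : Z) = d * (4 * b ^ 3 - 18 * a * b * c) := by
        linear_combination hf + 27 * d ^ 2 * haa
      rw [e1]
      have e2 : (4 * b ^ 3 - 18 * a * b * c) * i2 ^ 2 * b' ^ 3 = 1 - 9 * a * c * i2 * b' ^ 2 := by
        have q1 : (b * b' : Z) ^ 3 = 1 := by rw [hbb]; ring
        linear_combination (2 * i2 + 1) * h2 + 4 * i2 ^ 2 * q1 - 18 * a * c * i2 ^ 2 * b' ^ 2 * hbb - 9 * a * c * i2 * b' ^ 2 * h2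
      linear_combination (-d) * (1 + 9 * a * c * i2 * b' ^ 2) * e2 + d * 81 * c ^ 2 * i2 ^ 2 * b' ^ 4 * haa
    · right
      by_cases hc : IsUnit (f 2)
      · obtain ⟨c, hc⟩ := hc
        have hcc : (c : Z) * ↑(c⁻¹) = 1 := Units.mul_inv c
        refine ⟨(⟨f 1, hb⟩, c, f 3), ?_⟩
        symm
        refine vec4 ?_ rfl hc.symm rfl
        simp only
        have hab := hI _ _ ha hb
        have hbb := hI _ _ hb hb
        rw [← hc] at hf
        generalize ((c⁻¹ : Zˣ) : Z) = c' at *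
        unfold pD at hf
        have e1 : t = -4 * f 0 * c ^ 3 := by
          linear_combination -hf + c ^ 2 * hbb - 4 * f 1 * f 3 * hbb - 27 * (f 3) ^ 2 * haa + 18 * c * f 3 * hab
        rw [e1]
        have q1 : (c * c' : Z) ^ 3 = 1 := by rw [hcc]; ring
        linear_combination (-f 0) * 4 * i2 ^ 2 * q1 - f 0 * (2 * i2 + 1) * h2
      · exact absurd (hf.symm.trans (pD_zero_of_nil hI _ ha hb hc)) ht0

end local17

section local18

variable {Z : Type*} [CommRing Z] [Fintype Z] [DecidableEq Z]

open Classical in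
lemma upper_count (hI : ∀ x y : Z, ¬ IsUnit x → ¬ IsUnit y → x * y = 0) {i2 i3 : Z} (h2 : 2 * i2 = 1) (h3 : 3 * i3 = 1)
    {t : Z} (ht : ¬ IsUnit t) (ht0 : t ≠ 0) {u i : ℕ} (hu : Fintype.card Zˣ = u) (hi : Fintype.card {x : Z // ¬ IsUnit x} = i) :
    (Finset.univ.filter fun f : Fin 4 → Z => pD (f 0) (f 1) (f 2) (f 3) = t).card ≤
      u * Fintype.card Z * u + 2 * (i * u * Fintype.card Z) := by
  have hsub : (Finset.univ.filter fun f : Fin 4 → Z => pD (f 0) (f 1) (f 2) (f 3) = t) ⊆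
      Finset.univ.image (Ph1 i2 i3 t) ∪ (Finset.univ.image (Ph2 i2 t) ∪ Finset.univ.image (Ph3 i2 t)) := by
    intro f hf
    have := upper_cover hI h2 h3 ht ht0 f (Finset.mem_filter.1 hf).2
    simpa only [Finset.mem_union, Finset.mem_image, Finset.mem_univ, true_and] using this
  refine (Finset.card_le_card hsub).trans ?_
  refine (Finset.card_union_le _ _).trans ?_
  have c1 : (Finset.univ.image (Ph1 i2 i3 t)).card ≤ u * Fintype.card Z * u := by
    refine Finset.card_image_le.trans (le_of_eq ?_)
    rw [Finset.card_univ, Fintype.card_prod, Fintype.card_prod, hu, mul_assoc]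
  have c2 : (Finset.univ.image (Ph2 i2 t)).card ≤ i * u * Fintype.card Z := by
    refine Finset.card_image_le.trans (le_of_eq ?_)
    rw [Finset.card_univ, Fintype.card_prod, Fintype.card_prod, hu, hi, mul_assoc]
  have c3 : (Finset.univ.image (Ph3 i2 t)).card ≤ i * u * Fintype.card Z := by
    refine Finset.card_image_le.trans (le_of_eq ?_)
    rw [Finset.card_univ, Fintype.card_prod, Fintype.card_prod, hu, hi, mul_assoc]
  have c4 := Finset.card_union_le (Finset.univ.image (Ph2 i2 t)) (Finset.univ.image (Ph3 i2 t))
  omega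

open Classical in
/-- class of a form -/
noncomputable def cls (f : Fin 4 → Z) : Fin 5 :=
  if IsUnit (f 0) then (if IsUnit (f 1 ^ 2 - 3 * f 0 * f 2) then 0 else 1) else
    if IsUnit (f 1) then 2 else if IsUnit (f 2) then 3 else 4

lemma Ph1_P {i2 i3 : Z} (h3 : 3 * i3 = 1) (z : Zˣ × Z × Zˣ) :
    (Ph1 i2 i3 0 z 1) ^ 2 - 3 * Ph1 i2 i3 0 z 0 * Ph1 i2 i3 0 z 2 = (z.2.2 : Z) ^ 2 := by
  obtain ⟨a, b, w⟩ := z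
  have haa : (a : Z) * ↑(a⁻¹) = 1 := Units.mul_inv a
  simp only [Ph1, Matrix.cons_val]
  generalize ((a⁻¹ : Zˣ) : Z) = a' at *
  linear_combination (-(b ^ 2 - w ^ 2)) * (3 * i3) * haa - (b ^ 2 - w ^ 2) * h3

lemma Ph1_G {i2 i3 : Z} (h3 : 3 * i3 = 1) (z : Zˣ × Z × Zˣ) :
    2 * (Ph1 i2 i3 0 z 1) ^ 3 - 9 * Ph1 i2 i3 0 z 0 * Ph1 i2 i3 0 z 1 * Ph1 i2 i3 0 z 2
      + 27 * (Ph1 i2 i3 0 z 0) ^ 2 * Ph1 i2 i3 0 z 3 = 2 * (z.2.2 : Z) ^ 3 := by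
  obtain ⟨a, b, w⟩ := z
  have haa : (a : Z) * ↑(a⁻¹) = 1 := Units.mul_inv a
  simp only [Ph1, Matrix.cons_val]
  generalize ((a⁻¹ : Zˣ) : Z) = a' at *
  generalize (b ^ 2 - (w ^ 2 + 27 * a ^ 2 * 0 * i2 ^ 2 * ↑w⁻¹ ^ 4)) * i3 * a' = c
  have e : (27 * a ^ 2 * i3 ^ 3 * a' ^ 2 : Z) = 1 := by
    have e1 : (3 * i3) ^ 3 * (a * a' : Z) ^ 2 = 1 := by rw [haa, h3]; ring
    linear_combination e1
  linear_combination (2 * w ^ 3 - 2 * b ^ 3 + 9 * a * b * c) * e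

lemma Ph1'_P {i3 : Z} (h3 : 3 * i3 = 1) (z : Zˣ × Z × {x : Z // ¬ IsUnit x} × {x : Z // ¬ IsUnit x}) :
    (Ph1' i3 z 1) ^ 2 - 3 * Ph1' i3 z 0 * Ph1' i3 z 2 = z.2.2.1 := by
  obtain ⟨a, b, P, G⟩ := z
  have haa : (a : Z) * ↑(a⁻¹) = 1 := Units.mul_inv a
  simp only [Ph1', Matrix.cons_val]
  generalize ((a⁻¹ : Zˣ) : Z) = a' at *
  linear_combination (-(b ^ 2 - P)) * (3 * i3) * haa - (b ^ 2 - P) * h3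

lemma Ph1'_G {i3 : Z} (h3 : 3 * i3 = 1) (z : Zˣ × Z × {x : Z // ¬ IsUnit x} × {x : Z // ¬ IsUnit x}) :
    2 * (Ph1' i3 z 1) ^ 3 - 9 * Ph1' i3 z 0 * Ph1' i3 z 1 * Ph1' i3 z 2
      + 27 * (Ph1' i3 z 0) ^ 2 * Ph1' i3 z 3 = z.2.2.2 := by
  obtain ⟨a, b, P, G⟩ := z
  have haa : (a : Z) * ↑(a⁻¹) = 1 := Units.mul_inv a
  simp only [Ph1', Matrix.cons_val]
  generalize ((a⁻¹ : Zˣ) : Z) = a' at *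
  generalize (b ^ 2 - (P : Z)) * i3 * a' = c
  have e : (27 * a ^ 2 * i3 ^ 3 * a' ^ 2 : Z) = 1 := by
    have e1 : (3 * i3) ^ 3 * (a * a' : Z) ^ 2 = 1 := by rw [haa, h3]; ring
    linear_combination e1
  linear_combination (G - 2 * b ^ 3 + 9 * a * b * c) * e

lemma pD_PG (a b c d : Z) : 27 * a ^ 2 * pD a b c d =
    4 * (b ^ 2 - 3 * a * c) ^ 3 - (2 * b ^ 3 - 9 * a * b * c + 27 * a ^ 2 * d) ^ 2 := by
  unfold pD; ring

lemma pD_zero_of {i3 : Z} (h3 : 3 * i3 = 1) (a : Zˣ) {b c d : Z}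
    (h : 4 * (b ^ 2 - 3 * a * c) ^ 3 - (2 * b ^ 3 - 9 * a * b * c + 27 * a ^ 2 * d) ^ 2 = 0) : pD (a : Z) b c d = 0 := by
  have haa : (a : Z) * ↑(a⁻¹) = 1 := Units.mul_inv a
  generalize ((a⁻¹ : Zˣ) : Z) = a' at *
  have e : (27 * a ^ 2 * i3 ^ 3 * a' ^ 2 : Z) = 1 := by
    have e1 : (3 * i3) ^ 3 * (a * a' : Z) ^ 2 = 1 := by rw [haa, h3]; ring
    linear_combination e1
  rw [← pD_PG] at h
  linear_combination i3 ^ 3 * a' ^ 2 * h - pD (a : Z) b c d * e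

open Classical in
lemma lower_count (hI : ∀ x y : Z, ¬ IsUnit x → ¬ IsUnit y → x * y = 0) (hn : ¬ IsUnit (0 : Z))
    {i2 i3 : Z} (h2 : 2 * i2 = 1) (h3 : 3 * i3 = 1)
    {u i : ℕ} (hu : Fintype.card Zˣ = u) (hi : Fintype.card {x : Z // ¬ IsUnit x} = i) :
     u * Fintype.card Z * (u + i ^ 2) + 2 * (i * u * Fintype.card Z) + i ^ 3 * Fintype.card Z ≤
    (Finset.univ.filter fun f : Fin 4 → Z => pD (f 0) (f 1) (f 2) (f 3) = 0).card := by
  set S := Finset.univ.filter fun f : Fin 4 → Z => pD (f 0) (f 1) (f 2) (f 3) = 0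
  have hcard := Finset.card_eq_sum_card_fiberwise (s := S) (t := Finset.univ) (f := cls) (fun f _ => Finset.mem_coe.2 (Finset.mem_univ _))
  rw [Fin.sum_univ_five] at hcard
  have c0 : u * Fintype.card Z * u ≤ (S.filter fun f => cls f = 0).card := by
    have : u * Fintype.card Z * u = (Finset.univ : Finset (Zˣ × Z × Zˣ)).card := by
      rw [Finset.card_univ, Fintype.card_prod, Fintype.card_prod, hu, mul_assoc]
    rw [this]
    refine Finset.card_le_card_of_injOn (Ph1 i2 i3 0) ?_ ?_
    · intro z _
      rw [Finset.mem_coe, Finset.mem_filter, Finset.mem_filter]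
      have hP := Ph1_P (i2 := i2) h3 z
      have hG := Ph1_G (i2 := i2) h3 z
      have h0 : Ph1 i2 i3 0 z 0 = (z.1 : Z) := rfl
      refine ⟨⟨Finset.mem_univ _, ?_⟩, ?_⟩
      · rw [h0] at hP hG ⊢
        apply pD_zero_of h3
        rw [hP, hG]; ring
      · rw [cls, hP, if_pos (by rw [h0]; exact z.1.isUnit), if_pos (z.2.2.isUnit.pow 2)]
    · intro z _ z' _ h
      have hP := Ph1_P (i2 := i2) h3 z
      have hG := Ph1_G (i2 := i2) h3 z
      rw [h] at hP hG
      have hP' := hP.symm.trans (Ph1_P (i2 := i2) h3 z')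
      have hG' := hG.symm.trans (Ph1_G (i2 := i2) h3 z')
      have h0 : (z.1 : Z) = z'.1 := congrFun h 0
      have h1 : z.2.1 = z'.2.1 := congrFun h 1
      have hww : (z.2.2 : Z) * ↑(z.2.2⁻¹) = 1 := Units.mul_inv _
      have hw : (z.2.2 : Z) = z'.2.2 := by
        generalize ((z.2.2⁻¹ : Zˣ) : Z) = w' at *
        have hG2 : (z.2.2 : Z) ^ 3 = z'.2.2 ^ 3 := by linear_combination i2 * hG' + ((z'.2.2 : Z) ^ 3 - (z.2.2 : Z) ^ 3) * h2
        have e3 : (z.2.2 : Z) ^ 2 * z.2.2 = z.2.2 ^ 2 * z'.2.2 := by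
          linear_combination hG2 - z'.2.2 * hP'
        linear_combination w' ^ 2 * e3 + (z'.2.2 - z.2.2 : Z) * (z.2.2 * w' + 1) * hww
      exact Prod.ext (Units.ext h0) (Prod.ext h1 (Units.ext hw))
  have c1 : u * Fintype.card Z * i ^ 2 ≤ (S.filter fun f => cls f = 1).card := by
    have : u * Fintype.card Z * i ^ 2 = (Finset.univ : Finset (Zˣ × Z × {x : Z // ¬ IsUnit x} × {x : Z // ¬ IsUnit x})).card := by
      rw [Finset.card_univ, Fintype.card_prod, Fintype.card_prod, Fintype.card_prod, hu, hi]; ring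
    rw [this]
    refine Finset.card_le_card_of_injOn (Ph1' i3) ?_ ?_
    · intro z _
      rw [Finset.mem_coe, Finset.mem_filter, Finset.mem_filter]
      have hP := Ph1'_P h3 z
      have hG := Ph1'_G h3 z
      have h0 : Ph1' i3 z 0 = (z.1 : Z) := rfl
      refine ⟨⟨Finset.mem_univ _, ?_⟩, ?_⟩
      · rw [h0] at hP hG ⊢
        apply pD_zero_of h3
        rw [hP, hG]
        linear_combination 4 * (z.2.2.1 : Z) * hI _ _ z.2.2.1.2 z.2.2.1.2 - hI _ _ z.2.2.2.2 z.2.2.2.2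
      · rw [cls, hP, if_pos (by rw [h0]; exact z.1.isUnit), if_neg z.2.2.1.2]
    · intro z _ z' _ h
      have hP := Ph1'_P h3 z
      have hG := Ph1'_G h3 z
      rw [h] at hP hG
      have hP' := hP.symm.trans (Ph1'_P h3 z')
      have hG' := hG.symm.trans (Ph1'_G h3 z')
      have h0 : (z.1 : Z) = z'.1 := congrFun h 0
      have h1 : z.2.1 = z'.2.1 := congrFun h 1
      exact Prod.ext (Units.ext h0) (Prod.ext h1 (Prod.ext (Subtype.ext hP') (Subtype.ext hG')))
  have hc : i * u * Fintype.card Z = (Finset.univ : Finset ({x : Z // ¬ IsUnit x} × Zˣ × Z)).card := by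
      rw [Finset.card_univ, Fintype.card_prod, Fintype.card_prod, hu, hi, mul_assoc]
  have c2 : i * u * Fintype.card Z ≤ (S.filter fun f => cls f = 2).card := by
    rw [hc]
    refine Finset.card_le_card_of_injOn (Ph2 i2 0) ?_ ?_
    · rintro ⟨⟨a, ha⟩, b, c⟩ _
      rw [Finset.mem_coe, Finset.mem_filter, Finset.mem_filter]
      refine ⟨⟨Finset.mem_univ _, ?_⟩, ?_⟩
      · have haa := hI _ _ ha ha
        have hbb : (b : Z) * ↑(b⁻¹) = 1 := Units.mul_inv b
        simp only [Ph2, Matrix.cons_val, sub_zero]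
        generalize ((b⁻¹ : Zˣ) : Z) = b' at *
        have e2 : (4 * b ^ 3 - 18 * a * b * c) * i2 ^ 2 * b' ^ 3 = 1 - 9 * a * c * i2 * b' ^ 2 := by
          have q1 : (b * b' : Z) ^ 3 = 1 := by rw [hbb]; ring
          linear_combination (2 * i2 + 1) * h2 + 4 * i2 ^ 2 * q1 - 18 * a * c * i2 ^ 2 * b' ^ 2 * hbb - 9 * a * c * i2 * b' ^ 2 * h2
        generalize hd : (b ^ 2 * c ^ 2 - 4 * a * c ^ 3 : Z) * (1 + 9 * a * c * i2 * b' ^ 2) * i2 ^ 2 * b' ^ 3 = d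
        have e3 : d * (4 * b ^ 3 - 18 * a * b * c) = b ^ 2 * c ^ 2 - 4 * a * c ^ 3 := by
          rw [← hd]
          linear_combination (b ^ 2 * c ^ 2 - 4 * a * c ^ 3 : Z) * (1 + 9 * a * c * i2 * b' ^ 2) * e2 - (b ^ 2 * c ^ 2 - 4 * a * c ^ 3 : Z) * 81 * c ^ 2 * i2 ^ 2 * b' ^ 4 * haa
        unfold pD
        linear_combination -e3 - 27 * d ^ 2 * haa
      · rw [cls, if_neg (by exact ha), if_pos (by exact b.isUnit)]
    · intro z _ z' _ h
      have h0 : (z.1 : Z) = z'.1 := congrFun h 0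
      have h1 : (z.2.1 : Z) = z'.2.1 := congrFun h 1
      have h2 : z.2.2 = z'.2.2 := congrFun h 2
      exact Prod.ext (Subtype.ext h0) (Prod.ext (Units.ext h1) h2)
  have c3 : i * u * Fintype.card Z ≤ (S.filter fun f => cls f = 3).card := by
    rw [hc]
    refine Finset.card_le_card_of_injOn (Ph3 i2 0) ?_ ?_
    · rintro ⟨⟨b, hb⟩, c, d⟩ _
      rw [Finset.mem_coe, Finset.mem_filter, Finset.mem_filter]
      refine ⟨⟨Finset.mem_univ _, ?_⟩, ?_⟩
      · have hbb := hI _ _ hb hb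
        simp only [Ph3, Matrix.cons_val]
        unfold pD
        linear_combination (c ^ 2 - 4 * b * d) * hbb
      · rw [cls, if_neg (by simpa [Ph3] using hn), if_neg (by exact hb), if_pos (by exact c.isUnit)]
    · intro z _ z' _ h
      have h0 : (z.1 : Z) = z'.1 := congrFun h 1
      have h1 : (z.2.1 : Z) = z'.2.1 := congrFun h 2
      have h2 : z.2.2 = z'.2.2 := congrFun h 3
      exact Prod.ext (Subtype.ext h0) (Prod.ext (Units.ext h1) h2)
  have c4 : i ^ 3 * Fintype.card Z ≤ (S.filter fun f => cls f = 4).card := by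
    have : i ^ 3 * Fintype.card Z = (Finset.univ : Finset ({x : Z // ¬ IsUnit x} × {x : Z // ¬ IsUnit x} × {x : Z // ¬ IsUnit x} × Z)).card := by
      rw [Finset.card_univ, Fintype.card_prod, Fintype.card_prod, Fintype.card_prod, hi]; ring
    rw [this]
    refine Finset.card_le_card_of_injOn (fun z => ![(z.1 : Z), z.2.1, z.2.2.1, z.2.2.2]) ?_ ?_
    · rintro ⟨⟨a, ha⟩, ⟨b, hb⟩, ⟨c, hc⟩, d⟩ _
      rw [Finset.mem_coe, Finset.mem_filter, Finset.mem_filter]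
      refine ⟨⟨Finset.mem_univ _, ?_⟩, ?_⟩
      · exact pD_zero_of_nil hI d ha hb hc
      · rw [cls, if_neg (by exact ha), if_neg (by exact hb), if_neg (by exact hc)]
    · intro z _ z' _ h
      have h0 : (z.1 : Z) = z'.1 := congrFun h 0
      have h1 : (z.2.1 : Z) = z'.2.1 := congrFun h 1
      have h2 : (z.2.2.1 : Z) = z'.2.2.1 := congrFun h 2
      have h3 : z.2.2.2 = z'.2.2.2 := congrFun h 3
      exact Prod.ext (Subtype.ext h0) (Prod.ext (Subtype.ext h1) (Prod.ext (Subtype.ext h2) h3))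
  rw [hcard]
  have : u * Fintype.card Z * (u + i ^ 2) = u * Fintype.card Z * u + u * Fintype.card Z * i ^ 2 := by ring
  omega

end local18

section local19

def QI {Z : Type*} [CommRing Z] (f : Fin 4 → Z) : Z := f 0 * f 3 - f 1 * f 2
def PRI {Z : Type*} [CommRing Z] (f : Fin 4 → Z) : Z := (f 1 ^ 2 - f 0 * f 2) * (f 2 ^ 2 - f 1 * f 3)
def QII {Z : Type*} [CommRing Z] (f : Fin 4 → Z) : Z := f 1 * f 2 - 9 * f 0 * f 3
def PRII {Z : Type*} [CommRing Z] (f : Fin 4 → Z) : Z := (f 1 ^ 2 - 3 * f 0 * f 2) * (f 2 ^ 2 - 3 * f 1 * f 3)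

def qq (k : Bool) {Z : Type*} [CommRing Z] (f : Fin 4 → Z) : Z :=
  match k with
  | true => pD (f 0) (f 1) (f 2) (f 3)
  | false => qD (f 0) (f 1) (f 2) (f 3)
def QQ (k : Bool) {Z : Type*} [CommRing Z] (f : Fin 4 → Z) : Z :=
  match k with
  | true => QII f
  | false => QI f
def PR (k : Bool) {Z : Type*} [CommRing Z] (f : Fin 4 → Z) : Z :=
  match k with
  | true => PRII f
  | false => PRI f

lemma map_qq (k : Bool) {Z W : Type*} [CommRing Z] [CommRing W] (φ : Z →+* W) (f : Fin 4 → Z) :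
    φ (qq k f) = qq k (fun i => φ (f i)) := by
  cases k <;> simp [qq, pD, qD, map_ofNat φ]
lemma map_QQ (k : Bool) {Z W : Type*} [CommRing Z] [CommRing W] (φ : Z →+* W) (f : Fin 4 → Z) :
    φ (QQ k f) = QQ k (fun i => φ (f i)) := by
  cases k <;> simp [QQ, QI, QII, map_ofNat φ]
lemma map_PR (k : Bool) {Z W : Type*} [CommRing Z] [CommRing W] (φ : Z →+* W) (f : Fin 4 → Z) :
    φ (PR k f) = PR k (fun i => φ (f i)) := by
  cases k <;> simp [PR, PRI, PRII, map_ofNat φ]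

/-- local condition -/
def Lc (k : Bool) (A : ℤ) (p : ℕ) {Z : Type*} [CommRing Z] (f : Fin 4 → Z) : Prop :=
  if p = 2 then (QQ k f = 0 ∧ PR k f = 1 ∨ QQ k f = 2 ∧ PR k f = 2) else
  if p = 3 then qq k f = 2 else
  if (p : ℤ) ∣ A then qq k f = ((4 * |A| : ℤ) : Z) else qq k f ≠ 0

/-- local modulus -/
def mm (p : ℕ) : ℕ := if p = 2 then 4 else if p = 3 then 3 else p ^ 2

open Classical in
/-- local density -/
noncomputable def lden (A : ℤ) (p : ℕ) : ℝ :=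
  if p = 2 then 3 / 32 else if p = 3 then 8 / 27 else
  if (p : ℤ) ∣ A then (1 - ((p : ℝ) ^ 2)⁻¹) * ((p : ℝ) ^ 2)⁻¹ else (1 - ((p : ℝ) ^ 2)⁻¹) ^ 2

variable {p : ℕ} (hp : p.Prime) (h5 : 5 ≤ p)

lemma zm_nu (hp : p.Prime) {x : ZMod (p ^ 2)} (hx : ¬ IsUnit x) : ∃ y, x = p * y := by
  haveI : NeZero (p ^ 2) := ⟨(pow_pos hp.pos 2).ne'⟩
  have h1 : ((x.val : ℕ) : ZMod (p ^ 2)) = x := ZMod.natCast_zmod_val x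
  rw [← h1, ZMod.isUnit_iff_coprime, Nat.coprime_pow_right_iff (by norm_num), Nat.coprime_comm,
    ← Nat.Prime.dvd_iff_not_coprime hp] at hx
  obtain ⟨y, hy⟩ := hx
  exact ⟨y, by rw [← h1, hy]; push_cast; ring⟩

lemma zm_nu' (hp : p.Prime) (y : ZMod (p ^ 2)) : ¬ IsUnit ((p : ZMod (p ^ 2)) * y) := by
  intro h
  have h' := isUnit_of_mul_isUnit_left h
  rw [ZMod.isUnit_iff_coprime, Nat.coprime_pow_right_iff (by norm_num), Nat.coprime_self] at h'
  exact hp.one_lt.ne' h'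

lemma zm_I (hp : p.Prime) (x y : ZMod (p ^ 2)) (hx : ¬ IsUnit x) (hy : ¬ IsUnit y) : x * y = 0 := by
  obtain ⟨a, rfl⟩ := zm_nu hp hx
  obtain ⟨b, rfl⟩ := zm_nu hp hy
  have : ((p : ℕ) : ZMod (p ^ 2)) ^ 2 = 0 := by
    have := ZMod.natCast_self (p ^ 2)
    rwa [Nat.cast_pow] at this
  linear_combination a * b * this

lemma zm_inv (hp : p.Prime) {n : ℕ} (h : n < p) (h0 : 0 < n) : ∃ i : ZMod (p ^ 2), (n : ZMod (p ^ 2)) * i = 1 := by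
  have : IsUnit ((n : ℕ) : ZMod (p ^ 2)) := by
    rw [ZMod.isUnit_iff_coprime]
    exact (Nat.coprime_of_lt_prime h0.ne' h hp).symm.pow_right 2
  exact this.exists_right_inv

lemma zm_cards (hp : p.Prime) : Nat.card (ZMod (p ^ 2))ˣ = p * (p - 1) ∧ Nat.card {x : ZMod (p ^ 2) // ¬ IsUnit x} = p := by
  classical
  haveI : NeZero (p ^ 2) := ⟨(pow_pos hp.pos 2).ne'⟩
  have h1 : Nat.card (ZMod (p ^ 2))ˣ = p * (p - 1) := by
    rw [Nat.card_eq_fintype_card, ZMod.card_units_eq_totient, Nat.totient_prime_pow hp (by norm_num)]; simp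
  refine ⟨h1, ?_⟩
  have h2 : Nat.card {x : ZMod (p ^ 2) // IsUnit x} = p * (p - 1) := by
    rw [← h1]
    refine (Nat.card_congr (Equiv.ofBijective (fun u : (ZMod (p ^ 2))ˣ => (⟨u, u.isUnit⟩ : {x : ZMod (p ^ 2) // IsUnit x})) ⟨?_, ?_⟩)).symm
    · intro a b h; exact Units.ext (congrArg Subtype.val h)
    · rintro ⟨x, u, rfl⟩; exact ⟨u, rfl⟩
  have h3 := Fintype.card_subtype_compl (fun x : ZMod (p ^ 2) => IsUnit x)
  rw [Nat.card_eq_fintype_card] at h2 ⊢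
  rw [h3, h2, ZMod.card]
  have : 1 ≤ p := hp.one_le
  obtain ⟨n, rfl⟩ := Nat.exists_eq_add_of_le this
  rw [Nat.add_sub_cancel_left, Nat.sub_eq_iff_eq_add (by nlinarith)]; ring

lemma pD_t (hp : p.Prime) (h5 : 5 ≤ p) {t : ZMod (p ^ 2)} (ht : ¬ IsUnit t) (ht0 : t ≠ 0) :
    Nat.card {f : Fin 4 → ZMod (p ^ 2) // pD (f 0) (f 1) (f 2) (f 3) = t} ≤ p ^ 4 * (p ^ 2 - 1) := by
  classical
  haveI : NeZero (p ^ 2) := ⟨(pow_pos hp.pos 2).ne'⟩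
  obtain ⟨i2, h2⟩ := zm_inv hp (n := 2) (by omega) (by norm_num)
  obtain ⟨i3, h3⟩ := zm_inv hp (n := 3) (by omega) (by norm_num)
  obtain ⟨c1, c2⟩ := zm_cards hp
  rw [Nat.card_eq_fintype_card] at c1 c2
  have := upper_count (zm_I hp) (i2 := i2) (i3 := i3) (by exact_mod_cast h2) (by exact_mod_cast h3) ht ht0 c1 (by convert c2)
  rw [Nat.card_eq_fintype_card, Fintype.card_subtype]
  convert this using 1
  rw [ZMod.card]
  obtain ⟨n, rfl⟩ := Nat.exists_eq_add_of_le hp.one_le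
  rw [Nat.add_sub_cancel_left, show (1 + n) ^ 2 - 1 = 2 * n + n ^ 2 by rw [Nat.sub_eq_iff_eq_add (by nlinarith)]; ring]
  ring

lemma pD_n0 (hp : p.Prime) (h5 : 5 ≤ p) :
    (Nat.card {f : Fin 4 → ZMod (p ^ 2) // pD (f 0) (f 1) (f 2) (f 3) ≠ 0} : ℝ) ≤ (p : ℝ) ^ 4 * ((p : ℝ) ^ 2 - 1) ^ 2 := by
  classical
  haveI : NeZero (p ^ 2) := ⟨(pow_pos hp.pos 2).ne'⟩
  haveI : Fact (1 < p ^ 2) := ⟨by nlinarith⟩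
  obtain ⟨i2, h2⟩ := zm_inv hp (n := 2) (by omega) (by norm_num)
  obtain ⟨i3, h3⟩ := zm_inv hp (n := 3) (by omega) (by norm_num)
  obtain ⟨c1, c2⟩ := zm_cards hp
  rw [Nat.card_eq_fintype_card] at c1 c2
  have := lower_count (zm_I hp) not_isUnit_zero (i2 := i2) (i3 := i3) (by exact_mod_cast h2) (by exact_mod_cast h3) c1 (by convert c2)
  have e1 := Fintype.card_subtype_compl (fun f : Fin 4 → ZMod (p ^ 2) => pD (f 0) (f 1) (f 2) (f 3) = 0)
  have e2 := Fintype.card_subtype_le (fun f : Fin 4 → ZMod (p ^ 2) => pD (f 0) (f 1) (f 2) (f 3) = 0)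
  have e3 : Fintype.card (Fin 4 → ZMod (p ^ 2)) = (p ^ 2) ^ 4 := by simp
  have e4 := Fintype.card_subtype (fun f : Fin 4 → ZMod (p ^ 2) => pD (f 0) (f 1) (f 2) (f 3) = 0)
  rw [Nat.card_eq_fintype_card]
  have e5 : (Fintype.card {f : Fin 4 → ZMod (p ^ 2) // pD (f 0) (f 1) (f 2) (f 3) ≠ 0} : ℝ) = ((p : ℝ) ^ 2) ^ 4 -
      (Finset.univ.filter fun f : Fin 4 → ZMod (p ^ 2) => pD (f 0) (f 1) (f 2) (f 3) = 0).card := by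
    have : Fintype.card {f : Fin 4 → ZMod (p ^ 2) // pD (f 0) (f 1) (f 2) (f 3) ≠ 0} +
      (Finset.univ.filter fun f : Fin 4 → ZMod (p ^ 2) => pD (f 0) (f 1) (f 2) (f 3) = 0).card = (p ^ 2) ^ 4 := by
      rw [← e4, ← e3]
      have e1' : Fintype.card {f : Fin 4 → ZMod (p ^ 2) // pD (f 0) (f 1) (f 2) (f 3) ≠ 0} = _ := e1
      rw [e1', Nat.sub_add_cancel e2]
    have h' : (Fintype.card {f : Fin 4 → ZMod (p ^ 2) // pD (f 0) (f 1) (f 2) (f 3) ≠ 0} : ℝ) +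
      (Finset.univ.filter fun f : Fin 4 → ZMod (p ^ 2) => pD (f 0) (f 1) (f 2) (f 3) = 0).card = ((p : ℝ) ^ 2) ^ 4 := by exact_mod_cast this
    linarith
  rw [e5]
  have h6 : (p : ℝ) ^ 4 * (2 * (p : ℝ) ^ 2 - 1) ≤ (Finset.univ.filter fun f : Fin 4 → ZMod (p ^ 2) => pD (f 0) (f 1) (f 2) (f 3) = 0).card := by
    have h7 : ((p * (p - 1) * (p ^ 2) * (p * (p - 1) + p ^ 2) + 2 * (p * (p * (p - 1)) * p ^ 2) + p ^ 3 * p ^ 2 : ℕ) : ℝ) ≤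
        (Finset.univ.filter fun f : Fin 4 → ZMod (p ^ 2) => pD (f 0) (f 1) (f 2) (f 3) = 0).card := by
      rw [ZMod.card] at this
      have t2 : (p * (p - 1) * (p ^ 2) * (p * (p - 1) + p ^ 2) + 2 * (p * (p * (p - 1)) * p ^ 2) + p ^ 3 * p ^ 2 : ℕ) ≤
        (Finset.univ.filter fun f : Fin 4 → ZMod (p ^ 2) => pD (f 0) (f 1) (f 2) (f 3) = 0).card := by convert this
      exact_mod_cast t2
    refine le_trans (le_of_eq ?_) h7
    push_cast [Nat.cast_sub hp.one_le]
    ring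
  nlinarith

end local19

section local20

lemma pD_qD {Z : Type*} [CommRing Z] (a b c d : Z) : pD a (3 * b) (3 * c) d = -27 * qD a b c d := by
  unfold pD qD; ring

lemma card_qp {Z : Type*} [CommRing Z] [Finite Z] {i3 : Z} (h3 : 3 * i3 = 1) (p q : Z → Prop)
    (h : ∀ z, p z → q (-27 * z)) :
    Nat.card {f : Fin 4 → Z // p (qD (f 0) (f 1) (f 2) (f 3))} ≤ Nat.card {f : Fin 4 → Z // q (pD (f 0) (f 1) (f 2) (f 3))} := by
  refine Nat.card_le_card_of_injective (fun f => ⟨![f.1 0, 3 * f.1 1, 3 * f.1 2, f.1 3], ?_⟩) ?_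
  · have := h _ f.2
    rw [← pD_qD] at this
    exact this
  · intro f g hfg
    have hfg := congrArg Subtype.val hfg
    have h0 : f.1 0 = g.1 0 := congrFun hfg 0
    have h1 : 3 * f.1 1 = 3 * g.1 1 := congrFun hfg 1
    have h2 : 3 * f.1 2 = 3 * g.1 2 := congrFun hfg 2
    have h4 : f.1 3 = g.1 3 := congrFun hfg 3
    have h1' : f.1 1 = g.1 1 := by linear_combination i3 * h1 + (g.1 1 - f.1 1) * h3
    have h2' : f.1 2 = g.1 2 := by linear_combination i3 * h2 + (g.1 2 - f.1 2) * h3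
    apply Subtype.ext
    funext i; fin_cases i <;> assumption

lemma qq_t (k : Bool) {p : ℕ} (hp : p.Prime) (h5 : 5 ≤ p) {t : ZMod (p ^ 2)} (ht : ¬ IsUnit t) (ht0 : t ≠ 0) :
    Nat.card {f : Fin 4 → ZMod (p ^ 2) // qq k f = t} ≤ p ^ 4 * (p ^ 2 - 1) := by
  haveI : NeZero (p ^ 2) := ⟨(pow_pos hp.pos 2).ne'⟩
  obtain ⟨i3, h3⟩ := zm_inv hp (n := 3) (by omega) (by norm_num)
  have h3' : (3 : ZMod (p ^ 2)) * i3 = 1 := by exact_mod_cast h3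
  cases k
  · refine (card_qp h3' (fun z => z = t) (fun z => z = t * (-27)) (fun z hz => by rw [hz]; ring)).trans
      (pD_t hp h5 (nu_mul ht) ?_)
    intro h
    apply ht0
    linear_combination (-i3 ^ 3) * h - t * (9 * i3 ^ 2 + 3 * i3 + 1) * h3'
  · exact pD_t hp h5 ht ht0

lemma qq_n0 (k : Bool) {p : ℕ} (hp : p.Prime) (h5 : 5 ≤ p) :
    (Nat.card {f : Fin 4 → ZMod (p ^ 2) // qq k f ≠ 0} : ℝ) ≤ (p : ℝ) ^ 4 * ((p : ℝ) ^ 2 - 1) ^ 2 := by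
  haveI : NeZero (p ^ 2) := ⟨(pow_pos hp.pos 2).ne'⟩
  obtain ⟨i3, h3⟩ := zm_inv hp (n := 3) (by omega) (by norm_num)
  have h3' : (3 : ZMod (p ^ 2)) * i3 = 1 := by exact_mod_cast h3
  cases k
  · refine le_trans ?_ (pD_n0 hp h5)
    exact_mod_cast card_qp h3' (fun z => z ≠ 0) (fun z => z ≠ 0) (fun z hz h => hz
      (by linear_combination (-i3 ^ 3) * h - z * (9 * i3 ^ 2 + 3 * i3 + 1) * h3'))
  · exact pD_n0 hp h5

lemma d2 (k : Bool) : Nat.card {f : Fin 4 → ZMod 4 // QQ k f = 0 ∧ PR k f = 1 ∨ QQ k f = 2 ∧ PR k f = 2} = 24 := by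
  rw [Nat.card_eq_fintype_card]
  revert k; decide +kernel

lemma d3 (k : Bool) : Nat.card {f : Fin 4 → ZMod 3 // qq k f = 2} = 24 := by
  rw [Nat.card_eq_fintype_card]
  cases k
  · simp only [qq, qD]; decide +kernel
  · simp only [qq, pD]; decide +kernel

theorem locdens (k : Bool) {A : ℤ} (hA : Squarefree A) {p m : ℕ} (hp : p.Prime) (hm : m = mm p) :
    (Nat.card {f : Fin 4 → ZMod m // Lc k A p f} : ℝ) ≤ lden A p * (m : ℝ) ^ 4 := by
  unfold Lc lden
  unfold mm at hm
  by_cases h2 : p = 2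
  · simp only [h2, if_true] at hm ⊢
    subst hm
    rw [d2]; norm_num
  by_cases h3 : p = 3
  · simp only [h3, if_true] at hm ⊢
    norm_num at hm ⊢
    subst hm
    rw [d3]; norm_num
  have h5 : 5 ≤ p := by
    have := hp.two_le
    by_contra hcon
    have : p = 4 := by omega
    subst this; revert hp; decide
  simp only [h2, h3, if_false] at hm ⊢
  subst hm
  have hp0 : (0 : ℝ) < p := by exact_mod_cast hp.pos
  by_cases hpA : (p : ℤ) ∣ A
  · simp only [hpA, if_true]
    have hne : (((4 * |A| : ℤ)) : ZMod (p ^ 2)) ≠ 0 := by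
      rw [Ne, ZMod.intCast_zmod_eq_zero_iff_dvd]
      intro h
      have h4 : IsCoprime (((p ^ 2 : ℕ)) : ℤ) 4 := by
        rw [show (4 : ℤ) = ((4 : ℕ) : ℤ) by rfl, Nat.isCoprime_iff_coprime]
        exact (Nat.coprime_of_lt_prime (by norm_num) (by omega) hp).pow_left 2
      have h6 := (dvd_abs _ _).1 (h4.dvd_of_dvd_mul_left h)
      push_cast at h6
      rw [sq] at h6
      have := Int.isUnit_iff.1 (hA _ h6)
      omega
    have hnu : ¬ IsUnit (((4 * |A| : ℤ)) : ZMod (p ^ 2)) := by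
      obtain ⟨c, hc⟩ := (dvd_abs _ _).2 hpA
      have := zm_nu' hp (4 * (c : ZMod (p ^ 2)))
      have e : ((4 * |A| : ℤ) : ZMod (p ^ 2)) = p * (4 * (c : ZMod (p ^ 2))) := by rw [hc]; push_cast; ring
      rwa [e]
    have := qq_t k hp h5 hnu hne
    have h7 : (Nat.card {f : Fin 4 → ZMod (p ^ 2) // qq k f = ((4 * |A| : ℤ) : ZMod (p ^ 2))} : ℝ) ≤ ((p ^ 4 * (p ^ 2 - 1) : ℕ) : ℝ) := by
      exact_mod_cast this
    refine h7.trans (le_of_eq ?_)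
    push_cast [Nat.cast_sub (Nat.one_le_pow 2 p hp.pos)]
    field_simp
  · simp only [hpA, if_false]
    refine (qq_n0 k hp h5).trans (le_of_eq ?_)
    push_cast
    field_simp

/-- primes below `n` as a finite type -/
abbrev Pr (n : ℕ) : Type := {p : ℕ // p ∈ Nat.primesBelow n}


lemma mm_pos {p : ℕ} (hp : p.Prime) : 0 < mm p := by
  unfold mm; split_ifs <;> first | exact pow_pos hp.pos 2 | norm_num

lemma mm_dvd (p : ℕ) : mm p ∣ p ^ 2 := by
  unfold mm; split_ifs with h1 h2
  · subst h1; norm_num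
  · subst h2; norm_num
  · exact dvd_rfl

lemma mm_coprime {p q : ℕ} (hp : p.Prime) (hq : q.Prime) (h : p ≠ q) : (mm p).Coprime (mm q) := by
  have h1 : (p ^ 2).Coprime (q ^ 2) := Nat.Coprime.pow 2 2 ((Nat.coprime_primes hp hq).2 h)
  exact Nat.Coprime.of_dvd (mm_dvd p) (mm_dvd q) h1

open Classical in
theorem crt (k : Bool) {A : ℤ} (hA : Squarefree A) (n : ℕ) : ∃ M : ℕ, 0 < M ∧ ∃ G : Finset (Fin 4 → ZMod M),
    (G.card : ℝ) / (M : ℝ) ^ 4 ≤ ∏ p ∈ Nat.primesBelow n, lden A p ∧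
    ∀ f : Fin 4 → ℤ, (∀ p ∈ Nat.primesBelow n, Lc k A p (fun i => (f i : ZMod (mm p)))) → rd M f ∈ G := by
  set a : Pr n → ℕ := fun p => mm p.1
  have hpr : ∀ p : Pr n, p.1.Prime := fun p => Nat.prime_of_mem_primesBelow p.2
  have hco : Pairwise (Function.onFun Nat.Coprime a) := by
    intro p q hpq
    exact mm_coprime (hpr p) (hpr q) (fun h => hpq (Subtype.ext h))
  have hM : 0 < ∏ p, a p := Finset.prod_pos fun p _ => mm_pos (hpr p)
  refine ⟨∏ p, a p, hM, ?_⟩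
  haveI : NeZero (∏ p, a p) := ⟨hM.ne'⟩
  haveI : ∀ p : Pr n, NeZero (a p) := fun p => ⟨(mm_pos (hpr p)).ne'⟩
  set E := ZMod.prodEquivPi a hco
  refine ⟨Finset.univ.filter fun w => ∀ p : Pr n, Lc k A p.1 (fun i => E (w i) p), ?_, ?_⟩
  · have hM4 : (0 : ℝ) < ((∏ p, a p : ℕ) : ℝ) ^ 4 := by positivity
    rw [div_le_iff₀ hM4]
    have h1 : (Finset.univ.filter fun w : Fin 4 → ZMod (∏ p, a p) => ∀ p : Pr n, Lc k A p.1 (fun i => E (w i) p)).card ≤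
        ∏ p : Pr n, Nat.card {f : Fin 4 → ZMod (a p) // Lc k A p.1 f} := by
      rw [← Nat.card_pi, ← Fintype.card_subtype, ← Nat.card_eq_fintype_card]
      refine Nat.card_le_card_of_injective (fun w p => ⟨fun i => E (w.1 i) p, w.2 p⟩) ?_
      intro w w' h
      apply Subtype.ext
      funext i
      apply E.injective
      funext p
      have := congrArg Subtype.val (congrFun h p)
      exact congrFun this i
    calc _ ≤ ((∏ p : Pr n, Nat.card {f : Fin 4 → ZMod (a p) // Lc k A p.1 f} : ℕ) : ℝ) := by exact_mod_cast h1
      _ = ∏ p : Pr n, (Nat.card {f : Fin 4 → ZMod (a p) // Lc k A p.1 f} : ℝ) := by push_cast; rfl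
      _ ≤ ∏ p : Pr n, (lden A p.1 * (a p : ℝ) ^ 4) :=
        Finset.prod_le_prod (fun p _ => by positivity) (fun p _ => locdens k hA (hpr p) rfl)
      _ = (∏ p ∈ Nat.primesBelow n, lden A p) * ((∏ p, a p : ℕ) : ℝ) ^ 4 := by
        rw [Finset.prod_mul_distrib, ← Finset.prod_coe_sort (Nat.primesBelow n), Finset.prod_pow]
        push_cast; rfl
  · intro f hf
    rw [Finset.mem_filter]
    refine ⟨Finset.mem_univ _, fun p => ?_⟩
    have : (fun i => E (rd _ f i) p) = fun i => ((f i : ℤ) : ZMod (a p)) := by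
      funext i
      simp only [rd, map_intCast]
      rfl
    rw [this]
    exact hf p.1 p.2

end local20

section local21

lemma QPR (k : Bool) (f : Fin 4 → ℤ) : QQ k f ^ 2 - 4 * PR k f = (if k then -3 else 1) * qq k f := by
  cases k
  · simp [QQ, PR, qq, QI, PRI, qD]; ring
  · simp [QQ, PR, qq, QII, PRII, pD]; ring

theorem Lc_of {k : Bool} {A D : ℤ} (hA0 : A < 0) (hA : A % 36 = 1 ∨ A % 36 = 25)
    (hD : Squarefree D) (hD1 : D ≡ 1 [ZMOD 12 * |A|]) {f : Fin 4 → ℤ} (hf : qq k f = 4 * (-A * D)) {p : ℕ} (hp : p.Prime) :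
    Lc k A p (fun i => (f i : ZMod (mm p))) := by
  have habs : |A| = -A := abs_of_neg hA0
  obtain ⟨c, hc⟩ := hD1.symm.dvd
  have hDc : D = 1 + 12 * |A| * c := by linarith
  have hN : -A * D = -A + 12 * (-A * |A| * c) := by rw [hDc]; ring
  have hN4 : (-A * D) % 4 = 3 := by rw [hN]; omega
  have hN3 : (-A * D) % 3 = 2 := by rw [hN]; omega
  have mq : ∀ m : ℕ, qq k (fun i => (f i : ZMod m)) = ((qq k f : ℤ) : ZMod m) := fun m =>
    (map_qq k (Int.castRingHom (ZMod m)) f).symm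
  unfold Lc
  split_ifs with h2 h3 hpA
  · subst h2
    have m1 : QQ k (fun i => (f i : ZMod 4)) = ((QQ k f : ℤ) : ZMod 4) := (map_QQ k (Int.castRingHom (ZMod 4)) f).symm
    have m2 : PR k (fun i => (f i : ZMod 4)) = ((PR k f : ℤ) : ZMod 4) := (map_PR k (Int.castRingHom (ZMod 4)) f).symm
    change QQ k (fun i => (f i : ZMod 4)) = 0 ∧ PR k (fun i => (f i : ZMod 4)) = 1 ∨
      QQ k (fun i => (f i : ZMod 4)) = 2 ∧ PR k (fun i => (f i : ZMod 4)) = 2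
    rw [m1, m2]
    have h := QPR k f
    rw [hf] at h
    generalize QQ k f = Q at h ⊢
    generalize PR k f = P at h ⊢
    generalize -A * D = N at *
    obtain ⟨K, hK, hK4⟩ : ∃ K : ℤ, Q ^ 2 = 4 * (P + K) ∧ K % 4 = 3 := by
      cases k
      · exact ⟨N, by simp at h; linarith, hN4⟩
      · exact ⟨-3 * N, by simp at h; linarith, by omega⟩
    have hQ : Even Q := by
      by_contra hodd
      rw [Int.not_even_iff_odd] at hodd
      have h1 := Int.sq_mod_four_eq_one_of_odd hodd
      omega
    obtain ⟨j, rfl⟩ := hQ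
    have hj : j ^ 2 = P + K := by linarith
    have c0 : ∀ z w : ℤ, z % 4 = w % 4 → (z : ZMod 4) = (w : ZMod 4) := fun z w h =>
      (ZMod.intCast_eq_intCast_iff z w 4).2 h
    rcases Int.even_or_odd' j with ⟨l, rfl | rfl⟩
    · left
      exact ⟨by exact_mod_cast c0 (2 * l + 2 * l) 0 (by omega), by
        refine (c0 P 1 ?_).trans (by norm_num)
        have : 4 * l ^ 2 = P + K := by linarith
        omega⟩
    · right
      exact ⟨(c0 _ 2 (by omega)).trans (by norm_num), by
        refine (c0 P 2 ?_).trans (by norm_num)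
        have : 4 * (l ^ 2 + l) + 1 = P + K := by linarith
        omega⟩
  · subst h3
    change qq k (fun i => (f i : ZMod 3)) = 2
    rw [mq, hf]
    refine ((ZMod.intCast_eq_intCast_iff _ 2 3).2 ?_).trans (by norm_num)
    change (4 * (-A * D)) % 3 = 2 % 3
    generalize -A * D = N at *
    omega
  · have hm : mm p = p ^ 2 := by simp [mm, h2, h3]
    rw [mq, hf, ZMod.intCast_eq_intCast_iff_dvd_sub, hm]
    obtain ⟨b, hb⟩ := hpA
    refine ⟨-(48 * b ^ 2 * c), ?_⟩
    rw [hDc, habs, hb]; push_cast; ring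
  · have hm : mm p = p ^ 2 := by simp [mm, h2, h3]
    rw [mq, hf, Ne, ZMod.intCast_zmod_eq_zero_iff_dvd, hm]
    intro h
    have hpz : Prime (p : ℤ) := Nat.prime_iff_prime_int.1 hp
    have h4 : ¬ (p : ℤ) ∣ 4 := by
      intro h4
      have : p ∣ 2 ^ 2 := by exact_mod_cast h4
      exact h2 ((Nat.prime_dvd_prime_iff_eq hp Nat.prime_two).1 (hp.dvd_of_dvd_pow this))
    have hco : IsCoprime (((p ^ 2 : ℕ)) : ℤ) (4 * A) := by
      push_cast
      refine IsCoprime.pow_left ((Prime.coprime_iff_not_dvd hpz).2 ?_)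
      intro h
      rcases hpz.dvd_or_dvd h with h | h
      · exact h4 h
      · exact hpA h
    have h6 : ((p ^ 2 : ℕ) : ℤ) ∣ (4 * A) * D := by
      have e : 4 * (-A * D) = -((4 * A) * D) := by ring
      rw [e, dvd_neg] at h; exact h
    have h7 := hco.dvd_of_dvd_mul_left h6
    push_cast at h7
    rw [sq] at h7
    have := Int.isUnit_iff.1 (hD _ h7)
    have := hp.two_le
    omega

end local21

section lower22
open Filter

/-- progression count -/
lemma ap_count {q : ℕ} (hq : 0 < q) (a x : ℕ) :
    |(((Finset.range x).filter (fun D => D ≡ a [MOD q])).card : ℝ) - x / q| ≤ 1 := by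
  have h1 : (((Finset.range x).filter (fun D => D ≡ a [MOD q])).card : ℤ) = ⌈((x : ℝ) - ((a % q : ℕ) : ℝ)) / q⌉ := by
    rw [← Nat.count_eq_card_filter_range]
    have := Nat.count_modEq_card_eq_ceil x hq a
    have h2 := congrArg (fun z : ℤ => z) this
    rw [this]
    have : (((x - (a % q : ℕ)) / q : ℚ) : ℝ) = ((x : ℝ) - ((a % q : ℕ) : ℝ)) / q := by push_cast; rfl
    rw [← this, Rat.ceil_cast]
  have h2 : (((Finset.range x).filter (fun D => D ≡ a [MOD q])).card : ℝ) = ((⌈((x : ℝ) - ((a % q : ℕ) : ℝ)) / q⌉ : ℤ) : ℝ) := by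
    exact_mod_cast h1
  rw [h2]
  have h3 := Int.le_ceil (((x : ℝ) - ((a % q : ℕ) : ℝ)) / q)
  have h4 := Int.ceil_lt_add_one (((x : ℝ) - ((a % q : ℕ) : ℝ)) / q)
  have h5 : ((a % q : ℕ) : ℝ) < q := by exact_mod_cast Nat.mod_lt a hq
  have hq' : (0 : ℝ) < q := by exact_mod_cast hq
  have h6 : ((a % q : ℕ) : ℝ) / q < 1 := by rw [div_lt_one hq']; exact h5
  have h7 : 0 ≤ ((a % q : ℕ) : ℝ) / q := by positivity
  rw [sub_div] at *
  rw [abs_le]; constructor <;> linarith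

open Classical in
lemma sieve (P : Finset ℕ) (hP : ∀ p ∈ P, p.Prime) : ∀ {q : ℕ}, 0 < q → (∀ p ∈ P, Nat.Coprime p q) → ∀ a : ℕ, ∃ C : ℝ, ∀ x : ℕ,
    |(((Finset.range x).filter (fun D => D ≡ a [MOD q] ∧ ∀ p ∈ P, ¬ p ^ 2 ∣ D)).card : ℝ) - x / q * ∏ p ∈ P, (1 - ((p : ℝ) ^ 2)⁻¹)| ≤ C := by
  induction P using Finset.induction_on with
  | empty => 
    intro q hq _ a
    refine ⟨1, fun x => ?_⟩
    have := ap_count hq a x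
    simpa using this
  | insert p P hpP ih =>
    intro q hq hco a
    have hp := hP p (by simp)
    have ih' := @ih (fun r hr => hP r (by simp [hr]))
    obtain ⟨C1, h1⟩ := ih' hq (fun r hr => hco r (by simp [hr])) a
    have hcop : Nat.Coprime q (p ^ 2) := (Nat.Coprime.pow_left 2 (hco p (by simp))).symm
    obtain ⟨b, hb1, hb2⟩ := Nat.chineseRemainder hcop a 0
    obtain ⟨C2, h2⟩ := @ih' (q * p ^ 2) (Nat.mul_pos hq (pow_pos hp.pos 2)) (by
      intro r hr
      refine Nat.Coprime.mul_right (hco r (by simp [hr])) (Nat.Coprime.pow_right 2 ?_)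
      refine (Nat.coprime_primes (hP r (by simp [hr])) hp).2 ?_
      rintro rfl; exact hpP hr) b
    refine ⟨C1 + C2, fun x => ?_⟩
    have hc : ((Finset.range x).filter (fun D => D ≡ a [MOD q] ∧ ∀ r ∈ P, ¬ r ^ 2 ∣ D)).card
        = ((Finset.range x).filter (fun D => D ≡ a [MOD q] ∧ ∀ r ∈ insert p P, ¬ r ^ 2 ∣ D)).card
        + ((Finset.range x).filter (fun D => D ≡ b [MOD q * p ^ 2] ∧ ∀ r ∈ P, ¬ r ^ 2 ∣ D)).card := by
      rw [← Finset.card_union_of_disjoint]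
      · congr 1
        ext D
        simp only [Finset.mem_union, Finset.mem_filter, Finset.mem_insert, forall_eq_or_imp]
        rw [← Nat.modEq_and_modEq_iff_modEq_mul hcop]
        have e1 : D ≡ b [MOD q] ↔ D ≡ a [MOD q] := ⟨fun h => h.trans hb1, fun h => h.trans hb1.symm⟩
        have e2 : D ≡ b [MOD p ^ 2] ↔ p ^ 2 ∣ D := by
          rw [← Nat.modEq_zero_iff_dvd]
          exact ⟨fun h => h.trans hb2, fun h => h.trans hb2.symm⟩
        rw [e1, e2]; tauto
      · rw [Finset.disjoint_left]
        intro D h3 h4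
        simp only [Finset.mem_filter, Finset.mem_insert, forall_eq_or_imp] at h3 h4
        rw [← Nat.modEq_and_modEq_iff_modEq_mul hcop] at h4
        exact h3.2.2.1 (Nat.modEq_zero_iff_dvd.1 (h4.2.1.2.trans hb2))
    have h1 := h1 x
    have h2 := h2 x
    rw [hc] at h1
    rw [Finset.prod_insert hpP]
    push_cast at h1 h2 ⊢
    rw [abs_le] at *
    have e : (x : ℝ) / (q * p ^ 2) = x / q * ((p : ℝ) ^ 2)⁻¹ := by
      rw [div_mul_eq_div_div, div_eq_mul_inv (_ / _)]
    rw [e] at h2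
    generalize ∏ p ∈ P, (1 - ((p : ℝ) ^ 2)⁻¹) = Q at *
    constructor <;> nlinarith

open Classical in
lemma tail_count (n x : ℕ) (hn : 0 < n) :
    (((Finset.range x).filter (fun D => D ≠ 0 ∧ ∃ m, n ≤ m ∧ m ^ 2 ∣ D)).card : ℝ) ≤ x * (2 / n) := by
  have h1 : ((Finset.range x).filter (fun D => D ≠ 0 ∧ ∃ m, n ≤ m ∧ m ^ 2 ∣ D)) ⊆
      (Finset.Ioo (n - 1) x).biUnion (fun m => (Finset.range x.succ).filter (fun k => k ≠ 0 ∧ m ^ 2 ∣ k)) := by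
    intro D hD
    simp only [Finset.mem_filter, Finset.mem_range, Finset.mem_biUnion, Finset.mem_Ioo] at hD ⊢
    obtain ⟨hx, h0, m, hm, hd⟩ := hD
    have := Nat.le_of_dvd (Nat.pos_of_ne_zero h0) hd
    have : m ≤ m ^ 2 := by nlinarith
    exact ⟨m, ⟨by omega, by omega⟩, by omega, h0, hd⟩
  have h2 := (Finset.card_le_card h1).trans Finset.card_biUnion_le
  simp only [Nat.card_multiples'] at h2
  have h3 : (∑ m ∈ Finset.Ioo (n - 1) x, ((x / m ^ 2 : ℕ) : ℝ)) ≤ x * ∑ m ∈ Finset.Ioo (n - 1) x, ((m : ℝ) ^ 2)⁻¹ := by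
    rw [Finset.mul_sum]
    refine Finset.sum_le_sum fun m _ => ?_
    rw [← div_eq_mul_inv]
    exact_mod_cast Nat.cast_div_le
  have h4 := sum_Ioo_inv_sq_le (α := ℝ) (n - 1) x
  have h5 : ((n - 1 : ℕ) : ℝ) + 1 = n := by
    have : n - 1 + 1 = n := by omega
    exact_mod_cast this
  rw [h5] at h4
  calc _ ≤ ((∑ m ∈ Finset.Ioo (n - 1) x, (x / m ^ 2 : ℕ) : ℕ) : ℝ) := by exact_mod_cast h2
    _ ≤ _ := by push_cast at h3 ⊢; exact h3.trans (mul_le_mul_of_nonneg_left h4 (by positivity))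

lemma Nplus_finite (X : ℝ) (m N : ℤ) : (Nplus X m N).Finite := by
  refine (Set.finite_Icc (0 : ℤ) ⌈X⌉).subset ?_
  rintro D ⟨h0, hX, -⟩
  exact ⟨h0.le, by exact_mod_cast hX.le.trans (Int.le_ceil X)⟩

theorem nplus_lower {A : ℤ} (hA : A ≠ 0) {n : ℕ} (hn : 0 < n) {e : ℝ} (he : 0 < e) : ∀ᶠ X : ℝ in atTop,
    X * ((∏ p ∈ (Nat.primesBelow n).filter (fun p => ¬ p ∣ 12 * A.natAbs), (1 - ((p : ℝ) ^ 2)⁻¹)) / (12 * A.natAbs) - 2 / n - e)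
     ≤ (Nat.card (Nplus X 1 (12 * |A|)) : ℝ) := by
  classical
  set q := 12 * A.natAbs with hq
  have hA' : 0 < A.natAbs := Int.natAbs_pos.2 hA
  have hq0 : 0 < q := by omega
  have hq1 : 12 ≤ q := by omega
  set P := (Nat.primesBelow n).filter (fun p => ¬ p ∣ q) with hPdef
  have hPp : ∀ p ∈ P, p.Prime := fun p hp => Nat.prime_of_mem_primesBelow (Finset.mem_filter.1 hp).1
  obtain ⟨C, hC⟩ := sieve P hPp hq0 (fun p hp => ((Nat.Prime.coprime_iff_not_dvd (hPp p hp)).2 (Finset.mem_filter.1 hp).2)) 1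
  have hBnn : 0 ≤ ∏ p ∈ P, (1 - ((p : ℝ) ^ 2)⁻¹) := by
    refine Finset.prod_nonneg fun p hp => ?_
    have : (1 : ℝ) ≤ (p : ℝ) ^ 2 := one_le_pow₀ (by exact_mod_cast (hPp p hp).one_lt.le)
    have := inv_le_one_of_one_le₀ this
    linarith
  filter_upwards [eventually_ge_atTop ((|C| + 3) / e), eventually_ge_atTop 0] with X hX hX0
  set x := ⌈X⌉₊ with hx
  have h1 := hC x
  have h2 := tail_count n x hn
  set T1 := (Finset.range x).filter (fun D => D ≡ 1 [MOD q] ∧ ∀ p ∈ P, ¬ p ^ 2 ∣ D) with hT1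
  set T2 := (Finset.range x).filter (fun D => D ≠ 0 ∧ ∃ m, n ≤ m ∧ m ^ 2 ∣ D) with hT2
  have h3 : ((T1 \ (T2 ∪ {1})).image (fun D : ℕ => (D : ℤ)) : Set ℤ) ⊆ Nplus X 1 (12 * |A|) := by
    intro z hz
    simp only [Finset.coe_image, Set.mem_image, Finset.mem_coe, Finset.mem_sdiff, Finset.mem_union, Finset.mem_singleton, hT1, hT2, Finset.mem_filter,
      Finset.mem_range, not_or] at hz
    obtain ⟨D, ⟨⟨hDx, hDq, hDP⟩, hD2, hD1⟩, rfl⟩ := hz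
    have hdq : ∀ p, p ∣ q → p ∣ D → p = 1 := by
      intro p h h'
      have := (Nat.modEq_zero_iff_dvd.2 h').symm.trans (hDq.of_dvd h)
      exact Nat.dvd_one.1 (Nat.modEq_zero_iff_dvd.1 this.symm)
    have hD0 : D ≠ 0 := by
      rintro rfl
      have := hdq q dvd_rfl (dvd_zero _)
      omega
    have hsf : Squarefree D := by
      rw [Nat.squarefree_iff_prime_squarefree]
      intro p hp hpd
      rw [← sq] at hpd
      by_cases hpn : n ≤ p
      · exact hD2 ⟨hDx, hD0, p, hpn, hpd⟩
      · refine hDP p (Finset.mem_filter.2 ⟨Nat.mem_primesBelow.2 ⟨by omega, hp⟩, ?_⟩) hpd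
        intro h
        exact hp.one_lt.ne' (hdq p h ((dvd_pow_self p two_ne_zero).trans hpd))
    have h4 : D % 4 = 1 := by
      have : D ≡ 1 [MOD 4] := hDq.of_dvd (Dvd.dvd.mul_right (by norm_num) _)
      exact this
    refine ⟨by omega, ?_, ⟨by exact_mod_cast hD1, Or.inl ⟨Int.squarefree_natCast.2 hsf, by omega⟩⟩, ?_⟩
    · have := Nat.lt_ceil.1 hDx
      exact_mod_cast this
    · have := (Int.natCast_modEq_iff).2 hDq
      rw [hq] at this
      push_cast at this
      exact this
  have h4 : (T1 \ (T2 ∪ {1})).card ≤ Nat.card (Nplus X 1 (12 * |A|)) := by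
    rw [Nat.card_coe_set_eq, ← Finset.card_image_of_injective _ (Nat.cast_injective : Function.Injective (fun D : ℕ => (D : ℤ))), ← Set.ncard_coe_finset]
    exact Set.ncard_le_ncard h3 (Nplus_finite _ _ _)
  have h5 : T1.card ≤ (T1 \ (T2 ∪ {1})).card + (T2.card + 1) := by
    have := Finset.card_le_card_sdiff_add_card (s := T1) (t := T2 ∪ {1})
    have h6 := Finset.card_union_le T2 {1}
    rw [Finset.card_singleton] at h6
    omega
  have h6 : (T1.card : ℝ) ≤ Nat.card (Nplus X 1 (12 * |A|)) + (T2.card + 1) := by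
    have : T1.card ≤ Nat.card (Nplus X 1 (12 * |A|)) + (T2.card + 1) := by omega
    exact_mod_cast this
  have hxX : X ≤ x := Nat.le_ceil X
  have hxX' : (x : ℝ) ≤ X + 1 := (Nat.ceil_lt_add_one hX0).le
  have h7 := (abs_le.1 h1).1
  have hCa := le_abs_self C
  have h8 : |C| + 3 ≤ X * e := by rwa [div_le_iff₀ he] at hX
  have hqr : ((q : ℕ) : ℝ) = 12 * A.natAbs := by rw [hq]; push_cast; rfl
  rw [hqr] at h7
  have h9 : X / (12 * A.natAbs) * ∏ p ∈ P, (1 - ((p : ℝ) ^ 2)⁻¹) ≤ x / (12 * A.natAbs) * ∏ p ∈ P, (1 - ((p : ℝ) ^ 2)⁻¹) := by gcongr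
  have h10 : (x : ℝ) * (2 / n) ≤ X * (2 / n) + 2 := by
    have : (1 : ℝ) ≤ n := by exact_mod_cast hn
    have : (2 : ℝ) / n ≤ 2 := div_le_self (by norm_num) this
    have : (0 : ℝ) ≤ 2 / n := by positivity
    nlinarith
  have h11 : X * ((∏ p ∈ P, (1 - ((p : ℝ) ^ 2)⁻¹)) / (12 * A.natAbs) - 2 / n - e) = X / (12 * A.natAbs) * ∏ p ∈ P, (1 - ((p : ℝ) ^ 2)⁻¹) - X * (2 / n) - X * e := by ring
  rw [h11]
  linarith

end lower22

section prod23
open Filter Topology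

/-- Euler factor at two -/
noncomputable def ww (p : ℕ) : ℝ := 1 - ((p : ℝ) ^ 2)⁻¹

lemma ww_nonneg {p : ℕ} (hp : p.Prime) : 0 ≤ ww p := by
  have : (1 : ℝ) ≤ (p : ℝ) ^ 2 := one_le_pow₀ (by exact_mod_cast hp.one_lt.le)
  have := inv_le_one_of_one_le₀ this
  unfold ww; linarith

lemma ww_le_one (p : ℕ) : ww p ≤ 1 := by
  unfold ww; have : 0 ≤ ((p : ℝ) ^ 2)⁻¹ := by positivity
  linarith

/-- product away from `6 A` -/
noncomputable def BB (A : ℤ) (n : ℕ) : ℝ := ∏ p ∈ (Nat.primesBelow n).filter (fun p => ¬ p ∣ 12 * A.natAbs), ww p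
/-- product away from `6` -/
noncomputable def EE (n : ℕ) : ℝ := ∏ p ∈ Nat.primesBelow n, (if p = 2 ∨ p = 3 then 1 else ww p)

lemma full_prod {n : ℕ} (hn : 4 ≤ n) : ∏ p ∈ Nat.primesBelow n, ww p = 2 / 3 * EE n := by
  have h2 : 2 ∈ Nat.primesBelow n := Nat.mem_primesBelow.2 ⟨by omega, Nat.prime_two⟩
  have h3 : 3 ∈ Nat.primesBelow n := Nat.mem_primesBelow.2 ⟨by omega, Nat.prime_three⟩
  have e : ∀ p ∈ Nat.primesBelow n, ww p = (if p = 2 then 3 / 4 else 1) * (if p = 3 then 8 / 9 else 1) * (if p = 2 ∨ p = 3 then 1 else ww p) := by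
    intro p _
    by_cases h2 : p = 2
    · subst h2; norm_num [ww]
    · by_cases h3 : p = 3
      · subst h3; norm_num [ww]
      · simp [h2, h3]
  rw [Finset.prod_congr rfl e, Finset.prod_mul_distrib, Finset.prod_mul_distrib, Finset.prod_ite_eq', Finset.prod_ite_eq', if_pos h2, if_pos h3, EE]
  norm_num

lemma EE_lim : Tendsto EE atTop (𝓝 (9 / Real.pi ^ 2)) := by
  have h := riemannZeta_eulerProduct (s := 2) (by norm_num)
  rw [riemannZeta_two] at h
  have h1 : Tendsto (fun n : ℕ => ∏ p ∈ Nat.primesBelow n, (ww p)⁻¹) atTop (𝓝 (Real.pi ^ 2 / 6)) := by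
    have h2 := (Complex.continuous_re.tendsto _).comp h
    have e : (((Real.pi : ℂ) ^ 2 / 6)).re = Real.pi ^ 2 / 6 := by
      have : ((Real.pi : ℂ) ^ 2 / 6) = ((Real.pi ^ 2 / 6 : ℝ) : ℂ) := by push_cast; rfl
      rw [this, Complex.ofReal_re]
    rw [e] at h2
    refine h2.congr fun n => ?_
    have : ∏ p ∈ Nat.primesBelow n, (1 - (p : ℂ) ^ (-2 : ℂ))⁻¹ = ((∏ p ∈ Nat.primesBelow n, (ww p)⁻¹ : ℝ) : ℂ) := by
      push_cast
      refine Finset.prod_congr rfl fun p _ => ?_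
      rw [Complex.cpow_neg]
      have : (p : ℂ) ^ (2 : ℂ) = (p : ℂ) ^ 2 := by exact_mod_cast Complex.cpow_natCast (p : ℂ) 2
      rw [this, ww]; push_cast; rfl
    simp only [Function.comp]
    rw [this, Complex.ofReal_re]
  have h2 := (h1.inv₀ (by positivity)).const_mul (3 / 2 : ℝ)
  have e : (3 / 2 : ℝ) * (Real.pi ^ 2 / 6)⁻¹ = 9 / Real.pi ^ 2 := by rw [inv_div]; ring
  rw [e] at h2
  refine h2.congr' ?_
  filter_upwards [eventually_ge_atTop 4] with n hn
  rw [Finset.prod_inv_distrib, inv_inv, full_prod hn]; ring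

lemma lden_prod {A : ℤ} (hA0 : A ≠ 0) (hsf : Squarefree A) (h2 : ¬ (2 : ℤ) ∣ A) (h3 : ¬ (3 : ℤ) ∣ A) {n : ℕ} (hn : 4 ≤ n) (hnA : A.natAbs < n) :
    ∏ p ∈ Nat.primesBelow n, lden A p = 1 / 36 * ((A.natAbs : ℝ) ^ 2)⁻¹ * BB A n * EE n := by
  classical
  have m2 : 2 ∈ Nat.primesBelow n := Nat.mem_primesBelow.2 ⟨by omega, Nat.prime_two⟩
  have m3 : 3 ∈ Nat.primesBelow n := Nat.mem_primesBelow.2 ⟨by omega, Nat.prime_three⟩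
  have e : ∀ p ∈ Nat.primesBelow n, lden A p = (if p = 2 then 3 / 32 else 1) * (if p = 3 then 8 / 27 else 1) * (if p ∣ A.natAbs then ((p : ℝ) ^ 2)⁻¹ else 1)
      * (if ¬ p ∣ 12 * A.natAbs then ww p else 1) * (if p = 2 ∨ p = 3 then 1 else ww p) := by
    intro p hp
    have hp := Nat.prime_of_mem_primesBelow hp
    have hd : (p : ℤ) ∣ A ↔ p ∣ A.natAbs := Int.natCast_dvd
    by_cases e2 : p = 2
    · subst e2
      have : ¬ 2 ∣ A.natAbs := by rw [← hd]; exact h2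
      have h' : 2 ∣ 12 * A.natAbs := Dvd.dvd.mul_right (by norm_num) _
      simp [lden, this, h']
    · by_cases e3 : p = 3
      · subst e3
        have : ¬ 3 ∣ A.natAbs := by rw [← hd]; exact h3
        have h' : 3 ∣ 12 * A.natAbs := Dvd.dvd.mul_right (by norm_num) _
        simp [lden, this, h']
      · have h12 : p ∣ 12 * A.natAbs ↔ p ∣ A.natAbs := by
          refine ⟨fun h => ?_, fun h => Dvd.dvd.mul_left h _⟩
          rcases hp.dvd_mul.1 h with h | h
          · exfalso
            have : p ∣ 2 ^ 2 * 3 := by simpa using h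
            rcases hp.dvd_mul.1 this with h | h
            · exact e2 ((Nat.prime_dvd_prime_iff_eq hp Nat.prime_two).1 (hp.dvd_of_dvd_pow h))
            · exact e3 ((Nat.prime_dvd_prime_iff_eq hp Nat.prime_three).1 h)
          · exact h
        by_cases hpA : p ∣ A.natAbs
        · simp [lden, e2, e3, hd, h12, hpA, ww]; ring
        · simp [lden, e2, e3, hd, h12, hpA, ww]; ring
  have hAp : ∏ p ∈ Nat.primesBelow n, (if p ∣ A.natAbs then ((p : ℝ) ^ 2)⁻¹ else 1) = ((A.natAbs : ℝ) ^ 2)⁻¹ := by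
    have hf : (Nat.primesBelow n).filter (fun p => p ∣ A.natAbs) = A.natAbs.primeFactors := by
      ext p
      simp only [Finset.mem_filter, Nat.mem_primesBelow, Nat.mem_primeFactors]
      constructor
      · rintro ⟨⟨-, h⟩, h'⟩; exact ⟨h, h', Int.natAbs_ne_zero.2 hA0⟩
      · rintro ⟨h, h', h''⟩
        exact ⟨⟨(Nat.le_of_dvd (Nat.pos_of_ne_zero h'') h').trans_lt hnA, h⟩, h'⟩
    rw [← Finset.prod_filter, hf, Finset.prod_inv_distrib, Finset.prod_pow]
    have := Nat.prod_primeFactors_of_squarefree (Int.squarefree_natAbs.2 hsf)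
    have h' : (∏ p ∈ A.natAbs.primeFactors, (p : ℝ)) = A.natAbs := by
      have h'' := congrArg (Nat.cast : ℕ → ℝ) this
      rwa [Nat.cast_prod] at h''
    rw [h']
  rw [Finset.prod_congr rfl e, Finset.prod_mul_distrib, Finset.prod_mul_distrib, Finset.prod_mul_distrib, Finset.prod_mul_distrib,
    Finset.prod_ite_eq', Finset.prod_ite_eq', if_pos m2, if_pos m3, hAp, ← Finset.prod_filter, BB, EE]
  norm_num

lemma EE_le_BB {A : ℤ} {n : ℕ} : EE n ≤ BB A n := by
  rw [BB, Finset.prod_filter, EE]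
  refine Finset.prod_le_prod ?_ ?_
  · intro p hp
    have := ww_nonneg (Nat.prime_of_mem_primesBelow hp)
    split_ifs <;> linarith
  · intro p hp
    have h1 := ww_le_one p
    by_cases h : p = 2 ∨ p = 3
    · have : p ∣ 12 * A.natAbs := by
        rcases h with rfl | rfl <;> exact Dvd.dvd.mul_right (by norm_num) _
      simp [h, this]
    · rw [if_neg h]
      split_ifs <;> linarith

lemma BB_le_one {A : ℤ} {n : ℕ} : BB A n ≤ 1 := by
  rw [BB]
  exact Finset.prod_le_one (fun p hp => ww_nonneg (Nat.prime_of_mem_primesBelow (Finset.mem_filter.1 hp).1)) (fun p _ => ww_le_one p)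

end prod23

section sum24
open Filter Topology

lemma nplus_mem {X : ℝ} {A D : ℤ} (h : D ∈ Nplus X 1 (12 * |A|)) :
    0 < D ∧ (D : ℝ) < X ∧ Squarefree D ∧ D ≡ 1 [ZMOD 12 * |A|] ∧ D % 12 = 1 := by
  obtain ⟨h0, hX, ⟨-, h1⟩, h2⟩ := h
  have h12 : D ≡ 1 [ZMOD 12] := h2.of_dvd (dvd_mul_right _ _)
  have h12' : D % 12 = 1 := h12
  refine ⟨h0, hX, ?_, h2, h12'⟩
  rcases h1 with h1 | ⟨m, hm, -⟩
  · exact h1.1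
  · omega

/-- the reduced forms attached to `D` -/
def SS (β γ ε s : ℝ) (k : Bool) (N : ℤ) : Set (Fin 4 → ℤ) := {f | Red β γ ε s f ∧ qq k f = 4 * N}

lemma redL_of {β γ ε s c : ℝ} {k : Bool} (hc : 0 < c)
    (hq : ∀ u v x y : ℝ, qq k (Phi β γ ε s u v x y) = c * (y ^ 6 * (u ^ 2 + v ^ 2) ^ 2)) {N : ℤ} {f : Fin 4 → ℤ} (hf : f ∈ SS β γ ε s k N)
    {L : ℝ} (hL : ((4 * N : ℤ) : ℝ) ≤ c * L ^ 4) : RedL β γ ε s L (1 / 2) f := by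
  obtain ⟨⟨u, v, x, y, hu, hy, hx, hxy, hP⟩, hN⟩ := hf
  refine ⟨u, v, x, y, hu, hy, hx, hxy, hP, ?_, ?_⟩
  · have h1 := map_qq k (Int.castRingHom ℝ) f
    have h2 : (fun i => (Int.castRingHom ℝ) (f i)) = Phi β γ ε s u v x y := hP
    rw [h2, hq, hN] at h1
    have h3 : ((4 * N : ℤ) : ℝ) = c * (y ^ 6 * (u ^ 2 + v ^ 2) ^ 2) := h1
    rw [h3] at hL
    exact le_of_mul_le_mul_left hL hc
  · have := abs_le.1 hx
    nlinarith

lemma SS_finite {β γ ε s c : ℝ} {k : Bool} (hβ : |β| ≤ 3) (hγ : |γ| ≤ 3) (hε : |ε| ≤ 3) (hs1 : 1 ≤ s) (hc : 0 < c)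
    (hq : ∀ u v x y : ℝ, qq k (Phi β γ ε s u v x y) = c * (y ^ 6 * (u ^ 2 + v ^ 2) ^ 2)) (N : ℤ) : (SS β γ ε s k N).Finite := by
  set t : ℝ := max 1 (((4 * N : ℤ) : ℝ) / c) with ht
  have h1 : 1 ≤ t := le_max_left _ _
  refine (RedL_finite hβ hγ hε hs1 t).subset fun f hf => redL_of hc hq hf ?_
  have h2 : ((4 * N : ℤ) : ℝ) / c ≤ t := le_max_right _ _
  rw [div_le_iff₀ hc] at h2
  have h3 : t ≤ t ^ 4 := le_self_pow₀ h1 (by norm_num)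
  nlinarith

theorem sumS {β γ ε s K c : ℝ} {k : Bool} (hK1 : 2*β*γ^2 - 6*ε*γ = K) (hK2 : -4*β^2*ε = K) (hβ : |β| ≤ 3) (hγ : |γ| ≤ 3) (hε : |ε| ≤ 3) (hs1 : 1 ≤ s) {si r : ℤ}
    (hs : (si : ℝ) = s) (hr : si * r = 3) (hinj : PhiInj β γ ε s) (hc : 0 < c)
    (hq : ∀ u v x y : ℝ, qq k (Phi β γ ε s u v x y) = c * (y ^ 6 * (u ^ 2 + v ^ 2) ^ 2))
    {A : ℤ} (hA0 : A < 0) (hsf : Squarefree A) (hA : A % 36 = 1 ∨ A % 36 = 25) (n : ℕ) {e : ℝ} (he : 0 < e) :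
    ∀ᶠ X : ℝ in atTop, ∑ D ∈ (Nplus_finite X 1 (12 * |A|)).toFinset, ((SS β γ ε s k (-A * D)).ncard : ℝ) ≤
      ((∏ p ∈ Nat.primesBelow n, lden A p) * (|K| / s ^ 2 * c⁻¹ * (Real.pi ^ 2 / 12)) + e) * (4 * A.natAbs * X) := by
  classical
  obtain ⟨M, hM, G, hG, hGf⟩ := crt k hsf n
  set R : ℝ := (c⁻¹) ^ ((1 : ℝ) / 4) with hR
  have hR0 : 0 ≤ R := Real.rpow_nonneg (by positivity) _
  have hR4 : R ^ 4 = c⁻¹ := by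
    rw [hR, ← Real.rpow_natCast, ← Real.rpow_mul (by positivity)]; norm_num
  have hcount := count hK1 hK2 hβ hγ hε hs1 hs hr hinj hR0 hM G he
  have hNA : (0 : ℝ) < A.natAbs := by
    have : 0 < A.natAbs := by omega
    exact_mod_cast this
  have hNA' : ((A.natAbs : ℕ) : ℝ) = -(A : ℝ) := by
    have : ((A.natAbs : ℕ) : ℤ) = -A := by omega
    calc ((A.natAbs : ℕ) : ℝ) = (((A.natAbs : ℕ) : ℤ) : ℝ) := by rw [Int.cast_natCast]
      _ = _ := by rw [this]; push_cast; rfl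
  have hl : Tendsto (fun X : ℝ => (4 * A.natAbs * X) ^ ((1 : ℝ) / 4)) atTop atTop :=
    (tendsto_rpow_atTop (by norm_num)).comp (tendsto_id.const_mul_atTop (by positivity))
  filter_upwards [hl.eventually hcount, eventually_ge_atTop 0] with X hX hX0
  set l : ℝ := (4 * A.natAbs * X) ^ ((1 : ℝ) / 4) with hldef
  have hl4 : l ^ 4 = 4 * A.natAbs * X := by
    rw [hldef, ← Real.rpow_natCast, ← Real.rpow_mul (by positivity)]; norm_num
  have hfin : ∀ D, (SS β γ ε s k (-A * D)).Finite := fun D => SS_finite hβ hγ hε hs1 hc hq _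
  set F := (Nplus_finite X 1 (12 * |A|)).toFinset.biUnion (fun D => (hfin D).toFinset) with hF
  have hFc : F.card = ∑ D ∈ (Nplus_finite X 1 (12 * |A|)).toFinset, (SS β γ ε s k (-A * D)).ncard := by
    rw [hF, Finset.card_biUnion]
    · exact Finset.sum_congr rfl fun D _ => (Set.ncard_eq_toFinset_card _ (hfin D)).symm
    · intro D _ D' _ hne
      change Disjoint _ _
      rw [Finset.disjoint_left]
      intro f h h'
      simp only [Set.Finite.mem_toFinset] at h h'
      have h1 := h.2.symm.trans h'.2
      apply hne
      have h2 : A * D = A * D' := by linarith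
      exact mul_left_cancel₀ hA0.ne h2
  have hFm : ∀ f ∈ F, ∃ D ∈ Nplus X 1 (12 * |A|), f ∈ SS β γ ε s k (-A * D) := by
    intro f hf
    simpa [hF] using hf
  have h1 := hX F (by
    intro f hf
    obtain ⟨D, hD, hfD⟩ := hFm f hf
    obtain ⟨h0, hDX, hDs, hD1, hD12⟩ := nplus_mem hD
    exact hGf f fun p hp => Lc_of hA0 hA hDs hD1 hfD.2 (Nat.prime_of_mem_primesBelow hp)) (by
    intro f hf
    obtain ⟨D, hD, hfD⟩ := hFm f hf
    obtain ⟨h0, hDX, hDs, hD1, hD12⟩ := nplus_mem hD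
    refine redL_of hc hq hfD ?_
    rw [mul_pow, hR4, hl4, ← mul_assoc c, mul_inv_cancel₀ hc.ne', one_mul, hNA']
    push_cast
    have hA' : (A : ℝ) < 0 := by exact_mod_cast hA0
    nlinarith)
  rw [hFc, hl4, hR4] at h1
  push_cast at h1
  refine h1.trans ?_
  gcongr

end sum24

section fin25
open Filter Topology

lemma final_bound {A : ℤ} (hA0 : A < 0) (hsf : Squarefree A) (hA : A % 36 = 1 ∨ A % 36 = 25) {δ : ℝ} (hδ : 0 < δ) :
    ∀ᶠ X : ℝ in atTop, ∑ D ∈ (Nplus_finite X 1 (12 * |A|)).toFinset, (mordellRank (-(A * D ^ 3)) : ℝ) ≤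
      (4 / 3 + δ) * (Nat.card (Nplus X 1 (12 * |A|)) : ℝ) := by
  set a : ℝ := ((A.natAbs : ℕ) : ℝ) with ha
  have ha1 : 1 ≤ a := by
    have : 1 ≤ A.natAbs := by omega
    rw [ha]; exact_mod_cast this
  have hpi := Real.pi_pos
  have hE1 : ∀ᶠ n : ℕ in atTop, EE n < 9 / Real.pi ^ 2 * (1 + 3 / 4 * δ) :=
    EE_lim.eventually_lt_const (by
      have : 0 < 9 / Real.pi ^ 2 := by positivity
      nlinarith)
  have hE2 : ∀ᶠ n : ℕ in atTop, 1 / 2 < EE n :=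
    EE_lim.eventually_const_lt (by
      rw [lt_div_iff₀ (by positivity)]
      have := Real.pi_lt_four
      nlinarith [Real.pi_lt_d2])
  have hE3 : ∀ᶠ n : ℕ in atTop, (2 / 3 + δ) * (2 / (n : ℝ)) < δ / (96 * a) := by
    have : Tendsto (fun n : ℕ => (2 / 3 + δ) * (2 / (n : ℝ))) atTop (𝓝 ((2 / 3 + δ) * 0)) :=
      (tendsto_const_div_atTop_nhds_zero_nat 2).const_mul _
    rw [mul_zero] at this
    exact this.eventually_lt_const (by positivity)
  obtain ⟨n, h1, h2, h3, h4, h5⟩ := (hE1.and (hE2.and (hE3.and ((eventually_ge_atTop 4).and (eventually_gt_atTop A.natAbs))))).exists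
  set e : ℝ := δ / (96 * a) / (2 / 3 + δ + 8 * a / 3) with he
  have he0 : 0 < e := by positivity
  have hee : e * (2 / 3 + δ + 8 * a / 3) = δ / (96 * a) := by
    rw [he]; exact div_mul_cancel₀ _ (by positivity)
  have hld := lden_prod hA0.ne hsf (by omega) (by omega) h4 h5
  have qI : ∀ u v x y : ℝ, qq false (Phi 1 1 1 3 u v x y) = 4 / 27 * (y ^ 6 * (u ^ 2 + v ^ 2) ^ 2) := by
    intro u v x y
    rw [← mul_assoc]; exact qD_Phi u v x y
  have qII : ∀ u v x y : ℝ, qq true (Phi 3 (-3) (-1) 1 u v x y) = 108 * (y ^ 6 * (u ^ 2 + v ^ 2) ^ 2) := by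
    intro u v x y
    rw [← mul_assoc]; exact pD_Phi u v x y
  have f1 : ∀ N, (S1 N).Finite := fun N => SS_finite (by norm_num) (by norm_num) (by norm_num) (by norm_num) (by norm_num) qI N
  have f2 : ∀ N, (S2 N).Finite := fun N => SS_finite (by norm_num) (by norm_num) (by norm_num) (by norm_num) (by norm_num) qII N
  have s1 := sumS (K := -4) (si := 3) (r := 1) (by norm_num) (by norm_num) (by norm_num) (by norm_num) (by norm_num) (by norm_num) (by norm_num) (by norm_num)
    PhiInj_I (by norm_num) qI hA0 hsf hA n he0
  have s2 := sumS (K := 36) (si := 1) (r := 3) (by norm_num) (by norm_num) (by norm_num) (by norm_num) (by norm_num) (by norm_num) (by norm_num) (by norm_num)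
    PhiInj_II (by norm_num) qII hA0 hsf hA n he0
  have hlow := nplus_lower hA0.ne (show 0 < n by omega) he0
  filter_upwards [s1, s2, hlow, eventually_ge_atTop 0] with X s1 s2 hlow hX
  set T := (Nplus_finite X 1 (12 * |A|)).toFinset with hT
  have hTc : (Nat.card (Nplus X 1 (12 * |A|)) : ℝ) = T.card := by
    rw [Nat.card_coe_set_eq, Set.ncard_eq_toFinset_card _ (Nplus_finite X 1 (12 * |A|))]
  have hsum : ∑ D ∈ T, (mordellRank (-(A * D ^ 3)) : ℝ) ≤
      (∑ D ∈ T, ((SS 1 1 1 3 false (-A * D)).ncard : ℝ)) / 6 + 2 / 3 * T.card + (∑ D ∈ T, ((SS 3 (-3) (-1) 1 true (-A * D)).ncard : ℝ)) / 2 := by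
    have : ∀ D ∈ T, (mordellRank (-(A * D ^ 3)) : ℝ) ≤ ((SS 1 1 1 3 false (-A * D)).ncard : ℝ) / 6 + 2 / 3 + ((SS 3 (-3) (-1) 1 true (-A * D)).ncard : ℝ) / 2 := by
      intro D hD
      obtain ⟨g0, -, gs, -, g12⟩ := nplus_mem ((Set.Finite.mem_toFinset _).1 hD)
      have := rank_bound (A := A) (D := D) (by omega) hA0 g0 (by omega) gs g12 (f1 _) (f2 _)
      have e1 : S1 (-A * D) = SS 1 1 1 3 false (-A * D) := rfl
      have e2 : S2 (-A * D) = SS 3 (-3) (-1) 1 true (-A * D) := rfl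
      rw [e1, e2] at this
      linarith
    refine (Finset.sum_le_sum this).trans (le_of_eq ?_)
    rw [Finset.sum_add_distrib, Finset.sum_add_distrib, Finset.sum_div, Finset.sum_div, Finset.sum_const, nsmul_eq_mul]
    ring
  rw [hld] at s1 s2
  rw [hTc] at hlow ⊢
  have hBE : EE n ≤ BB A n := EE_le_BB
  have hBdef : ∏ p ∈ (Nat.primesBelow n).filter (fun p => ¬ p ∣ 12 * A.natAbs), (1 - ((p : ℝ) ^ 2)⁻¹) = BB A n := rfl
  rw [hBdef] at hlow
  rw [← ha] at s1 s2 hlow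
  set B := BB A n
  set E := EE n
  refine hsum.trans ?_
  generalize (∑ D ∈ T, ((SS 1 1 1 3 false (-A * D)).ncard : ℝ)) = Sg1 at *
  generalize (∑ D ∈ T, ((SS 3 (-3) (-1) 1 true (-A * D)).ncard : ℝ)) = Sg2 at *
  generalize (T.card : ℝ) = t at *
  have k1 : Sg1 / 6 + Sg2 / 2 ≤ X * (B / (12 * a) * (2 / 27 * Real.pi ^ 2 * E) + 8 * a * e / 3) := by
    have : X * (B / (12 * a) * (2 / 27 * Real.pi ^ 2 * E) + 8 * a * e / 3) = 
      ((1 / 36 * (a ^ 2)⁻¹ * B * E * (|(-4 : ℝ)| / 3 ^ 2 * (4 / 27)⁻¹ * (Real.pi ^ 2 / 12)) + e) * (4 * a * X)) / 6 + 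
      ((1 / 36 * (a ^ 2)⁻¹ * B * E * (|(36 : ℝ)| / 1 ^ 2 * (108)⁻¹ * (Real.pi ^ 2 / 12)) + e) * (4 * a * X)) / 2 := by
      rw [abs_neg, abs_of_pos (by norm_num : (0 : ℝ) < 4), abs_of_pos (by norm_num : (0 : ℝ) < 36)]
      have : a ≠ 0 := by positivity
      field_simp
      ring
    rw [this]
    linarith
  have k2 : 2 / 27 * Real.pi ^ 2 * E ≤ 2 / 3 + δ / 2 := by
    have : 2 / 27 * Real.pi ^ 2 * (9 / Real.pi ^ 2 * (1 + 3 / 4 * δ)) = 2 / 3 + δ / 2 := by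
      field_simp; ring
    rw [← this]
    gcongr
  have hb : 1 / (24 * a) ≤ B / (12 * a) := by
    rw [div_le_div_iff₀ (by positivity) (by positivity)]
    nlinarith
  have hda : δ / 2 * (1 / (24 * a)) = δ / (96 * a) + δ / (96 * a) := by
    field_simp; ring
  generalize B / (12 * a) = b at *
  generalize δ / (96 * a) = d at *
  have hb0 : 0 ≤ b := le_trans (by positivity) hb
  have k3 : b * (2 / 27 * Real.pi ^ 2 * E) + 8 * a * e / 3 ≤ (2 / 3 + δ) * (b - 2 / n - e) := by
    have := mul_le_mul_of_nonneg_left k2 hb0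
    have := mul_le_mul_of_nonneg_left hb (show 0 ≤ δ / 2 by positivity)
    linarith
  have k4 := mul_le_mul_of_nonneg_left k3 hX
  have k5 := mul_le_mul_of_nonneg_left hlow (show 0 ≤ 2 / 3 + δ by positivity)
  linarith

end fin25

/-- Theorem 1.2 for `A < 0`: for a negative square-free integer `A ≡ 1` or `25 (mod 36)`,
the average rank of `E_D : y² = x³ - A·D³` over fundamental discriminants
`D ∈ N⁺(X, 1, 12|A|)` is at most `4/3` in the limsup as `X → ∞`. -/
theorem main_theorem_2_negative
    (A : ℤ) (hAneg : A < 0) (hAsf : Squarefree A)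
    (hAmod : A % 36 = 1 ∨ A % 36 = 25) :
    limsup (fun X : ℝ =>
      (∑ᶠ D ∈ Nplus X 1 (12 * |A|), (mordellRank (-(A * D ^ 3)) : ℝ)) /
        (Nat.card (Nplus X 1 (12 * |A|)) : ℝ)) atTop ≤ 4 / 3 := by
  refine le_of_forall_pos_le_add fun δ hδ => ?_
  refine Filter.limsup_le_of_le ?_ ?_
  · refine Filter.isCoboundedUnder_le_of_le Filter.atTop (x := 0) fun X => ?_
    refine div_nonneg (finsum_nonneg fun D => finsum_nonneg fun _ => ?_) ?_ <;> positivity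
  · filter_upwards [final_bound hAneg hAsf hAmod hδ] with X hX
    rw [finsum_mem_eq_finite_toFinset_sum _ (Nplus_finite X 1 (12 * |A|))]
    exact div_le_of_le_mul₀ (by positivity) (by positivity) hX
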